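/- Let ϱ(A) = #{a ∈ 𝕃^loc(A) : 𝔪(a)³ ≤ |a|·(log|a|)⁴·(log log|a|)} / #𝕃^loc(A). Then lim_{A→∞} ϱ(A) = 1. -/

import Mathlib

open Filter MeasureTheory Finset Topology
open scoped ENNReal

noncomputable section

/-- Euclidean norm of an integer quadruple. -/
def znorm (a : Fin 4 → ℤ) : ℝ := Real.sqrt (∑ i, ((a i : ℝ)) ^ 2)

/-- Euclidean norm of a natural-number quadruple. -/
def pnorm (x : Fin 4 → ℕ) : ℝ := Real.sqrt (∑ i, ((x i : ℝ)) ^ 2)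

/-- Sup-norm `|a| = maxᵢ |aᵢ|` of an integer quadruple. -/
def snorm (a : Fin 4 → ℤ) : ℕ := Finset.univ.sup fun i => (a i).natAbs

/-- Min of the absolute values of the coordinates. -/
def minAbs (a : Fin 4 → ℤ) : ℕ := Finset.univ.inf' Finset.univ_nonempty fun i => (a i).natAbs

/-- `a` is primitive: all coordinates nonzero and gcd of the coordinates is 1. -/
def IsPrimitive (a : Fin 4 → ℤ) : Prop := (∀ i, a i ≠ 0) ∧ Finset.univ.gcd a = 1

/-- `a` is locally solvable: it is primitive, its coordinates are not all of the same
sign, and for every prime `p` the congruence `⟨a,x⟩ ≡ 0 (mod p)` has a solution in the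
reduced residues mod `p`. -/
def IsLocSolv (a : Fin 4 → ℤ) : Prop :=
  IsPrimitive a ∧ ¬ ((∀ i, 0 < a i) ∨ (∀ i, a i < 0)) ∧
  ∀ p : ℕ, p.Prime → ∃ x : Fin 4 → (ZMod p)ˣ,
    ∑ i, (a i : ZMod p) * ((x i : (ZMod p)ˣ) : ZMod p) = 0

/-- The set `L(a)` of quadruples of primes solving `⟨a,p⟩ = 0`. -/
def Lsol (a : Fin 4 → ℤ) : Set (Fin 4 → ℕ) :=
  {p | (∀ i, (p i).Prime) ∧ ∑ i, a i * (p i : ℤ) = 0}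

/-- `𝔪(a)`: the minimum of `|p|` over prime solutions `p ∈ L(a)`, and `∞` if there is
no solution. -/
def mfrak (a : Fin 4 → ℤ) : ℝ≥0∞ :=
  ⨅ p ∈ Lsol a, ((Finset.univ.sup p : ℕ) : ℝ≥0∞)

/-- The condition `𝔪(a)³ ≤ |a|·(log |a|)⁴·(log log |a|)`. -/
def SmallSol (a : Fin 4 → ℤ) : Prop :=
  (mfrak a) ^ 3 ≤ ENNReal.ofReal ((snorm a : ℝ) * (Real.log (snorm a)) ^ 4 *
    Real.log (Real.log (snorm a)))

/-- `𝕃^loc(A)`. -/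
def LlocSet (A : ℝ) : Set (Fin 4 → ℤ) := {a | IsLocSolv a ∧ znorm a ≤ A}

/-- `𝕃(A)`. -/
def LSet (A : ℝ) : Set (Fin 4 → ℤ) := {a | IsPrimitive a ∧ znorm a ≤ A}

/-- `𝒫(B)`: quadruples of primes of sup-norm at most `B`. -/
def PP (B : ℝ) : Set (Fin 4 → ℕ) := {x | ∀ i, (x i).Prime ∧ (x i : ℝ) ≤ B}

/-- The counting function `N_a(B)`. -/
def NB (a : Fin 4 → ℤ) (B : ℝ) : ℝ :=
  (Real.log B) ^ 4 * (Set.ncard {x | x ∈ PP B ∧ ∑ i, a i * (x i : ℤ) = 0} : ℝ)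

/-- `w = log log B / log log log B`. -/
def wB (B : ℝ) : ℝ := Real.log (Real.log B) / Real.log (Real.log (Real.log B))

/-- `W = ∏_{p ≤ w} p^(⌈log w/log p⌉ + 1)`. -/
def WB (B : ℝ) : ℕ :=
  ∏ p ∈ Finset.filter Nat.Prime (Finset.range (⌊wB B⌋₊ + 1)),
    p ^ (⌈Real.log (wB B) / Real.log (p : ℝ)⌉₊ + 1)

/-- `rad(W) = ∏_{p ≤ w} p`. -/
def radWB (B : ℝ) : ℕ :=
  ∏ p ∈ Finset.filter Nat.Prime (Finset.range (⌊wB B⌋₊ + 1)), p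

/-- The local counting function `N_a^loc(B)`; the summation condition is
`a ∈ Λ_x^(W) ∩ 𝒞_x^(α)` with `α = log B`. -/
def NlocB (a : Fin 4 → ℤ) (B : ℝ) : ℝ :=
  (Real.log B) ^ 4 * (Real.log B * (WB B : ℝ) / znorm a) *
    ∑ᶠ x ∈ {x : Fin 4 → ℕ | x ∈ PP B ∧ ((WB B : ℤ) ∣ ∑ i, a i * (x i : ℤ)) ∧
      |∑ i, (x i : ℝ) * (a i : ℝ)| ≤ pnorm x * znorm a / (2 * Real.log B)},
      1 / pnorm x

/-- Gram determinant `‖u‖²‖v‖² − ⟨u,v⟩²` of a pair of real vectors. -/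
def gram2 (u v : Fin 4 → ℝ) : ℝ :=
  (∑ i, u i ^ 2) * (∑ i, v i ^ 2) - (∑ i, u i * v i) ^ 2

/-- Determinant of a rank-2 lattice `S ⊆ ℤ⁴`: for such a lattice it is the minimum of
`det(ℤu ⊕ ℤv) = √(‖u‖²‖v‖² − ⟨u,v⟩²)` over linearly independent pairs `u, v ∈ S`
(the minimum being attained precisely at bases of `S`). -/
def latDet2 (S : Set (Fin 4 → ℤ)) : ℝ :=
  sInf {d : ℝ | ∃ u ∈ S, ∃ v ∈ S,
    (∀ m n : ℤ, m • u + n • v = 0 → m = 0 ∧ n = 0) ∧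
    d = Real.sqrt (gram2 (fun i => (u i : ℝ)) (fun i => (v i : ℝ)))}

/-- `det(Λ_x ∩ Λ_y)` for quadruples of primes `x, y`. -/
def detXY (x y : Fin 4 → ℕ) : ℝ :=
  latDet2 {z | (∑ i, (x i : ℤ) * z i) = 0 ∧ (∑ i, (y i : ℤ) * z i) = 0}

/-- `Ω(B)`: pairs of distinct quadruples of primes of size at most `B`. -/
def OmegaB (B : ℝ) : Set ((Fin 4 → ℕ) × (Fin 4 → ℕ)) :=
  {p | p.1 ∈ PP B ∧ p.2 ∈ PP B ∧ p.1 ≠ p.2}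

/-- `E(B)`. -/
def EB (B : ℝ) : ℝ :=
  (Real.log B) ^ 8 * ∑ᶠ p ∈ OmegaB B, 1 / detXY p.1 p.2

/-- `𝒢(x,y)`: the gcd of the 2×2 minors of the matrix with columns `x, y`. -/
def Gcal (x y : Fin 4 → ℕ) : ℤ :=
  Finset.univ.gcd fun q : Fin 4 × Fin 4 =>
    (x q.1 : ℤ) * (y q.2 : ℤ) - (x q.2 : ℤ) * (y q.1 : ℤ)

/-- `Δ(x,y) = ‖x‖‖y‖/det(ℤx ⊕ ℤy)`. -/
def DeltaXY (x y : Fin 4 → ℕ) : ℝ :=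
  pnorm x * pnorm y / Real.sqrt (gram2 (fun i => (x i : ℝ)) (fun i => (y i : ℝ)))

/-- `ℰ_{x,y}(B) = min{1, Δ(x,y)²/α²} + 𝟏[𝒢(x,y) ∤ W/rad(W)]`. -/
def EcalXY (x y : Fin 4 → ℕ) (B : ℝ) : ℝ :=
  min 1 (DeltaXY x y ^ 2 / (Real.log B) ^ 2) +
  (if Gcal x y ∣ ((WB B / radWB B : ℕ) : ℤ) then 0 else 1)

/-- `F(B)`. -/
def FB (B : ℝ) : ℝ :=
  (Real.log B) ^ 8 * ∑ᶠ p ∈ OmegaB B, EcalXY p.1 p.2 B / detXY p.1 p.2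

/-- `ζ(2)`. -/
def zeta2 : ℝ := ∑' n : ℕ, (1 : ℝ) / (n + 1) ^ 2

/-- `{a ∈ ℤ⁴_prim : ‖a‖ ≤ A}` with `ℤ⁴_prim` the tuples of coprime coordinates. -/
def primA (A : ℝ) : Set (Fin 4 → ℤ) := {a | Finset.univ.gcd a = 1 ∧ znorm a ≤ A}

/-- `D(A,B)`. -/
def DAB (A B : ℝ) : ℝ :=
  (∑ᶠ a ∈ primA A, NB a B ^ 2) - (Real.log B) ^ 4 * ∑ᶠ a ∈ primA A, NB a B

/-- `Δ_a^mix(B)`. -/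
def DeltaMix (a : Fin 4 → ℤ) (B : ℝ) : ℝ :=
  (Real.log B) ^ 8 * (Real.log B * (WB B : ℝ) / znorm a) *
    ∑ᶠ x ∈ {x : Fin 4 → ℕ | x ∈ PP B ∧ ∑ i, a i * (x i : ℤ) = 0}, 1 / pnorm x

/-- `Δ_a^loc(B)`. -/
def DeltaLoc (a : Fin 4 → ℤ) (B : ℝ) : ℝ :=
  (Real.log B) ^ 8 * ((Real.log B) ^ 2 * (WB B : ℝ) ^ 2 / znorm a ^ 2) *
    ∑ᶠ x ∈ {x : Fin 4 → ℕ | x ∈ PP B ∧ ((WB B : ℤ) ∣ ∑ i, a i * (x i : ℤ)) ∧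
      |∑ i, (x i : ℝ) * (a i : ℝ)| ≤ pnorm x * znorm a / (2 * Real.log B)},
      1 / pnorm x ^ 2

/-- `D^mix(A,B)`. -/
def DmixAB (A B : ℝ) : ℝ :=
  (∑ᶠ a ∈ primA A, NB a B * NlocB a B) - ∑ᶠ a ∈ primA A, DeltaMix a B

/-- `D^loc(A,B)`. -/
def DlocAB (A B : ℝ) : ℝ :=
  (∑ᶠ a ∈ primA A, NlocB a B ^ 2) - ∑ᶠ a ∈ primA A, DeltaLoc a B

/-- `K(A,B)`. -/
def KAB (A B : ℝ) : ℝ :=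
  ∑ᶠ a ∈ primA A, ((Real.log B) ^ 4 * NB a B + DeltaMix a B + DeltaLoc a B)

/-- `τ(a,γ) = γ·vol({u ∈ 𝓑₄(1) ∩ ℝ⁴₊ : a ∈ 𝒞_u^(γ)})`. -/
def tauA (a : Fin 4 → ℤ) (γ : ℝ) : ℝ :=
  γ * (volume {u : Fin 4 → ℝ | Real.sqrt (∑ i, u i ^ 2) < 1 ∧ (∀ i, 0 < u i) ∧
      |∑ i, u i * (a i : ℝ)| ≤ Real.sqrt (∑ i, u i ^ 2) * znorm a / (2 * γ)}).toReal

/-- The singular integral `𝔍_a(B) = τ(a, log B)`. -/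
def Jfrak (a : Fin 4 → ℤ) (B : ℝ) : ℝ := tauA a (Real.log B)

/-- `σ(a,Q) = (Q/φ(Q)⁴)·#{b ∈ ((ℤ/Qℤ)^*)⁴ : ⟨a,b⟩ ≡ 0 mod Q}`. -/
def sigmaA (a : Fin 4 → ℤ) (Q : ℕ) : ℝ :=
  (Q : ℝ) / (Nat.totient Q : ℝ) ^ 4 *
    (Nat.card {b : Fin 4 → (ZMod Q)ˣ |
      ∑ i, (a i : ZMod Q) * ((b i : (ZMod Q)ˣ) : ZMod Q) = 0} : ℝ)

/-- The truncated singular series `𝔖_a(B) = σ(a, W)`. -/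
def Sfrak (a : Fin 4 → ℤ) (B : ℝ) : ℝ := sigmaA a (WB B)

end

namespace SmallPrimes

/-- The Fourier transform (on the half line) of the band-limited minorant `minorant`. -/
noncomputable def minorantWeight (u : ℝ) : ℝ :=
  (100 - Real.pi ^ 2) * ((1 - u) * Real.cos (Real.pi * u) + Real.sin (Real.pi * u) / Real.pi)
    + 2 * Real.pi * Real.sin (Real.pi * u)

/-- A band-limited function which is nonpositive outside `[-10, 10]` and has positive integral. -/
noncomputable def minorant (t : ℝ) : ℝ :=
  2 * ∫ u in (0 : ℝ)..1, minorantWeight u * Real.cos (u * t)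

lemma continuous_minorantWeight : Continuous minorantWeight := by
  unfold minorantWeight; fun_prop

lemma continuous_minorant : Continuous minorant := by
  unfold minorant
  refine continuous_const.mul ?_
  refine intervalIntegral.continuous_parametric_intervalIntegral_of_continuous' ?_ 0 1
  have := continuous_minorantWeight
  fun_prop

lemma minorant_identity (t : ℝ) :
    (Real.pi ^ 2 - t ^ 2) ^ 2 * minorant t =
      (100 - t ^ 2) * (4 * Real.pi ^ 2 * (1 + Real.cos t)) := by
  set P := Real.pi with hP
  have hP0 : P ≠ 0 := Real.pi_ne_zero
  set h : ℝ → ℝ := fun u => (1 - u) * Real.cos (P * u) + Real.sin (P * u) / P with hh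
  set A : ℝ → ℝ := fun u =>
    (100 - P ^ 2) * (2 * P * (-P * Real.cos (P * u) * Real.cos (u * t)
        - t * Real.sin (P * u) * Real.sin (u * t))
      - (P ^ 2 - t ^ 2) * ((-P * (1 - u) * Real.sin (P * u)) * Real.cos (u * t)
        + t * h u * Real.sin (u * t)))
      + 2 * P * (P ^ 2 - t ^ 2) * (-P * Real.cos (P * u) * Real.cos (u * t)
        - t * Real.sin (P * u) * Real.sin (u * t)) with hA
  have hs : ∀ u, HasDerivAt (fun u => Real.sin (P * u)) (Real.cos (P * u) * P) u := fun u => by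
    simpa using ((hasDerivAt_id u).const_mul P).sin
  have hc : ∀ u, HasDerivAt (fun u => Real.cos (P * u)) (-Real.sin (P * u) * P) u := fun u => by
    simpa using ((hasDerivAt_id u).const_mul P).cos
  have hst : ∀ u, HasDerivAt (fun u => Real.sin (u * t)) (Real.cos (u * t) * t) u := fun u => by
    simpa using ((hasDerivAt_id u).mul_const t).sin
  have hct : ∀ u, HasDerivAt (fun u => Real.cos (u * t)) (-Real.sin (u * t) * t) u := fun u => by
    simpa using ((hasDerivAt_id u).mul_const t).cos
  have h1u : ∀ u : ℝ, HasDerivAt (fun u : ℝ => 1 - u) (-1) u := fun u => by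
    simpa using (hasDerivAt_id u).const_sub 1
  have hhd : ∀ u, HasDerivAt h (-1 * Real.cos (P * u) + (1 - u) * (-Real.sin (P * u) * P)
      + Real.cos (P * u) * P / P) u := fun u =>
    ((h1u u).mul (hc u)).add ((hs u).div_const P)
  have key : ∀ u, HasDerivAt A
      ((P ^ 2 - t ^ 2) ^ 2 * (minorantWeight u * Real.cos (u * t))) u := by
    intro u
    have e1 := ((((hc u).const_mul (-P)).mul (hct u)).sub (((hs u).const_mul t).mul (hst u)))
    have e2 := ((((h1u u).const_mul (-P)).mul (hs u)).mul (hct u)).add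
      (((hhd u).const_mul t).mul (hst u))
    have e3 := (((e1.const_mul (2 * P)).sub (e2.const_mul (P ^ 2 - t ^ 2))).const_mul
      (100 - P ^ 2)).add (e1.const_mul (2 * P * (P ^ 2 - t ^ 2)))
    refine e3.congr_deriv ?_
    have hG : minorantWeight u = (100 - P ^ 2) * ((1 - u) * Real.cos (P * u) +
      Real.sin (P * u) / P) + 2 * P * Real.sin (P * u) := rfl
    rw [hG]
    simp only [hh, Pi.mul_apply]
    field_simp
    ring
  have hval := intervalIntegral.integral_eq_sub_of_hasDerivAt (a := 0) (b := 1)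
    (fun u _ => key u) (by
      have := continuous_minorantWeight
      exact Continuous.intervalIntegrable (by fun_prop) _ _)
  rw [intervalIntegral.integral_const_mul] at hval
  have : (P ^ 2 - t ^ 2) ^ 2 * minorant t = 2 * (A 1 - A 0) := by
    rw [← hval, minorant]; ring
  rw [this]
  simp only [hA, hh]
  simp [hP]
  ring

lemma minorant_eq_div {t : ℝ} (ht : 10 ≤ |t|) :
    minorant t = (100 - t ^ 2) * (4 * Real.pi ^ 2 * (1 + Real.cos t)) /
      (Real.pi ^ 2 - t ^ 2) ^ 2 := by
  have h1 : (100 : ℝ) ≤ t ^ 2 := by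
    have := abs_nonneg t
    rw [← sq_abs]; nlinarith
  have h2 : Real.pi ^ 2 < 10 := by nlinarith [Real.pi_lt_d2, Real.pi_pos]
  rw [eq_div_iff (pow_ne_zero 2 (by nlinarith)), mul_comm, minorant_identity]

lemma minorant_nonpos {t : ℝ} (ht : 10 ≤ |t|) : minorant t ≤ 0 := by
  rw [minorant_eq_div ht]
  have h1 : (100 : ℝ) ≤ t ^ 2 := by
    rw [← sq_abs]; nlinarith
  apply div_nonpos_of_nonpos_of_nonneg _ (sq_nonneg _)
  have h2 := Real.neg_one_le_cos t
  apply mul_nonpos_of_nonpos_of_nonneg (by linarith)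
  have := sq_nonneg Real.pi
  apply mul_nonneg (by linarith) (by linarith)

lemma exists_minorant_abs_le : ∃ C : ℝ, 0 < C ∧ ∀ t, |minorant t| ≤ C := by
  refine ⟨2 * (∫ u in (0 : ℝ)..1, |minorantWeight u|) + 1, ?_, fun t => ?_⟩
  · have : 0 ≤ ∫ u in (0 : ℝ)..1, |minorantWeight u| :=
      intervalIntegral.integral_nonneg (by norm_num) fun u _ => abs_nonneg _
    linarith
  · unfold minorant
    rw [abs_mul, abs_two]
    have hc := continuous_minorantWeight
    have h1 : |∫ u in (0 : ℝ)..1, minorantWeight u * Real.cos (u * t)| ≤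
        ∫ u in (0 : ℝ)..1, |minorantWeight u| := by
      refine (intervalIntegral.abs_integral_le_integral_abs (by norm_num)).trans ?_
      refine intervalIntegral.integral_mono_on (by norm_num)
        (Continuous.intervalIntegrable (by fun_prop) _ _)
        (Continuous.intervalIntegrable (by fun_prop) _ _) fun u _ => ?_
      rw [abs_mul]
      exact mul_le_of_le_one_right (abs_nonneg _) (Real.abs_cos_le_one _)
    linarith

lemma minorant_ge_of_abs_le_one {t : ℝ} (ht : |t| ≤ 1) : 59 ≤ minorant t := by
  have hid := minorant_identity t
  have h1 : t ^ 2 ≤ 1 := by rw [← sq_abs]; nlinarith [abs_nonneg t]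
  have h0 := sq_nonneg t
  have hc : 1 / 2 ≤ Real.cos t := by
    have := Real.one_sub_sq_div_two_le_cos (x := t); linarith
  have hp : (9.8 : ℝ) < Real.pi ^ 2 := by nlinarith [Real.pi_gt_d4]
  have hp2 : Real.pi ^ 2 < (9.9 : ℝ) := by nlinarith [Real.pi_lt_d4, Real.pi_pos]
  set Q := Real.pi ^ 2
  have hR : 99 * (4 * Q * (3 / 2)) ≤ (100 - t ^ 2) * (4 * Q * (1 + Real.cos t)) := by
    apply mul_le_mul (by linarith) _ (by nlinarith) (by linarith)
    apply mul_le_mul_of_nonneg_left (by linarith) (by linarith)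
  have hS : (Q - t ^ 2) ^ 2 ≤ Q ^ 2 := by nlinarith
  have hS0 : 0 < (Q - t ^ 2) ^ 2 := by apply pow_pos; linarith
  by_contra hlt
  push Not at hlt
  have : (Q - t ^ 2) ^ 2 * minorant t ≤ (Q - t ^ 2) ^ 2 * 59 := by gcongr
  nlinarith

lemma minorant_ge_of_ten_le {t : ℝ} (ht : 10 ≤ |t|) : -90 / t ^ 2 ≤ minorant t := by
  rw [minorant_eq_div ht]
  have h1 : (100 : ℝ) ≤ t ^ 2 := by
    rw [← sq_abs]; nlinarith
  have hp2 : Real.pi ^ 2 < (9.9 : ℝ) := by nlinarith [Real.pi_lt_d4, Real.pi_pos]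
  have hp0 : 0 < Real.pi ^ 2 := by have := Real.pi_pos; positivity
  set Q := Real.pi ^ 2
  rw [div_le_div_iff₀ (by linarith) (by have : Q - t ^ 2 ≠ 0 := by linarith
                                        positivity)]
  have hc := Real.cos_le_one t
  have : (t ^ 2 - 100) * (4 * Q * (1 + Real.cos t)) ≤ (t ^ 2 - 100) * (4 * 9.9 * 2) := by
    apply mul_le_mul_of_nonneg_left _ (by linarith)
    have := Real.neg_one_le_cos t
    apply mul_le_mul (by linarith) (by linarith) (by linarith) (by norm_num)
  set s := t ^ 2
  nlinarith

lemma minorant_nonneg {t : ℝ} (ht : |t| ≤ 10) : 0 ≤ minorant t := by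
  have key : ∀ s : ℝ, |s| ≤ 10 → |s| ≠ Real.pi → 0 ≤ minorant s := by
    intro s hs hne
    have hid := minorant_identity s
    have h1 : s ^ 2 ≤ 100 := by rw [← sq_abs]; nlinarith [abs_nonneg s]
    have hne2 : Real.pi ^ 2 - s ^ 2 ≠ 0 := by
      intro h
      apply hne
      have : |s| ^ 2 = Real.pi ^ 2 := by rw [sq_abs]; linarith
      exact (pow_left_inj₀ (abs_nonneg s) Real.pi_pos.le (by norm_num)).1 this
    have hpos : 0 < (Real.pi ^ 2 - s ^ 2) ^ 2 := by positivity
    have hR : 0 ≤ (100 - s ^ 2) * (4 * Real.pi ^ 2 * (1 + Real.cos s)) := by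
      have := Real.neg_one_le_cos s
      apply mul_nonneg (by linarith)
      apply mul_nonneg (by positivity) (by linarith)
    rw [← hid] at hR
    exact nonneg_of_mul_nonneg_right hR hpos
  by_cases hne : |t| = Real.pi
  · have hu : ∀ n : ℕ, 0 ≤ minorant (t * (1 - 1 / (n + 2 : ℝ))) := by
      intro n
      have hn : (0 : ℝ) < 1 / (n + 2 : ℝ) := by positivity
      have hn1 : 1 / (n + 2 : ℝ) < 1 := by
        rw [div_lt_one (by positivity)]; linarith [(Nat.cast_nonneg n : (0 : ℝ) ≤ n)]
      have he : |t * (1 - 1 / (n + 2 : ℝ))| = |t| * (1 - 1 / (n + 2 : ℝ)) := by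
        rw [abs_mul, abs_of_pos (by linarith : 0 < 1 - 1 / (n + 2 : ℝ))]
      apply key
      · rw [he]; nlinarith [abs_nonneg t]
      · rw [he, hne]; nlinarith [Real.pi_pos]
    have hl : Tendsto (fun n : ℕ => minorant (t * (1 - 1 / (n + 2 : ℝ)))) atTop
        (𝓝 (minorant t)) := by
      have : Tendsto (fun n : ℕ => t * (1 - 1 / (n + 2 : ℝ))) atTop (𝓝 (t * (1 - 0))) := by
        refine (Tendsto.const_sub 1 ?_).const_mul t
        have := (tendsto_one_div_add_atTop_nhds_zero_nat (𝕜 := ℝ)).comp (tendsto_add_atTop_nat 1)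
        refine this.congr fun n => ?_
        simp only [Function.comp]; push_cast; ring_nf
      rw [sub_zero, mul_one] at this
      exact (continuous_minorant.tendsto t).comp this
    exact ge_of_tendsto' hl hu
  · exact key t ht hne

/-- The tail `s ↦ s⁻²` on `|s| > 10`. -/
noncomputable def tailSq (s : ℝ) : ℝ := (Set.Ioi (10 : ℝ)).indicator (fun s => s ^ (-2 : ℝ)) s

lemma tailSq_integrable : Integrable tailSq :=
  (integrableOn_Ioi_rpow_of_lt (by norm_num) (by norm_num)).integrable_indicator measurableSet_Ioi

lemma integral_tailSq : ∫ s, tailSq s = 1 / 10 := by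
  unfold tailSq
  rw [integral_indicator measurableSet_Ioi, integral_Ioi_rpow_of_lt (by norm_num) (by norm_num)]
  rw [show (-2 : ℝ) + 1 = -1 by norm_num, Real.rpow_neg_one]; norm_num

lemma tailSq_nonneg (s : ℝ) : 0 ≤ tailSq s := by
  unfold tailSq
  apply Set.indicator_nonneg
  intro x hx
  exact Real.rpow_nonneg (by have := Set.mem_Ioi.1 hx; linarith) _

lemma minorant_ge (s : ℝ) :
    (Set.Icc (-1 : ℝ) 1).indicator (fun _ => (59 : ℝ)) s - 90 * (tailSq s + tailSq (-s))
      ≤ minorant s := by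
  by_cases h1 : |s| ≤ 1
  · have h2 := minorant_ge_of_abs_le_one h1
    rw [Set.indicator_of_mem (by rw [Set.mem_Icc]; exact abs_le.1 h1)]
    have := tailSq_nonneg s
    have := tailSq_nonneg (-s)
    linarith
  · rw [Set.indicator_of_notMem (by rw [Set.mem_Icc]; exact fun h => h1 (abs_le.2 h))]
    by_cases h2 : |s| ≤ 10
    · have := minorant_nonneg h2
      have := tailSq_nonneg s
      have := tailSq_nonneg (-s)
      linarith
    · push Not at h2
      have h3 := minorant_ge_of_ten_le h2.le
      suffices h : 1 / s ^ 2 ≤ tailSq s + tailSq (-s) by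
        have : -90 / s ^ 2 = - 90 * (1 / s ^ 2) := by ring
        linarith
      have hp : ∀ x : ℝ, 10 < x → tailSq x = 1 / x ^ 2 := by
        intro x hx
        unfold tailSq
        rw [Set.indicator_of_mem (Set.mem_Ioi.2 hx), Real.rpow_neg (by linarith)]
        norm_num
      rcases lt_abs.1 h2 with h | h
      · rw [hp s h]; linarith [tailSq_nonneg (-s)]
      · rw [hp (-s) h]; rw [neg_sq]; linarith [tailSq_nonneg s]

lemma integral_exp_mul_minorant_ge {lam ε Y : ℝ} (hl : 0 < lam) (hε : 0 < ε) (hY : 1 < lam * Y) :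
    (118 * Real.exp (-(ε * (Y + 1 / lam))) - 18) / lam ≤
      ∫ t in Set.Ioi (0 : ℝ), Real.exp (-(ε * t)) * minorant (lam * (t - Y)) := by
  set E := Real.exp (-(ε * (Y + 1 / lam))) with hE
  obtain ⟨C, hC0, hC⟩ := exists_minorant_abs_le
  have hexp : IntegrableOn (fun t : ℝ => Real.exp (-(ε * t))) (Set.Ioi 0) := by
    simpa only [neg_mul] using integrableOn_exp_mul_Ioi (neg_lt_zero.2 hε) 0
  have hval : IntegrableOn (fun t : ℝ => Real.exp (-(ε * t)) * minorant (lam * (t - Y)))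
      (Set.Ioi 0) := by
    refine Integrable.mul_bdd (c := C) hexp ?_ ?_
    · exact (continuous_minorant.comp (by fun_prop)).aestronglyMeasurable
    · exact ae_of_all _ fun t => hC _
  set r : ℝ → ℝ := fun s => tailSq s + tailSq (-s) with hr
  have hri : Integrable r := tailSq_integrable.add tailSq_integrable.comp_neg
  have hrint : ∫ s, r s = 1 / 5 := by
    rw [hr, integral_add tailSq_integrable tailSq_integrable.comp_neg,
      integral_neg_eq_self, integral_tailSq]; norm_num
  have hr0 : ∀ s, 0 ≤ r s := fun s => add_nonneg (tailSq_nonneg _) (tailSq_nonneg _)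
  have hrY : Integrable (fun t => r (lam * (t - Y))) :=
    (hri.comp_mul_left' hl.ne').comp_sub_right Y
  have hrYi : ∫ t, r (lam * (t - Y)) = 1 / 5 / lam := by
    rw [integral_sub_right_eq_self (fun t => r (lam * t)) Y, Measure.integral_comp_mul_left,
      hrint, abs_of_pos (by positivity)]
    simp; ring
  set I := Set.Icc (Y - 1 / lam) (Y + 1 / lam) with hI
  have hIs : I ⊆ Set.Ioi 0 := by
    intro t ht
    have h1 : 1 / lam < Y := by rw [div_lt_iff₀ hl]; linarith
    have := ht.1
    rw [Set.mem_Ioi]; linarith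
  have hii : Integrable (I.indicator (fun _ => 59 * E)) := by
    rw [integrable_indicator_iff measurableSet_Icc]
    exact integrableOn_const (by simp)
  have hle : ∫ t in Set.Ioi (0 : ℝ), (I.indicator (fun _ => 59 * E) t - 90 * r (lam * (t - Y))) ≤
      ∫ t in Set.Ioi (0 : ℝ), Real.exp (-(ε * t)) * minorant (lam * (t - Y)) := by
    refine setIntegral_mono_on (hii.sub (hrY.const_mul 90)).integrableOn hval measurableSet_Ioi ?_
    intro t ht
    have ht0 : 0 < t := ht
    have hm := minorant_ge (lam * (t - Y))
    have hexp1 : Real.exp (-(ε * t)) ≤ 1 := Real.exp_le_one_iff.2 (by nlinarith)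
    have hexp0 := Real.exp_pos (-(ε * t))
    by_cases htI : t ∈ I
    · rw [Set.indicator_of_mem htI]
      have hmem : |lam * (t - Y)| ≤ 1 := by
        rw [abs_mul, abs_of_pos hl, ← le_div_iff₀' hl, abs_le]
        constructor <;> linarith [htI.1, htI.2]
      have h59 := minorant_ge_of_abs_le_one hmem
      have hEt : E ≤ Real.exp (-(ε * t)) := by
        rw [hE, Real.exp_le_exp]; nlinarith [htI.2]
      have := hr0 (lam * (t - Y))
      nlinarith [Real.exp_pos (-(ε * (Y + 1 / lam)))]
    · rw [Set.indicator_of_notMem htI]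
      have hnm : lam * (t - Y) ∉ Set.Icc (-1 : ℝ) 1 := by
        intro h
        apply htI
        have h1 : |lam * (t - Y)| ≤ 1 := abs_le.2 h
        rw [abs_mul, abs_of_pos hl, ← le_div_iff₀' hl, abs_le] at h1
        exact ⟨by linarith [h1.1], by linarith [h1.2]⟩
      rw [Set.indicator_of_notMem hnm] at hm
      have h0 := hr0 (lam * (t - Y))
      have : -(90 * r (lam * (t - Y))) ≤ Real.exp (-(ε * t)) * -(90 * r (lam * (t - Y))) := by
        nlinarith
      calc 0 - 90 * r (lam * (t - Y)) ≤ Real.exp (-(ε * t)) * -(90 * r (lam * (t - Y))) := by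
            linarith
        _ ≤ _ := by gcongr; simpa using hm
  refine le_trans ?_ hle
  rw [integral_sub hii.integrableOn (hrY.const_mul 90).integrableOn, integral_const_mul,
    setIntegral_indicator measurableSet_Icc, Set.inter_eq_right.2 hIs, setIntegral_const]
  have h2 : ∫ t in Set.Ioi (0 : ℝ), r (lam * (t - Y)) ≤ 1 / 5 / lam := by
    rw [← hrYi]
    exact setIntegral_le_integral hrY (ae_of_all _ fun t => hr0 _)
  have h3 : volume.real I = 2 / lam := by
    rw [hI, Real.volume_real_Icc_of_le (by have : 0 < 1 / lam := by positivity
                                           linarith)]; ring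
  rw [h3, smul_eq_mul]
  have : (118 * E - 18) / lam = 2 / lam * (59 * E) - 90 * (1 / 5 / lam) := by
    field_simp; ring
  rw [this]; linarith

section ExplicitFormula

open ArithmeticFunction.vonMangoldt Complex

/-- The half-line Fourier integral of `minorantWeight`; its real part is `minorant / 2`. -/
noncomputable def halfMinorant (t : ℝ) : ℂ :=
  ∫ u in (0 : ℝ)..1, (minorantWeight u : ℂ) * Complex.exp (-(u * t) * I)

lemma continuous_halfMinorant_integrand (t : ℝ) :
    Continuous fun u : ℝ => (minorantWeight u : ℂ) * Complex.exp (-(u * t) * I) := by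
  have := continuous_minorantWeight
  fun_prop

lemma re_halfMinorant (t : ℝ) : (halfMinorant t).re = minorant t / 2 := by
  unfold halfMinorant minorant
  have h := (reCLM.intervalIntegral_comp_comm (μ := volume) (a := 0) (b := 1)
    ((continuous_halfMinorant_integrand t).intervalIntegrable 0 1))
  simp only [reCLM_apply] at h
  rw [← h, mul_div_cancel_left₀ _ two_ne_zero]
  refine intervalIntegral.integral_congr fun u _ => ?_
  have : Complex.exp (-(u * t) * I) = Complex.exp (((-(u * t) : ℝ) : ℂ) * I) := by
    push_cast; ring_nf
  simp only [this, re_ofReal_mul, exp_ofReal_mul_I_re, Real.cos_neg]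

variable {q : ℕ} {b : ZMod q}

/-- The smoothed boundary term of the explicit formula. -/
noncomputable def boundaryTerm [NeZero q] (b : ZMod q) (lam ε Y : ℝ) : ℂ :=
  ∫ u in (0 : ℝ)..1, (minorantWeight u : ℂ) * Complex.exp (u * (lam * Y) * I) *
    LFunctionResidueClassAux b (1 + ε + u * lam * I)

lemma hasSum_halfMinorant {lam ε Y : ℝ} (hε : 0 < ε) :
    HasSum (fun n : ℕ => LSeries.term (fun n => (residueClass b n : ℂ)) (1 + ε) n *
        halfMinorant (lam * (Real.log n - Y)))
      (∫ u in (0 : ℝ)..1, (minorantWeight u : ℂ) * Complex.exp (u * (lam * Y) * I) *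
        LSeries (fun n => (residueClass b n : ℂ)) (1 + ε + u * lam * I)) := by
  set f : ℕ → ℂ := fun n => (residueClass b n : ℂ) with hf
  have hcont := continuous_minorantWeight
  obtain ⟨K, hK⟩ : ∃ K, ∀ u ∈ Set.Icc (0 : ℝ) 1, ‖minorantWeight u‖ ≤ K :=
    isCompact_Icc.exists_bound_of_continuousOn hcont.continuousOn
  have hsum : ∀ s : ℂ, s.re = 1 + ε → LSeriesSummable f s := by
    intro s hs
    apply LSeriesSummable_of_abscissaOfAbsConv_lt_re
    refine lt_of_le_of_lt (abscissaOfAbsConv_residueClass_le_one b) ?_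
    rw [hs]; exact_mod_cast (by linarith : (1 : ℝ) < 1 + ε)
  have hre : ∀ u : ℝ, (1 + ε + u * lam * I : ℂ).re = 1 + ε := by intro u; simp
  have hre' : (1 + ε : ℂ).re = 1 + ε := by simp
  have hnorm : ∀ (u : ℝ) n, ‖LSeries.term f (1 + ε + u * lam * I) n‖ =
      ‖LSeries.term f (1 + ε) n‖ := by
    intro u n; rw [LSeries.norm_term_eq, LSeries.norm_term_eq, hre, hre']
  have hterm : ∀ (u : ℝ) (n : ℕ), (minorantWeight u : ℂ) * Complex.exp (u * (lam * Y) * I) *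
      LSeries.term f (1 + ε + u * lam * I) n = LSeries.term f (1 + ε) n *
        ((minorantWeight u : ℂ) * Complex.exp (-(u * (lam * (Real.log n - Y) : ℝ)) * I)) := by
    intro u n
    rcases eq_or_ne n 0 with rfl | hn
    · simp
    rw [LSeries.term_of_ne_zero hn, LSeries.term_of_ne_zero hn]
    have hnc : (n : ℂ) ≠ 0 := by exact_mod_cast hn
    rw [cpow_add _ _ hnc]
    have h2 : (n : ℂ) ^ ((u : ℂ) * lam * I) = Complex.exp (u * lam * I * Real.log n) := by
      rw [cpow_def_of_ne_zero hnc, natCast_log, mul_comm]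
    have h3 : Complex.exp (-(u * (lam * (Real.log n - Y) : ℝ)) * I) =
        Complex.exp (u * (lam * Y) * I) / Complex.exp (u * lam * I * Real.log n) := by
      rw [← Complex.exp_sub]; congr 1; push_cast; ring
    rw [h2, h3]
    field_simp
  have key := intervalIntegral.hasSum_integral_of_dominated_convergence (μ := volume)
    (a := 0) (b := 1)
    (F := fun (n : ℕ) (u : ℝ) => (minorantWeight u : ℂ) * Complex.exp (u * (lam * Y) * I) *
      LSeries.term f (1 + ε + u * lam * I) n)
    (f := fun u => (minorantWeight u : ℂ) * Complex.exp (u * (lam * Y) * I) *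
        LSeries f (1 + ε + u * lam * I))
    (fun n _ => K * ‖LSeries.term f (1 + ε) n‖) ?_ ?_ ?_ ?_ ?_
  · refine key.congr_fun ?_
    intro n
    rw [halfMinorant, ← intervalIntegral.integral_const_mul]
    refine intervalIntegral.integral_congr fun u _ => ?_
    exact (hterm u n).symm
  · intro n
    have : (fun u : ℝ => (minorantWeight u : ℂ) * Complex.exp (u * (lam * Y) * I) *
      LSeries.term f (1 + ε + u * lam * I) n) = fun u : ℝ => LSeries.term f (1 + ε) n *
        ((minorantWeight u : ℂ) * Complex.exp (-(u * (lam * (Real.log n - Y) : ℝ)) * I)) := by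
      ext u; exact hterm u n
    rw [this]
    exact (continuous_const.mul (continuous_halfMinorant_integrand _)).aestronglyMeasurable
  · intro n
    refine ae_of_all _ fun u hu => ?_
    rw [Set.uIoc_of_le zero_le_one] at hu
    have h1 : ‖Complex.exp (u * (lam * Y) * I)‖ = 1 := by
      have : (u * (lam * Y) * I : ℂ) = ((u * (lam * Y) : ℝ) : ℂ) * I := by push_cast; ring
      rw [this, norm_exp_ofReal_mul_I]
    rw [norm_mul, norm_mul, h1, mul_one, hnorm]
    gcongr
    rw [norm_real]
    exact hK u ⟨hu.1.le, hu.2⟩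
  · refine ae_of_all _ fun u hu => ?_
    exact ((hsum (1 + ε) hre').norm).mul_left K
  · exact intervalIntegrable_const
  · refine ae_of_all _ fun u hu => ?_
    exact (hsum _ (hre u)).LSeriesHasSum.mul_left _

lemma integral_minorantWeight_div {lam ε Y : ℝ} (hε : 0 < ε) :
    ∫ u in (0 : ℝ)..1, (minorantWeight u : ℂ) * Complex.exp (u * (lam * Y) * I) *
        (1 / (ε + u * lam * I)) =
      ∫ t in Set.Ioi (0 : ℝ), (Real.exp (-(ε * t)) : ℂ) * halfMinorant (lam * (t - Y)) := by
  have hcont := continuous_minorantWeight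
  have h1 : ∀ u : ℝ, (minorantWeight u : ℂ) * Complex.exp (u * (lam * Y) * I) *
        (1 / (ε + u * lam * I)) = ∫ t in Set.Ioi (0 : ℝ), (Real.exp (-(ε * t)) : ℂ) *
          ((minorantWeight u : ℂ) * Complex.exp (-(u * (lam * (t - Y) : ℝ)) * I)) := by
    intro u
    have h2 := integral_exp_mul_complex_Ioi (a := -(ε + u * lam * I)) (by simpa using hε) 0
    simp only [ofReal_zero, mul_zero, Complex.exp_zero] at h2
    have h3 : (1 : ℂ) / (ε + u * lam * I) = -1 / -(ε + u * lam * I) := by rw [neg_div_neg_eq]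
    rw [h3, ← h2, ← integral_const_mul]
    refine integral_congr_ae (ae_of_all _ fun t => ?_)
    simp only
    rw [mul_assoc, ← Complex.exp_add, ofReal_exp,
      mul_left_comm (Complex.exp ((-(ε * t) : ℝ) : ℂ)), ← Complex.exp_add]
    congr 2; push_cast; ring
  simp_rw [h1]
  rw [intervalIntegral.integral_of_le zero_le_one, integral_integral_swap]
  · refine integral_congr_ae (ae_of_all _ fun t => ?_)
    simp only
    rw [halfMinorant, intervalIntegral.integral_of_le zero_le_one, integral_const_mul]
  · obtain ⟨K, hK⟩ : ∃ K, ∀ u ∈ Set.Icc (0 : ℝ) 1, ‖minorantWeight u‖ ≤ K :=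
      isCompact_Icc.exists_bound_of_continuousOn hcont.continuousOn
    have hexp : Integrable (fun t : ℝ => (Real.exp (-(ε * t)) : ℂ))
        (volume.restrict (Set.Ioi 0)) := by
      have := integrableOn_exp_mul_Ioi (neg_lt_zero.2 hε) 0
      simp only [neg_mul] at this
      exact Integrable.ofReal (f := fun t : ℝ => Real.exp (-(ε * t))) this
    have hprod : Integrable (fun z : ℝ × ℝ => (Real.exp (-(ε * z.2)) : ℂ))
        ((volume.restrict (Set.Ioc 0 1)).prod (volume.restrict (Set.Ioi 0))) :=
      hexp.comp_snd _
    have hw : Integrable (fun u : ℝ => (minorantWeight u : ℂ)) (volume.restrict (Set.Ioc 0 1)) :=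
      (Continuous.integrableOn_Icc (by fun_prop)).mono_set Set.Ioc_subset_Icc_self
    have hwe := hw.mul_prod hexp
    have : (Function.uncurry fun (u t : ℝ) => (Real.exp (-(ε * t)) : ℂ) *
          ((minorantWeight u : ℂ) * Complex.exp (-(u * (lam * (t - Y) : ℝ)) * I))) =
        fun z : ℝ × ℝ => ((minorantWeight z.1 : ℂ) * (Real.exp (-(ε * z.2)) : ℂ)) *
          Complex.exp (((-(z.1 * (lam * (z.2 - Y))) : ℝ) : ℂ) * I) := by
      ext z; simp only [Function.uncurry]; push_cast; ring_nf
    rw [this]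
    refine Integrable.mul_bdd (c := 1) hwe ?_ ?_
    · exact Continuous.aestronglyMeasurable (by fun_prop)
    · exact ae_of_all _ fun z => (norm_exp_ofReal_mul_I _).le

lemma hasSum_minorant [NeZero q] (hb : IsUnit b) {lam ε Y : ℝ} (hε : 0 < ε) :
    HasSum (fun n : ℕ => residueClass b n / (n : ℝ) ^ (1 + ε) * minorant (lam * (Real.log n - Y)))
      ((q.totient : ℝ)⁻¹ * (∫ t in Set.Ioi (0 : ℝ), Real.exp (-(ε * t)) *
        minorant (lam * (t - Y))) + 2 * (boundaryTerm b lam ε Y).re) := by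
  have hcont := continuous_minorantWeight
  have h := hasSum_halfMinorant (b := b) (lam := lam) (Y := Y) hε
  have hL : ∀ u : ℝ, LSeries (fun n => (residueClass b n : ℂ)) (1 + ε + u * lam * I) =
      LFunctionResidueClassAux b (1 + ε + u * lam * I) +
        (q.totient : ℂ)⁻¹ * (1 / (ε + u * lam * I)) := by
    intro u
    have := eqOn_LFunctionResidueClassAux hb (x := 1 + ε + u * lam * I)
      (by simpa [Set.mem_ofPred_eq] using hε)
    rw [this]
    have : (1 + ε + u * lam * I - 1 : ℂ) = ε + u * lam * I := by ring
    simp only [this]; ring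
  have hmaps : ∀ u : ℝ, (1 + ε + u * lam * I : ℂ) ∈ {s : ℂ | 1 ≤ s.re} := by
    intro u; simpa [Set.mem_ofPred_eq] using hε.le
  have hcF : Continuous fun u : ℝ => LFunctionResidueClassAux b (1 + ε + u * lam * I) :=
    (continuousOn_LFunctionResidueClassAux b).comp_continuous (by fun_prop) hmaps
  have hci : Continuous fun u : ℝ => (1 / (ε + u * lam * I) : ℂ) := by
    refine Continuous.div continuous_const (by fun_prop) fun u h0 => ?_
    have := congrArg Complex.re h0
    simp at this; linarith
  have hsplit : (∫ u in (0 : ℝ)..1, (minorantWeight u : ℂ) * Complex.exp (u * (lam * Y) * I) *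
        LSeries (fun n => (residueClass b n : ℂ)) (1 + ε + u * lam * I)) =
      boundaryTerm b lam ε Y + (q.totient : ℂ)⁻¹ *
       ∫ t in Set.Ioi (0 : ℝ), (Real.exp (-(ε * t)) : ℂ) * halfMinorant (lam * (t - Y)) := by
    rw [← integral_minorantWeight_div hε, boundaryTerm, ← intervalIntegral.integral_const_mul,
      ← intervalIntegral.integral_add]
    · refine intervalIntegral.integral_congr fun u _ => ?_
      simp only [hL]; ring
    · exact Continuous.intervalIntegrable (by fun_prop) _ _
    · exact Continuous.intervalIntegrable (by fun_prop) _ _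
  rw [hsplit] at h
  have hr := (Complex.hasSum_re h).mul_left 2
  have hcm : Continuous fun t : ℝ => halfMinorant (lam * (t - Y)) := by
    have : Continuous halfMinorant := by
      unfold halfMinorant
      exact intervalIntegral.continuous_parametric_intervalIntegral_of_continuous'
        (by fun_prop) 0 1
    fun_prop
  obtain ⟨K, hK⟩ : ∃ K, ∀ u ∈ Set.Icc (0 : ℝ) 1, ‖minorantWeight u‖ ≤ K :=
    isCompact_Icc.exists_bound_of_continuousOn hcont.continuousOn
  have hbd : ∀ t, ‖halfMinorant t‖ ≤ K := by
    intro t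
    have := intervalIntegral.norm_integral_le_of_norm_le_const (a := 0) (b := 1) (C := K)
      (f := fun u : ℝ => (minorantWeight u : ℂ) * Complex.exp (-(u * t) * I)) (fun u hu => ?_)
    · simpa [halfMinorant] using this
    · rw [Set.uIoc_of_le zero_le_one] at hu
      have h1 : ‖Complex.exp (-(u * t) * I)‖ = 1 := by
        have : (-(u * t) * I : ℂ) = ((-(u * t) : ℝ) : ℂ) * I := by push_cast; ring
        rw [this, norm_exp_ofReal_mul_I]
      rw [norm_mul, h1, mul_one, norm_real]
      exact hK u ⟨hu.1.le, hu.2⟩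
  have hval : (∫ t in Set.Ioi (0 : ℝ), (Real.exp (-(ε * t)) : ℂ) *
      halfMinorant (lam * (t - Y))).re =
      (∫ t in Set.Ioi (0 : ℝ), Real.exp (-(ε * t)) * minorant (lam * (t - Y))) / 2 := by
    have hexp : Integrable (fun t : ℝ => (Real.exp (-(ε * t)) : ℂ))
        (volume.restrict (Set.Ioi 0)) := by
      have := integrableOn_exp_mul_Ioi (neg_lt_zero.2 hε) 0
      simp only [neg_mul] at this
      exact Integrable.ofReal (f := fun t : ℝ => Real.exp (-(ε * t))) this
    have hI := Integrable.mul_bdd (c := K) hexp hcm.aestronglyMeasurable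
      (ae_of_all _ fun t => hbd _)
    have := reCLM.integral_comp_comm hI
    simp only [reCLM_apply] at this
    rw [← this, ← integral_div]
    refine integral_congr_ae (ae_of_all _ fun t => ?_)
    simp only [re_ofReal_mul, re_halfMinorant]; ring
  have hterm : ∀ n : ℕ, 2 * (LSeries.term (fun n => (residueClass b n : ℂ)) (1 + ε) n *
        halfMinorant (lam * (Real.log n - Y))).re =
      residueClass b n / (n : ℝ) ^ (1 + ε) * minorant (lam * (Real.log n - Y)) := by
    intro n
    rcases eq_or_ne n 0 with rfl | hn
    · simp [residueClass_apply_zero]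
    rw [LSeries.term_of_ne_zero hn]
    have : ((residueClass b n : ℝ) : ℂ) / (n : ℂ) ^ (1 + ε : ℂ) =
        ((residueClass b n / (n : ℝ) ^ (1 + ε) : ℝ) : ℂ) := by
      push_cast
      rw [ofReal_cpow (Nat.cast_nonneg n)]
      push_cast; rfl
    rw [this, re_ofReal_mul, re_halfMinorant]; ring
  simp only [hterm] at hr
  have : ((q.totient : ℂ)⁻¹ * ∫ t in Set.Ioi (0 : ℝ), (Real.exp (-(ε * t)) : ℂ) *
      halfMinorant (lam * (t - Y))).re = (q.totient : ℝ)⁻¹ *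
      ((∫ t in Set.Ioi (0 : ℝ), Real.exp (-(ε * t)) * minorant (lam * (t - Y))) / 2) := by
    rw [← hval, ← re_ofReal_mul]; push_cast; rfl
  rw [add_re, this] at hr
  have e : ∀ x y : ℝ, (q.totient : ℝ)⁻¹ * x + 2 * y = 2 * (y + (q.totient : ℝ)⁻¹ * (x / 2)) := by
    intro x y; ring
  rw [e]; exact hr

end ExplicitFormula

section PrimesInProgressions

open ArithmeticFunction.vonMangoldt

variable {q : ℕ} [NeZero q] {b : ZMod q}

lemma tendsto_boundaryTerm_eps (lam Y : ℝ) :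
    Tendsto (fun ε => boundaryTerm b lam ε Y) (𝓝[>] 0) (𝓝 (boundaryTerm b lam 0 Y)) := by
  have hcont := continuous_minorantWeight
  unfold boundaryTerm
  have hF : ContinuousOn (fun z : ℝ × ℝ => (minorantWeight z.2 : ℂ) *
      Complex.exp (z.2 * (lam * Y) * Complex.I) *
      LFunctionResidueClassAux b (1 + z.1 + z.2 * lam * Complex.I)) {z | 0 ≤ z.1} := by
    refine ContinuousOn.mul (Continuous.continuousOn (by fun_prop)) ?_
    refine (continuousOn_LFunctionResidueClassAux b).comp
      (Continuous.continuousOn (by fun_prop)) ?_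
    intro z hz
    simpa [Set.mem_ofPred_eq] using hz
  obtain ⟨K, hK⟩ : ∃ K, ∀ z ∈ Set.Icc (0 : ℝ) 1 ×ˢ Set.Icc (0 : ℝ) 1,
      ‖(minorantWeight z.2 : ℂ) * Complex.exp (z.2 * (lam * Y) * Complex.I) *
      LFunctionResidueClassAux b (1 + z.1 + z.2 * lam * Complex.I)‖ ≤ K :=
    (isCompact_Icc.prod isCompact_Icc).exists_bound_of_continuousOn
      (hF.mono fun z hz => hz.1.1)
  refine intervalIntegral.tendsto_integral_filter_of_dominated_convergence (fun _ => K) ?_ ?_ ?_ ?_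
  · filter_upwards [self_mem_nhdsWithin] with ε hε
    have : Continuous fun u : ℝ => (minorantWeight u : ℂ) *
        Complex.exp (u * (lam * Y) * Complex.I) *
        LFunctionResidueClassAux b (1 + ε + u * lam * Complex.I) :=
      hF.comp_continuous (f := fun u : ℝ => (ε, u)) (by fun_prop) fun u =>
        (le_of_lt (Set.mem_Ioi.1 hε) : (0 : ℝ) ≤ ε)
    exact this.aestronglyMeasurable
  · have : Set.Ioo (0 : ℝ) 1 ∈ 𝓝[>] (0 : ℝ) := Ioo_mem_nhdsGT one_pos
    filter_upwards [this] with ε hε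
    refine ae_of_all _ fun u hu => ?_
    rw [Set.uIoc_of_le zero_le_one] at hu
    exact hK (ε, u) ⟨⟨hε.1.le, hε.2.le⟩, ⟨hu.1.le, hu.2⟩⟩
  · exact intervalIntegrable_const
  · refine ae_of_all _ fun u _ => ?_
    have h1 := (hF (0, u) (by simp)).tendsto
    have h2 : Tendsto (fun ε : ℝ => (ε, u)) (𝓝[>] 0) (𝓝[{z : ℝ × ℝ | 0 ≤ z.1}] (0, u)) := by
      refine tendsto_nhdsWithin_iff.2 ⟨?_, ?_⟩
      · exact ((continuous_id.prodMk continuous_const).tendsto' _ _ rfl).mono_left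
          nhdsWithin_le_nhds
      · filter_upwards [self_mem_nhdsWithin] with ε hε
        exact (le_of_lt (Set.mem_Ioi.1 hε) : (0 : ℝ) ≤ ε)
    have h3 := h1.comp h2
    simpa only [Function.comp_def] using h3

lemma tendsto_boundaryTerm_atTop {lam : ℝ} (hlam : 0 < lam) :
    Tendsto (fun Y => boundaryTerm b lam 0 Y) atTop (𝓝 0) := by
  set f : ℝ → ℂ := (Set.Ioc (0 : ℝ) 1).indicator fun u => (minorantWeight u : ℂ) *
    LFunctionResidueClassAux b (1 + u * lam * Complex.I) with hf
  have h := Real.tendsto_integral_exp_smul_cocompact f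
  have h2 : Tendsto (fun Y : ℝ => -(lam * Y / (2 * Real.pi))) atTop (cocompact ℝ) := by
    rw [cocompact_eq_atBot_atTop]
    refine Tendsto.mono_right ?_ le_sup_left
    refine tendsto_neg_atTop_atBot.comp ?_
    exact (tendsto_id.const_mul_atTop hlam).atTop_div_const (by positivity)
  refine (h.comp h2).congr fun Y => ?_
  simp only [Function.comp, boundaryTerm]
  rw [intervalIntegral.integral_of_le zero_le_one, ← integral_indicator measurableSet_Ioc]
  refine integral_congr_ae (ae_of_all _ fun u => ?_)
  by_cases hu : u ∈ Set.Ioc (0 : ℝ) 1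
  · simp only [hf, Set.indicator_of_mem hu]
    rw [Circle.smul_def, Real.fourierChar_apply, smul_eq_mul]
    have : ((2 * Real.pi * -(u * -(lam * Y / (2 * Real.pi))) : ℝ) : ℂ) = u * (lam * Y) := by
      push_cast
      have : (Real.pi : ℂ) ≠ 0 := by exact_mod_cast Real.pi_ne_zero
      field_simp
    rw [this]
    simp only [Complex.ofReal_zero, add_zero]
    ring
  · simp only [hf, Set.indicator_of_notMem hu, smul_zero]

/-- A weak form of the prime number theorem in arithmetic progressions: short multiplicative
intervals contain a positive proportion of the expected mass. -/
lemma exists_sum_residueClass_ge : ∃ c : ℝ, 0 < c ∧ ∀ (q : ℕ) [NeZero q] (b : ZMod q),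
    IsUnit b → ∀ lam : ℝ, 0 < lam → ∀ᶠ Y : ℝ in atTop,
      c / (q.totient * lam) ≤ ∑ n ∈ (Finset.range (⌊Real.exp (Y + 10 / lam)⌋₊ + 1)).filter
        (fun n : ℕ => |Real.log n - Y| ≤ 10 / lam), residueClass b n / n := by
  obtain ⟨C, hC0, hC⟩ := exists_minorant_abs_le
  refine ⟨50 / C, by positivity, fun q _ b hb lam hlam => ?_⟩
  have hq : (0 : ℝ) < q.totient := by exact_mod_cast Nat.totient_pos.2 (NeZero.pos q)
  have hsmall : ∀ᶠ Y in atTop, ‖boundaryTerm b lam 0 Y‖ < 25 / (q.totient * lam) := by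
    have := (tendsto_boundaryTerm_atTop (b := b) hlam).norm
    rw [norm_zero] at this
    exact this.eventually_lt_const (by positivity)
  filter_upwards [hsmall, eventually_gt_atTop (1 / lam)] with Y hY1 hY2
  rw [div_lt_iff₀' hlam] at hY2
  set S := (Finset.range (⌊Real.exp (Y + 10 / lam)⌋₊ + 1)).filter
        (fun n : ℕ => |Real.log n - Y| ≤ 10 / lam) with hS
  have hnn : ∀ n, 0 ≤ residueClass b n := fun n => residueClass_nonneg b n
  have hfin : ∀ ε : ℝ, 0 < ε → (q.totient : ℝ)⁻¹ *
      ((118 * Real.exp (-(ε * (Y + 1 / lam))) - 18) / lam) + 2 * (boundaryTerm b lam ε Y).re ≤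
      C * ∑ n ∈ S, residueClass b n / n := by
    intro ε hε
    have hs := hasSum_minorant hb (lam := lam) (Y := Y) hε
    have hge := integral_exp_mul_minorant_ge hlam hε hY2
    have h1 : (q.totient : ℝ)⁻¹ * (∫ t in Set.Ioi (0 : ℝ), Real.exp (-(ε * t)) *
        minorant (lam * (t - Y))) + 2 * (boundaryTerm b lam ε Y).re ≤
        C * ∑ n ∈ S, residueClass b n / n := by
      rw [Finset.mul_sum]
      refine hasSum_le (f := fun n : ℕ => residueClass b n / (n : ℝ) ^ (1 + ε) *
        minorant (lam * (Real.log n - Y)))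
        (g := fun n => if n ∈ S then C * (residueClass b n / n) else 0) ?_ hs ?_
      · intro n
        rcases eq_or_ne n 0 with rfl | hn
        · simp [residueClass_apply_zero]
        have hn1 : (1 : ℝ) ≤ n := by exact_mod_cast Nat.one_le_iff_ne_zero.2 hn
        have hp : (0 : ℝ) < (n : ℝ) ^ (1 + ε) := by positivity
        by_cases hmem : |Real.log n - Y| ≤ 10 / lam
        · have hnS : n ∈ S := by
            rw [hS, mem_filter, Finset.mem_range, Nat.lt_succ_iff]
            refine ⟨Nat.le_floor ?_, hmem⟩
            rw [← Real.log_le_iff_le_exp (by linarith)]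
            linarith [(abs_le.1 hmem).2]
          rw [if_pos hnS, mul_comm C]
          have h2 : residueClass b n / (n : ℝ) ^ (1 + ε) ≤ residueClass b n / n := by
            apply div_le_div_of_nonneg_left (hnn n) (by linarith)
            calc (n : ℝ) = (n : ℝ) ^ (1 : ℝ) := (Real.rpow_one _).symm
              _ ≤ _ := Real.rpow_le_rpow_of_exponent_le hn1 (by linarith)
          calc _ ≤ residueClass b n / (n : ℝ) ^ (1 + ε) * C := by
                apply mul_le_mul_of_nonneg_left ((le_abs_self _).trans (hC _))
                exact div_nonneg (hnn n) hp.le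
            _ ≤ _ := by gcongr
        · have hnS : n ∉ S := by
            rw [hS, mem_filter]; exact fun h => hmem h.2
          rw [if_neg hnS]
          apply mul_nonpos_of_nonneg_of_nonpos (div_nonneg (hnn n) hp.le)
          apply minorant_nonpos
          push Not at hmem
          rw [abs_mul, abs_of_pos hlam, ← div_le_iff₀' hlam]
          exact hmem.le
      · have := hasSum_sum_of_ne_finset_zero (f := fun n : ℕ => if n ∈ S then
          C * (residueClass b n / n) else 0) (s := S) (L := SummationFilter.unconditional ℕ)
          (fun n hn => if_neg hn)
        rwa [Finset.sum_congr rfl fun n hn => if_pos hn] at this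
    refine le_trans ?_ h1
    gcongr
  have hlim : Tendsto (fun ε : ℝ => (q.totient : ℝ)⁻¹ *
      ((118 * Real.exp (-(ε * (Y + 1 / lam))) - 18) / lam) + 2 * (boundaryTerm b lam ε Y).re)
      (𝓝[>] 0) (𝓝 ((q.totient : ℝ)⁻¹ *
      ((118 * Real.exp (-(0 * (Y + 1 / lam))) - 18) / lam) +
        2 * (boundaryTerm b lam 0 Y).re)) := by
    refine Tendsto.add ?_ ?_
    · exact (Continuous.tendsto (by fun_prop) _).mono_left nhdsWithin_le_nhds
    · exact ((Complex.continuous_re.tendsto _).comp (tendsto_boundaryTerm_eps lam Y)).const_mul 2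
  have hle := le_of_tendsto hlim (by
    filter_upwards [self_mem_nhdsWithin] with ε hε
    exact hfin ε hε)
  have hre : -(25 / (q.totient * lam)) ≤ (boundaryTerm b lam 0 Y).re := by
    have := (abs_le.1 (Complex.abs_re_le_norm (boundaryTerm b lam 0 Y))).1
    linarith
  rw [zero_mul, neg_zero, Real.exp_zero] at hle
  have e1 : (q.totient : ℝ)⁻¹ * ((118 * 1 - 18) / lam) = 4 * (25 / (q.totient * lam)) := by
    field_simp; norm_num
  rw [e1] at hle
  have e2 : 50 / C / (q.totient * lam) = 2 * (25 / (q.totient * lam)) / C := by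
    field_simp; norm_num
  rw [e2, div_le_iff₀' hC0]
  linarith

end PrimesInProgressions

open ArithmeticFunction.vonMangoldt in
/-- Short intervals `[x, (1 + δ) x]` contain a positive proportion of the expected number of
primes in every reduced residue class. -/
lemma exists_primes_progression_ge : ∃ c : ℝ, 0 < c ∧ ∀ (q : ℕ) [NeZero q] (b : ZMod q),
    IsUnit b → ∀ δ : ℝ, 0 < δ → δ ≤ 1 → ∀ᶠ x : ℝ in atTop,
      c * δ * x / (q.totient * Real.log x) ≤
        ((Finset.range (⌊(1 + δ) * x⌋₊ + 1)).filter
          (fun p : ℕ => p.Prime ∧ x ≤ p ∧ (p : ZMod q) = b)).card := by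
  obtain ⟨c, hc0, hc⟩ := exists_sum_residueClass_ge
  refine ⟨c / 160, by positivity, fun q _ b hb δ hδ0 hδ1 => ?_⟩
  have hq : (0 : ℝ) < q.totient := by exact_mod_cast Nat.totient_pos.2 (NeZero.pos q)
  set l := Real.log (1 + δ) with hl
  have hl1 : δ / 2 ≤ l := by
    have h1 := Real.one_sub_inv_le_log_of_pos (show 0 < 1 + δ by linarith)
    have h2 : δ / 2 ≤ 1 - (1 + δ)⁻¹ := by
      have : 1 - (1 + δ)⁻¹ = δ / (1 + δ) := by field_simp; ring
      rw [this]; apply div_le_div_of_nonneg_left hδ0.le <;> linarith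
    linarith
  have hl0 : 0 < l := by linarith
  have hel : Real.exp l = 1 + δ := Real.exp_log (by linarith)
  set lam := 20 / l with hlam
  have hlam0 : 0 < lam := by positivity
  have hl10 : 10 / lam = l / 2 := by rw [hlam]; field_simp; norm_num
  set η := c / (q.totient * lam) / 2 with hη
  have hη0 : 0 < η := by positivity
  obtain ⟨s, hs⟩ := summable_iff_vanishing_norm.1 (summable_residueClass_non_primes_div b) η hη0
  have hY := hc q b hb lam hlam0
  have htend : Tendsto (fun x : ℝ => Real.log x + l / 2) atTop atTop :=
    tendsto_atTop_add_const_right _ _ Real.tendsto_log_atTop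
  filter_upwards [htend.eventually hY, eventually_gt_atTop (((s.sup id : ℕ) : ℝ) + 2)] with x hx hx2
  have hx2' : (2 : ℝ) < x := by
    have : (0 : ℝ) ≤ ((s.sup id : ℕ) : ℝ) := Nat.cast_nonneg _
    linarith
  have hx0 : 0 < x := by linarith
  rw [hl10] at hx
  have hexp : Real.exp (Real.log x + l / 2 + l / 2) = (1 + δ) * x := by
    rw [add_assoc, add_halves, Real.exp_add, Real.exp_log hx0, hel]; ring
  rw [hexp] at hx
  set S := (Finset.range (⌊(1 + δ) * x⌋₊ + 1)).filter
    (fun n : ℕ => |Real.log n - (Real.log x + l / 2)| ≤ l / 2) with hS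
  set T := (Finset.range (⌊(1 + δ) * x⌋₊ + 1)).filter
          (fun p : ℕ => p.Prime ∧ x ≤ p ∧ (p : ZMod q) = b) with hT
  have hSx : ∀ n ∈ S, x ≤ n := by
    intro n hn
    rw [hS, mem_filter, Finset.mem_range] at hn
    have h1 := (abs_le.1 hn.2).1
    have h2 : Real.log x ≤ Real.log n := by linarith
    rcases Nat.eq_zero_or_pos n with rfl | hn0
    · simp only [Nat.cast_zero, Real.log_zero] at h2
      have := Real.log_pos (show 1 < x by linarith)
      linarith
    · exact (Real.log_le_log_iff hx0 (by exact_mod_cast hn0)).1 h2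
  have hdis : Disjoint S s := by
    rw [Finset.disjoint_left]
    intro n hn hns
    have h1 := hSx n hn
    have h2 : (n : ℝ) ≤ ((s.sup id : ℕ) : ℝ) := by
      exact_mod_cast Finset.le_sup (f := id) hns
    linarith
  have hsm := hs S hdis
  have hsplit : ∑ n ∈ S, residueClass b n / n =
      ∑ n ∈ S, (if n.Prime then 0 else residueClass b n) / n +
      ∑ n ∈ S.filter Nat.Prime, residueClass b n / n := by
    rw [Finset.sum_filter Nat.Prime, ← Finset.sum_add_distrib]
    refine Finset.sum_congr rfl fun n _ => ?_
    split_ifs <;> simp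
  have hprime : ∑ n ∈ S.filter Nat.Prime, residueClass b n / n ≤
      T.card * (2 * Real.log x / x) := by
    calc ∑ n ∈ S.filter Nat.Prime, residueClass b n / n
        ≤ ∑ n ∈ S.filter Nat.Prime, if n ∈ T then 2 * Real.log x / x else 0 := by
          refine Finset.sum_le_sum fun n hn => ?_
          rw [mem_filter] at hn
          have hxn := hSx n hn.1
          have hnr := hn.1
          rw [hS, mem_filter] at hnr
          have hn0 : (0 : ℝ) < n := by linarith
          by_cases hnb : (n : ZMod q) = b
          · rw [if_pos (by rw [hT, mem_filter]; exact ⟨hnr.1, hn.2, hxn, hnb⟩)]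
            have hle : (n : ℝ) ≤ (1 + δ) * x := by
              have := hnr.1
              rw [Finset.mem_range, Nat.lt_succ_iff] at this
              exact (Nat.le_floor_iff (by positivity)).1 this
            have h1 : residueClass b n ≤ 2 * Real.log x := by
              refine (residueClass_le b n).trans ?_
              rw [ArithmeticFunction.vonMangoldt_apply_prime hn.2]
              calc Real.log n ≤ Real.log (x ^ 2) := by
                    apply Real.log_le_log hn0; nlinarith
                _ = 2 * Real.log x := by rw [Real.log_pow]; norm_num
            have hlx : 0 ≤ Real.log x := Real.log_nonneg (by linarith)
            gcongr
          · have : residueClass b n = 0 := by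
              rw [residueClass, Set.indicator_of_notMem]; simpa [Set.mem_ofPred_eq] using hnb
            rw [this, zero_div]
            have hlx : 0 ≤ Real.log x := Real.log_nonneg (by linarith)
            split_ifs <;> positivity
      _ = ((S.filter Nat.Prime).filter (· ∈ T)).card * (2 * Real.log x / x) := by
          rw [← Finset.sum_filter, Finset.sum_const, nsmul_eq_mul]
      _ ≤ _ := by
          have hlx : 0 ≤ Real.log x := Real.log_nonneg (by linarith)
          have : ((S.filter Nat.Prime).filter (· ∈ T)).card ≤ T.card :=
            Finset.card_le_card fun n hn => (mem_filter.1 hn).2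
          gcongr
  have hnp : ∑ n ∈ S, (if n.Prime then 0 else residueClass b n) / n ≤ η :=
    (le_abs_self _).trans hsm.le
  have h2 : η ≤ T.card * (2 * Real.log x / x) := by
    have : c / (q.totient * lam) = 2 * η := by rw [hη]; ring
    rw [hsplit, this] at hx
    linarith
  have hlx : 0 < Real.log x := Real.log_pos (by linarith)
  have h3 : c / 160 * δ * x / (q.totient * Real.log x) ≤ η * (x / (2 * Real.log x)) := by
    rw [hη, hlam]
    have : c / (q.totient * (20 / l)) / 2 * (x / (2 * Real.log x)) =
      c / 160 * (2 * l) * x / (q.totient * Real.log x) := by field_simp; norm_num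
    rw [this]
    have : δ ≤ 2 * l := by linarith
    gcongr
  refine h3.trans ?_
  have : (T.card : ℝ) = T.card * (2 * Real.log x / x) * (x / (2 * Real.log x)) := by
    field_simp
  rw [this]
  gcongr

/-- The `2 × 2` minors of the matrix with columns `p`, `q`. -/
def minor (p q : Fin 4 → ℤ) (i j : Fin 4) : ℤ := p i * q j - p j * q i

/-- The gcd of the `2 × 2` minors. -/
def minorGcd (p q : Fin 4 → ℤ) : ℕ :=
  (Finset.univ.gcd fun s : Fin 4 × Fin 4 => minor p q s.1 s.2).natAbs

/-- The largest absolute value of the `2 × 2` minors. -/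
def minorMax (p q : Fin 4 → ℤ) : ℕ :=
  Finset.univ.sup fun s : Fin 4 × Fin 4 => (minor p q s.1 s.2).natAbs

lemma minorGcd_dvd (p q : Fin 4 → ℤ) (i j : Fin 4) : (minorGcd p q : ℤ) ∣ minor p q i j := by
  rw [minorGcd, Int.natCast_natAbs, abs_dvd]
  exact Finset.gcd_dvd (f := fun s : Fin 4 × Fin 4 => minor p q s.1 s.2) (mem_univ (i, j))

lemma natAbs_minor_le (p q : Fin 4 → ℤ) (i j : Fin 4) :
    (minor p q i j).natAbs ≤ minorMax p q :=
  Finset.le_sup (f := fun s : Fin 4 × Fin 4 => (minor p q s.1 s.2).natAbs) (mem_univ (i, j))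

lemma exists_natAbs_minor_eq (p q : Fin 4 → ℤ) :
    ∃ i j, (minor p q i j).natAbs = minorMax p q := by
  obtain ⟨s, -, hs⟩ := Finset.exists_mem_eq_sup (Finset.univ : Finset (Fin 4 × Fin 4))
    univ_nonempty (fun s => (minor p q s.1 s.2).natAbs)
  exact ⟨s.1, s.2, hs.symm⟩

lemma exists_minorGcd_eq (p q : Fin 4 → ℤ) :
    ∃ f : Fin 4 → Fin 4 → ℤ, (minorGcd p q : ℤ) = ∑ i, ∑ j, f i j * minor p q i j := by
  obtain ⟨f, hf⟩ := Finset.gcd_eq_sum_mul Finset.univ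
    fun s : Fin 4 × Fin 4 => minor p q s.1 s.2
  refine ⟨fun i j => f (i, j), ?_⟩
  rw [minorGcd, Int.natCast_natAbs, abs_of_nonneg (Int.finsetGcd_nonneg ..), hf,
    Fintype.sum_prod_type]
  simp [mul_comm]

lemma minorGcd_pos {p q : Fin 4 → ℤ} (h : minorMax p q ≠ 0) : 0 < minorGcd p q := by
  rw [Nat.pos_iff_ne_zero]
  intro h0
  obtain ⟨i, j, hij⟩ := exists_natAbs_minor_eq p q
  have := minorGcd_dvd p q i j
  rw [h0] at this
  simp at this
  rw [this] at hij
  exact h hij.symm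

lemma minorGcd_le_minorMax {p q : Fin 4 → ℤ} (h : minorMax p q ≠ 0) :
    minorGcd p q ≤ minorMax p q := by
  obtain ⟨i, j, hij⟩ := exists_natAbs_minor_eq p q
  have := Int.natAbs_dvd_natAbs.2 (minorGcd_dvd p q i j)
  rw [hij] at this
  exact Nat.le_of_dvd (Nat.pos_of_ne_zero h) (by simpa using this)

lemma exists_complement (i j : Fin 4) (h : i ≠ j) : ∃ k l : Fin 4,
    (∀ s, s = i ∨ s = j ∨ s = k ∨ s = l) ∧
    (∀ f : Fin 4 → ℤ, ∑ s, f s = f i + f j + f k + f l) ∧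
    i ≠ k ∧ i ≠ l ∧ j ≠ k ∧ j ≠ l ∧ k ≠ l := by
  have h1 : ∀ i j : Fin 4, i ≠ j → ∃ k l : Fin 4, i ≠ k ∧ i ≠ l ∧ j ≠ k ∧ j ≠ l ∧ k ≠ l ∧
      (Finset.univ : Finset (Fin 4)) = {i, j, k, l} := by decide
  obtain ⟨k, l, h1, h2, h3, h4, h5, h6⟩ := h1 i j h
  refine ⟨k, l, fun s => ?_, fun f => ?_, h1, h2, h3, h4, h5⟩
  · have : s ∈ (Finset.univ : Finset (Fin 4)) := mem_univ s
    rw [h6] at this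
    simpa using this
  · rw [h6, Finset.sum_insert (by simp [*]), Finset.sum_insert (by simp [*]),
      Finset.sum_insert (by simp [*]), Finset.sum_singleton]
    ring

/-- The lattices spanned by `p, q` and by `v, a` are orthogonal, so their Plücker coordinates
are proportional up to passing to complementary indices. -/
lemma plucker_orthogonal {p q v a : Fin 4 → ℤ} {i j k l : Fin 4}
    (hc : ∀ s : Fin 4, s = i ∨ s = j ∨ s = k ∨ s = l)
    (h1 : p i * v i + p j * v j + p k * v k + p l * v l = 0)
    (h2 : q i * v i + q j * v j + q k * v k + q l * v l = 0)
    (h3 : p i * a i + p j * a j + p k * a k + p l * a l = 0)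
    (h4 : q i * a i + q j * a j + q k * a k + q l * a l = 0) (s t : Fin 4) :
    (∃ x, minor p q i j * minor v a s t = x * minor v a k l) ∧
    ∃ x, minor p q s t * minor v a k l = minor p q i j * x := by
  have key : ∀ (x y : Fin 4),
      minor p q x i * minor v a i y + minor p q x j * minor v a j y +
      minor p q x k * minor v a k y + minor p q x l * minor v a l y = 0 := by
    intro x y
    simp only [minor]
    linear_combination a y * (p x * h2 - q x * h1) - v y * (p x * h4 - q x * h3)
  have anti : ∀ x y, minor p q x y = - minor p q y x := fun x y => by simp only [minor]; ring
  have anti' : ∀ x y, minor v a x y = - minor v a y x := fun x y => by simp only [minor]; ring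
  have z : ∀ x, minor p q x x = 0 := fun x => by simp only [minor]; ring
  have z' : ∀ x, minor v a x x = 0 := fun x => by simp only [minor]; ring
  have eik : minor p q i j * minor v a i k = - minor p q j l * minor v a k l := by
    linear_combination -key j k + minor v a i k * anti i j + minor p q j k * z' k +
      minor v a j k * z j
      +minor p q j l * anti' l k
  have eil : minor p q i j * minor v a i l = minor p q j k * minor v a k l := by
    linear_combination -key j l + minor v a i l * anti i j + minor p q j l * z' l +
      minor v a j l * z j
  have ejk : minor p q i j * minor v a j k = minor p q i l * minor v a k l := by
    linear_combination key i k - minor v a i k * z i - minor p q i k * z' k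
      - minor p q i l * anti' l k
  have ejl : minor p q i j * minor v a j l = - minor p q i k * minor v a k l := by
    linear_combination key i l - minor v a i l * z i - minor p q i l * z' l
  have eij : minor p q i j * minor v a i j = minor p q k l * minor v a k l := by
    have h := key i i
    have h' := key j j
    have h'' := key k k
    have h''' := key l l
    simp only [z, z', mul_zero, zero_add, add_zero, anti j i, anti k i, anti l i,
      anti k j, anti l j, anti l k, anti' j i, anti' k i, anti' l i, anti' k j, anti' l j,
      anti' l k] at h h' h'' h'''
    linarith
  constructor
  · rcases hc s with rfl | rfl | rfl | rfl <;> rcases hc t with rfl | rfl | rfl | rfl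
    all_goals first
      | exact ⟨0, by rw [z']; ring⟩
      | exact ⟨_, eij⟩
      | exact ⟨_, eik⟩
      | exact ⟨_, eil⟩
      | exact ⟨_, ejk⟩
      | exact ⟨_, ejl⟩
      | exact ⟨_, rfl⟩
      | (rw [anti' s t]
         first
         | exact ⟨_, by rw [mul_neg, eij, ← neg_mul]⟩
         | exact ⟨_, by rw [mul_neg, eik, ← neg_mul]⟩
         | exact ⟨_, by rw [mul_neg, eil, ← neg_mul]⟩
         | exact ⟨_, by rw [mul_neg, ejk, ← neg_mul]⟩
         | exact ⟨_, by rw [mul_neg, ejl, ← neg_mul]⟩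
         | exact ⟨_, by rw [mul_neg, ← neg_mul]⟩)
  · rw [neg_mul] at eik ejl
    rcases hc s with rfl | rfl | rfl | rfl <;> rcases hc t with rfl | rfl | rfl | rfl
    all_goals first
      | exact ⟨0, by rw [z]; ring⟩
      | exact ⟨_, eij.symm⟩
      | exact ⟨_, eil.symm⟩
      | exact ⟨_, ejk.symm⟩
      | exact ⟨_, rfl⟩
      | exact ⟨_, by rw [← neg_eq_iff_eq_neg.2 eik, ← mul_neg]⟩
      | exact ⟨_, by rw [← neg_eq_iff_eq_neg.2 ejl, ← mul_neg]⟩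
      | (rw [anti s t]
         first
         | exact ⟨_, by rw [neg_mul, ← eij, ← mul_neg]⟩
         | exact ⟨_, by rw [neg_mul, ← eil, ← mul_neg]⟩
         | exact ⟨_, by rw [neg_mul, ← eik]⟩
         | exact ⟨_, by rw [neg_mul, ← ejl]⟩
         | exact ⟨_, by rw [neg_mul, ← ejk, ← mul_neg]⟩
         | exact ⟨_, by rw [neg_mul, ← mul_neg]⟩)

/-- Number of lattice points of a box on a translate of the orthogonal complement of `p, q`. -/
lemma card_coset_le {p q : Fin 4 → ℤ} (c c' : ℤ) {R : ℕ} (hM : minorMax p q ≠ 0)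
    (hMR : minorMax p q ≤ R) (S : Finset (Fin 4 → ℤ))
    (hS : ∀ a ∈ S, ∑ i, p i * a i = c ∧ ∑ i, q i * a i = c' ∧ ∀ i, |a i| ≤ R) :
    minorMax p q * S.card ≤ 72 * R ^ 2 * minorGcd p q := by
  set M := minorMax p q with hMdef
  set G := minorGcd p q with hGdef
  have hG : 1 ≤ G := minorGcd_pos hM
  have hR : 1 ≤ R := by omega
  rcases le_or_gt S.card 1 with h1 | h1
  · calc M * S.card ≤ R * 1 := by gcongr
      _ ≤ 72 * R ^ 2 * G := by nlinarith [Nat.mul_le_mul hR hG, Nat.mul_le_mul hR hR]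
  obtain ⟨a₀, ha₀, a₁, ha₁, hne⟩ := Finset.one_lt_card.1 h1
  have hex : ∃ ℓ : ℕ, ∃ v : Fin 4 → ℤ, v ≠ 0 ∧ ∑ i, p i * v i = 0 ∧ ∑ i, q i * v i = 0 ∧
      (∀ i, |v i| ≤ ℓ) := by
    refine ⟨2 * R, a₁ - a₀, sub_ne_zero.2 hne.symm, ?_, ?_, fun i => ?_⟩
    · simp [mul_sub, Finset.sum_sub_distrib, (hS _ ha₀).1, (hS _ ha₁).1]
    · simp [mul_sub, Finset.sum_sub_distrib, (hS _ ha₀).2.1, (hS _ ha₁).2.1]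
    · have h0 := abs_le.1 ((hS _ ha₀).2.2 i)
      have h1 := abs_le.1 ((hS _ ha₁).2.2 i)
      push_cast
      rw [Pi.sub_apply, abs_le]
      constructor <;> linarith
  classical
  set ℓ := Nat.find hex with hℓ
  obtain ⟨v, hv0, hpv, hqv, hvl⟩ := Nat.find_spec hex
  rw [← hℓ] at hvl
  have hmin : ∀ d : Fin 4 → ℤ, ∑ i, p i * d i = 0 → ∑ i, q i * d i = 0 →
      (∀ i, |d i| < ℓ) → d = 0 := by
    intro d h1 h2 h3
    by_contra hd
    have hl : ℓ ≠ 0 := by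
      intro h; have := h3 0; rw [h] at this
      have := abs_nonneg (d 0); push_cast at *; omega
    refine Nat.find_min hex (m := ℓ - 1) (by omega) ⟨d, hd, h1, h2, fun i => ?_⟩
    have := h3 i
    omega
  have hl2R : ℓ ≤ 2 * R := by
    apply Nat.find_min' hex
    refine ⟨a₁ - a₀, sub_ne_zero.2 hne.symm, ?_, ?_, fun i => ?_⟩
    · simp [mul_sub, Finset.sum_sub_distrib, (hS _ ha₀).1, (hS _ ha₁).1]
    · simp [mul_sub, Finset.sum_sub_distrib, (hS _ ha₀).2.1, (hS _ ha₁).2.1]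
    · have h0 := abs_le.1 ((hS _ ha₀).2.2 i)
      have h1 := abs_le.1 ((hS _ ha₁).2.2 i)
      push_cast
      rw [Pi.sub_apply, abs_le]
      constructor <;> linarith
  obtain ⟨i₀, hi₀⟩ : ∃ i, |v i| = ℓ := by
    by_contra h
    push Not at h
    exact hv0 (hmin v hpv hqv fun i => lt_of_le_of_ne (hvl i) (h i))
  have hl1 : 1 ≤ ℓ := by
    rw [Nat.one_le_iff_ne_zero]
    intro h
    apply hv0
    ext i
    have := hvl i
    rw [h] at this
    simpa using this
  obtain ⟨i, j, hij⟩ := exists_natAbs_minor_eq p q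
  rw [← hMdef] at hij
  have hm0 : minor p q i j ≠ 0 := by
    intro h; rw [h] at hij; exact hM hij.symm
  have hne' : i ≠ j := by
    rintro rfl; apply hm0; simp only [minor]; ring
  obtain ⟨k, l, hc, hsum, -⟩ := exists_complement i j hne'
  obtain ⟨f, hf⟩ := exists_minorGcd_eq p q
  rw [hsum] at hpv hqv
  have hpl : ∀ d : Fin 4 → ℤ, ∑ i, p i * d i = 0 → ∑ i, q i * d i = 0 → ∀ s t,
      (∃ x, minor p q i j * minor v d s t = x * minor v d k l) ∧
      ∃ x, minor p q s t * minor v d k l = minor p q i j * x := by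
    intro d h1 h2
    rw [hsum] at h1 h2
    exact plucker_orthogonal hc hpv hqv h1 h2
  have hdvd : ∀ d : Fin 4 → ℤ, ∑ i, p i * d i = 0 → ∑ i, q i * d i = 0 →
      minor p q i j ∣ G * minor v d k l := by
    intro d h1 h2
    rw [hf, Finset.sum_mul]
    refine Finset.dvd_sum fun s _ => ?_
    rw [Finset.sum_mul]
    refine Finset.dvd_sum fun t _ => ?_
    obtain ⟨x, hx⟩ := (hpl d h1 h2 s t).2
    rw [mul_assoc, hx]
    exact ⟨f s t * x, by ring⟩
  have hpar : ∀ d : Fin 4 → ℤ, ∑ i, p i * d i = 0 → ∑ i, q i * d i = 0 →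
      minor v d k l = 0 → |d i₀| < ℓ → d = 0 := by
    intro d h1 h2 h3 h4
    refine hmin d h1 h2 fun t => ?_
    obtain ⟨x, hx⟩ := (hpl d h1 h2 i₀ t).1
    rw [h3, mul_zero, mul_eq_zero, or_iff_right hm0, minor, sub_eq_zero] at hx
    have h5 : (ℓ : ℤ) * |d t| ≤ ℓ * |d i₀| := by
      rw [← hi₀, ← abs_mul, hx, abs_mul, hi₀]
      exact mul_le_mul_of_nonneg_right (hvl t) (abs_nonneg _)
    have h6 : |d t| ≤ |d i₀| := le_of_mul_le_mul_left h5 (by exact_mod_cast hl1)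
    linarith
  set K := 4 * ℓ * R * G / M with hK
  set J := 2 * R / ℓ with hJ
  have hd0 : ∀ a ∈ S, ∑ i, p i * (a - a₀) i = 0 ∧ ∑ i, q i * (a - a₀) i = 0 ∧
      ∀ i, |(a - a₀) i| ≤ 2 * R := by
    intro a ha
    refine ⟨?_, ?_, fun i => ?_⟩
    · simp [mul_sub, Finset.sum_sub_distrib, (hS _ ha₀).1, (hS _ ha).1]
    · simp [mul_sub, Finset.sum_sub_distrib, (hS _ ha₀).2.1, (hS _ ha).2.1]
    · have h0 := abs_le.1 ((hS _ ha₀).2.2 i)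
      have h1 := abs_le.1 ((hS _ ha).2.2 i)
      rw [Pi.sub_apply, abs_le]
      constructor <;> linarith
  have hlZ : (0 : ℤ) < ℓ := by exact_mod_cast hl1
  have hcard : S.card ≤ (Finset.Icc (-(K : ℤ)) K ×ˢ Finset.Icc (-(J : ℤ) - 1) J).card := by
    refine Finset.card_le_card_of_injOn
      (fun a => (G * minor v (a - a₀) k l / minor p q i j, (a - a₀) i₀ / (ℓ : ℤ))) ?_ ?_
    · intro a ha
      obtain ⟨h1, h2, h3⟩ := hd0 a ha
      rw [Finset.mem_coe, Finset.mem_product, Finset.mem_Icc, Finset.mem_Icc]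
      constructor
      · obtain ⟨x, hx⟩ := hdvd _ h1 h2
        simp only [hx]
        rw [Int.mul_ediv_cancel_left _ hm0, ← abs_le, Int.abs_eq_natAbs]
        norm_cast
        rw [hK, Nat.le_div_iff_mul_le (Nat.pos_of_ne_zero hM), ← hij, mul_comm,
          ← Int.natAbs_mul, ← hx]
        zify
        rw [abs_mul, Nat.abs_cast]
        have : |minor v (a - a₀) k l| ≤ 4 * ℓ * R := by
          simp only [minor]
          calc |v k * (a - a₀) l - v l * (a - a₀) k|
              ≤ |v k * (a - a₀) l| + |v l * (a - a₀) k| := abs_sub _ _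
            _ ≤ ℓ * (2 * R) + ℓ * (2 * R) := by
              rw [abs_mul, abs_mul]
              have := h3 l
              have := h3 k
              have := hvl l
              have := hvl k
              gcongr
            _ = 4 * ℓ * R := by ring
        calc (G : ℤ) * |minor v (a - a₀) k l| ≤ G * (4 * ℓ * R) := by gcongr
          _ = _ := by ring
      · have h4 := abs_le.1 (h3 i₀)
        have h5 : (J : ℤ) = 2 * R / ℓ := by simp [hJ]
        constructor
        · rw [Int.le_ediv_iff_mul_le hlZ]
          have := Int.lt_ediv_add_one_mul_self (2 * R : ℤ) hlZ
          rw [← h5] at this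
          nlinarith
        · rw [h5]
          exact Int.ediv_le_ediv hlZ h4.2
    · intro a ha b hb hab
      obtain ⟨h1, h2, h3⟩ := hd0 a ha
      obtain ⟨h1', h2', h3'⟩ := hd0 b hb
      rw [Prod.mk.injEq] at hab
      obtain ⟨e1, e2⟩ := hab
      obtain ⟨x, hx⟩ := hdvd _ h1 h2
      obtain ⟨x', hx'⟩ := hdvd _ h1' h2'
      rw [hx, hx', Int.mul_ediv_cancel_left _ hm0, Int.mul_ediv_cancel_left _ hm0] at e1
      rw [e1, ← hx'] at hx
      have hG0 : (G : ℤ) ≠ 0 := by exact_mod_cast (by omega : G ≠ 0)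
      have e3 := mul_left_cancel₀ hG0 hx
      rw [← sub_eq_zero]
      apply hpar
      · simpa [mul_sub, Finset.sum_sub_distrib, sub_eq_zero] using h1.trans h1'.symm
      · simpa [mul_sub, Finset.sum_sub_distrib, sub_eq_zero] using h2.trans h2'.symm
      · simp only [minor, Pi.sub_apply] at e3 ⊢
        linarith
      · have hA := Int.emod_add_mul_ediv ((a - a₀) i₀) ℓ
        have hB := Int.emod_add_mul_ediv ((b - a₀) i₀) ℓ
        have e2' : (a - a₀) i₀ / (ℓ : ℤ) = (b - a₀) i₀ / (ℓ : ℤ) := e2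
        rw [e2'] at hA
        have := Int.emod_nonneg ((a - a₀) i₀) hlZ.ne'
        have := Int.emod_nonneg ((b - a₀) i₀) hlZ.ne'
        have := Int.emod_lt_of_pos ((a - a₀) i₀) hlZ
        have := Int.emod_lt_of_pos ((b - a₀) i₀) hlZ
        simp only [Pi.sub_apply] at *
        rw [abs_lt]
        constructor <;> linarith
  rw [Finset.card_product, Int.card_Icc, Int.card_Icc] at hcard
  have hKM : K * M ≤ 4 * ℓ * R * G := Nat.div_mul_le_self _ _
  have hJl : J * ℓ ≤ 2 * R := Nat.div_mul_le_self _ _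
  have hJ1 : 1 ≤ J := by rw [hJ, Nat.le_div_iff_mul_le (by omega)]; omega
  have e1 : ((K : ℤ) + 1 - -(K : ℤ)).toNat = 2 * K + 1 := by omega
  have e2 : ((J : ℤ) + 1 - (-(J : ℤ) - 1)).toNat = 2 * J + 2 := by omega
  rw [e1, e2] at hcard
  have hJ2R : J ≤ 2 * R := by nlinarith
  calc M * S.card ≤ M * ((2 * K + 1) * (2 * J + 2)) := by gcongr
    _ ≤ M * ((2 * K + 1) * (4 * J)) := by gcongr; omega
    _ = 8 * J * (K * M) + 4 * (J * M) := by ring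
    _ ≤ 8 * J * (4 * ℓ * R * G) + 4 * (2 * R * R) := by gcongr
    _ = 32 * (J * ℓ) * (R * G) + 8 * R ^ 2 * 1 := by ring
    _ ≤ 32 * (2 * R) * (R * G) + 8 * R ^ 2 * G := by gcongr
    _ = 72 * R ^ 2 * G := by ring

/-- Prescribed values of the linear forms `p`, `q` are attained at a short integer vector. -/
lemma exists_short_preimage {p q : Fin 4 → ℤ} {B Z : ℕ} (hM : minorMax p q ≠ 0)
    (hp : ∀ i, |p i| ≤ B) (hq : ∀ i, |q i| ≤ B) {x y : ℤ} (hx : (minorGcd p q : ℤ) ∣ x)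
    (hy : (minorGcd p q : ℤ) ∣ y) (hxZ : |x| ≤ Z) (hyZ : |y| ≤ Z) :
    ∃ t : Fin 4 → ℤ, ∑ i, p i * t i = x ∧ ∑ i, q i * t i = y ∧
      ∀ k, |t k| * minorMax p q ≤ 2 * Z * B + 2 * (minorMax p q : ℤ) ^ 2 := by
  obtain ⟨i, j, hij⟩ := exists_natAbs_minor_eq p q
  have hm0 : minor p q i j ≠ 0 := by
    intro h; rw [h] at hij; exact hM hij.symm
  have hne' : i ≠ j := by
    rintro rfl; apply hm0; simp only [minor]; ring
  obtain ⟨k, l, hc, hsum, hik, hil, hjk, hjl, hkl⟩ := exists_complement i j hne'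
  obtain ⟨f, hf⟩ := exists_minorGcd_eq p q
  obtain ⟨x', hx'⟩ := hx
  obtain ⟨y', hy'⟩ := hy
  obtain ⟨t₀, h1, h2⟩ : ∃ t : Fin 4 → ℤ, ∑ i, p i * t i = x ∧ ∑ i, q i * t i = y := by
    refine ⟨fun s => x' * ∑ u, (f s u - f u s) * q u - y' * ∑ u, (f s u - f u s) * p u, ?_, ?_⟩
    · rw [hx', hf]
      simp only [Fin.sum_univ_four, minor]
      ring
    · rw [hy', hf]
      simp only [Fin.sum_univ_four, minor]
      ring
  set m := minor p q i j with hm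
  have hmM : |m| = minorMax p q := by rw [Int.abs_eq_natAbs, hij]
  have hle : ∀ s t, |minor p q s t| ≤ minorMax p q := fun s t => by
    rw [Int.abs_eq_natAbs]; exact_mod_cast natAbs_minor_le p q s t
  obtain ⟨t, ht1, ht2, htk, htl⟩ : ∃ t : Fin 4 → ℤ, ∑ i, p i * t i = x ∧ ∑ i, q i * t i = y ∧
      |t k| < minorMax p q ∧ |t l| < minorMax p q := by
    have aux : ∀ n : ℤ, |n % m| < minorMax p q := fun n => by
      rw [abs_of_nonneg (Int.emod_nonneg _ hm0), ← hmM]; exact Int.emod_lt_abs _ hm0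
    refine ⟨fun s => t₀ s
      - (t₀ k / m) * ((if s = i then (minor p q j k) else 0)
        - (if s = j then (minor p q i k) else 0)
        + (if s = k then m else 0))
      - (t₀ l / m) * ((if s = i then (minor p q j l) else 0)
        - (if s = j then (minor p q i l) else 0)
        + (if s = l then m else 0)), ?_, ?_, ?_, ?_⟩
    · rw [← h1, hsum, hsum]
      simp only [hne', hne'.symm, hik, hil, hjk, hjl, hkl, hik.symm, hil.symm,
        hjk.symm, hjl.symm, hkl.symm, if_true, if_false, hm, minor]
      ring
    · rw [← h2, hsum, hsum]
      simp only [hne', hne'.symm, hik, hil, hjk, hjl, hkl, hik.symm, hil.symm,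
        hjk.symm, hjl.symm, hkl.symm, if_true, if_false, hm, minor]
      ring
    · convert aux (t₀ k) using 2
      simp only [hkl, hik.symm, hjk.symm, if_true, if_false]
      rw [Int.emod_def]
      ring
    · convert aux (t₀ l) using 2
      simp only [hil.symm, hjl.symm, hkl.symm, if_true, if_false]
      rw [Int.emod_def]
      ring
  refine ⟨t, ht1, ht2, fun s => ?_⟩
  have hM0 : (0 : ℤ) ≤ minorMax p q := Nat.cast_nonneg _
  have hZ0 : (0 : ℤ) ≤ 2 * Z * B := by positivity
  have hb : ∀ u, |x * q u - y * p u - t k * minor p q k u - t l * minor p q l u| ≤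
      2 * Z * B + 2 * (minorMax p q : ℤ) ^ 2 := by
    intro u
    have e1 : |x * q u| ≤ Z * B := by
      rw [abs_mul]; have := hq u; gcongr
    have e2 : |y * p u| ≤ Z * B := by
      rw [abs_mul]; have := hp u; gcongr
    have e3 : |t k * minor p q k u| ≤ minorMax p q * minorMax p q := by
      rw [abs_mul]; have := hle k u; gcongr
    have e4 : |t l * minor p q l u| ≤ minorMax p q * minorMax p q := by
      rw [abs_mul]; have := hle l u; gcongr
    rw [abs_le] at *
    constructor <;> nlinarith
  rw [hsum] at ht1 ht2
  rcases hc s with rfl | rfl | rfl | rfl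
  · rw [← hmM, ← abs_mul, hmM]
    refine le_of_eq_of_le (congrArg abs ?_) (hb j)
    rw [← ht1, ← ht2, hm]
    simp only [minor]
    ring
  · rw [← hmM, ← abs_mul, hmM, ← abs_neg]
    refine le_of_eq_of_le (congrArg abs ?_) (hb i)
    rw [← ht1, ← ht2, hm]
    simp only [minor]
    ring
  · nlinarith
  · nlinarith

/-- Number of points of a box on the hyperplane orthogonal to `p`. -/
lemma card_hyperplane_le {p : Fin 4 → ℤ} {i j : Fin 4} (hij : i ≠ j) (hco : IsCoprime (p i) (p j))
    (hi : p i ≠ 0) {b R : ℕ} (hj : p j = b) (hb : 0 < b) (hbR : b ≤ R) (c : ℤ)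
    (S : Finset (Fin 4 → ℤ))
    (hS : ∀ a ∈ S, ∑ i, p i * a i = c ∧ ∀ i, |a i| ≤ R) : b * S.card ≤ 36 * R ^ 3 := by
  obtain ⟨k, l, hc, hsum, -⟩ := exists_complement i j hij
  have hbZ : (0 : ℤ) < b := by exact_mod_cast hb
  set J := R / b with hJ
  have hcard : S.card ≤ (Finset.Icc (-(R : ℤ)) R ×ˢ Finset.Icc (-(R : ℤ)) R ×ˢ
      Finset.Icc (-(J : ℤ) - 1) J).card := by
    refine Finset.card_le_card_of_injOn (fun a => (a k, a l, a i / (b : ℤ))) ?_ ?_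
    · intro a ha
      have h := fun i => abs_le.1 ((hS a ha).2 i)
      simp only [Finset.mem_coe, Finset.mem_product, Finset.mem_Icc]
      refine ⟨h k, h l, ?_, ?_⟩
      · have h5 : (J : ℤ) = R / b := by simp [hJ]
        rw [Int.le_ediv_iff_mul_le hbZ]
        have := Int.lt_ediv_add_one_mul_self (R : ℤ) hbZ
        rw [← h5] at this
        nlinarith [h i]
      · have h5 : (J : ℤ) = R / b := by simp [hJ]
        rw [h5]
        exact Int.ediv_le_ediv hbZ (h i).2
    · intro a ha a' ha' h
      simp only [Prod.mk.injEq] at h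
      obtain ⟨e1, e2, e3⟩ := h
      have h1 := (hS a ha).1
      have h2 := (hS a' ha').1
      rw [hsum] at h1 h2
      rw [e1, e2] at h1
      have h3 : p i * (a i - a' i) = - (p j * (a j - a' j)) := by linear_combination h1 - h2
      have h4 : p j ∣ a i - a' i :=
        hco.symm.dvd_of_dvd_mul_left ⟨-(a j - a' j), by rw [h3]; ring⟩
      have h5 : a i = a' i := by
        rw [← sub_eq_zero]
        apply Int.eq_zero_of_abs_lt_dvd h4
        rw [hj]
        have hA := Int.emod_add_mul_ediv (a i) b
        have hB := Int.emod_add_mul_ediv (a' i) b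
        rw [e3] at hA
        have := Int.emod_nonneg (a i) hbZ.ne'
        have := Int.emod_nonneg (a' i) hbZ.ne'
        have := Int.emod_lt_of_pos (a i) hbZ
        have := Int.emod_lt_of_pos (a' i) hbZ
        rw [abs_lt]
        constructor <;> linarith
      have h6 : a j = a' j := by
        rw [h5, sub_self, mul_zero] at h3
        have : p j * (a j - a' j) = 0 := by linarith
        rw [mul_eq_zero, or_iff_right (by rw [hj]; exact hbZ.ne'), sub_eq_zero] at this
        exact this
      ext s
      rcases hc s with rfl | rfl | rfl | rfl <;> assumption
  rw [Finset.card_product, Finset.card_product, Int.card_Icc, Int.card_Icc] at hcard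
  have e1 : ((R : ℤ) + 1 - -(R : ℤ)).toNat = 2 * R + 1 := by omega
  have e2 : ((J : ℤ) + 1 - (-(J : ℤ) - 1)).toNat = 2 * J + 2 := by omega
  rw [e1, e2] at hcard
  have hJl : J * b ≤ R := Nat.div_mul_le_self _ _
  have hJ1 : 1 ≤ J := by rw [hJ, Nat.le_div_iff_mul_le (by omega)]; omega
  calc b * S.card ≤ b * ((2 * R + 1) * ((2 * R + 1) * (2 * J + 2))) := by gcongr
    _ ≤ b * ((3 * R) * ((3 * R) * (4 * J))) := by gcongr <;> omega
    _ = 36 * R ^ 2 * (J * b) := by ring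
    _ ≤ 36 * R ^ 2 * R := by gcongr
    _ = 36 * R ^ 3 := by ring

lemma factorial_dvd_pow_mul_prod (K b g : ℕ) :
    K.factorial ∣ g ^ K * ∏ i ∈ Finset.range K, (b + i * g) := by
  rw [Nat.dvd_iff_prime_pow_dvd_dvd]
  intro ℓ k hℓ hk
  by_cases hg : ℓ ∣ g
  · have h1 : k ≤ K.factorial.factorization ℓ :=
      (hℓ.pow_dvd_iff_le_factorization (Nat.factorial_ne_zero K)).1 hk
    have h2 : k ≤ K := by
      refine h1.trans ((Nat.factorization_factorial_le_div_pred hℓ K).trans ?_)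
      exact Nat.div_le_self _ _
    exact Dvd.dvd.mul_right ((pow_dvd_pow_of_dvd hg k).trans (pow_dvd_pow g h2)) _
  · have hco : Nat.Coprime g (ℓ ^ k) := ((hℓ.coprime_iff_not_dvd.2 hg).symm).pow_right k
    have : NeZero (ℓ ^ k) := ⟨pow_ne_zero _ hℓ.ne_zero⟩
    rw [← ZMod.natCast_eq_zero_iff]
    push_cast
    have hu : (g : ZMod (ℓ ^ k)) * (g : ZMod (ℓ ^ k))⁻¹ = 1 := ZMod.coe_mul_inv_eq_one g hco
    set c : ℕ := ((b : ZMod (ℓ ^ k)) * (g : ZMod (ℓ ^ k))⁻¹).val with hc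
    have hcc : (c : ZMod (ℓ ^ k)) = (b : ZMod (ℓ ^ k)) * (g : ZMod (ℓ ^ k))⁻¹ := by
      rw [hc, ZMod.natCast_val, ZMod.cast_id', id]
    have h1 : ∏ i ∈ Finset.range K, ((b : ZMod (ℓ ^ k)) + i * g) =
        g ^ K * ((c.ascFactorial K : ℕ) : ZMod (ℓ ^ k)) := by
      rw [Nat.ascFactorial_eq_prod_range]
      push_cast
      rw [← Finset.card_range K, ← Finset.prod_const, Finset.card_range, ← Finset.prod_mul_distrib]
      refine Finset.prod_congr rfl fun i _ => ?_
      rw [hcc]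
      linear_combination -(b : ZMod (ℓ ^ k)) * hu
    rw [h1, (ZMod.natCast_eq_zero_iff _ _).2 (hk.trans (Nat.factorial_dvd_ascFactorial c K))]
    ring

/-- A short progression contains few primes. -/
lemma factorial_mul_pow_le {K b g z Y : ℕ} (hb : 1 ≤ b) (hg : 1 ≤ g) (hz : K < z)
    (hY : ∀ i < K, b + i * g ≤ Y) (T : Finset ℕ) (hT : ∀ t ∈ T, t < K ∧ (b + t * g).Prime ∧
      z ≤ b + t * g) :
    K.factorial * z ^ T.card ≤ (g * Y) ^ K := by
  have hsub : T ⊆ Finset.range K := fun t ht => Finset.mem_range.2 (hT t ht).1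
  have h1 : (∏ t ∈ T, (b + t * g)) ∣ g ^ K * ∏ i ∈ Finset.range K, (b + i * g) :=
    Dvd.dvd.mul_left (Finset.prod_dvd_prod_of_subset _ _ _ hsub) _
  have hco : Nat.Coprime K.factorial (∏ t ∈ T, (b + t * g)) := by
    refine Nat.Coprime.prod_right fun t ht => ?_
    obtain ⟨-, h2, h3⟩ := hT t ht
    rw [Nat.coprime_comm, h2.coprime_iff_not_dvd, h2.dvd_factorial]
    omega
  have h2 := hco.mul_dvd_of_dvd_of_dvd (factorial_dvd_pow_mul_prod K b g) h1
  have hpos : 0 < g ^ K * ∏ i ∈ Finset.range K, (b + i * g) := by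
    have : ∀ i ∈ Finset.range K, 0 < b + i * g := fun i _ => by omega
    have := Finset.prod_pos this
    positivity
  calc K.factorial * z ^ T.card ≤ K.factorial * ∏ t ∈ T, (b + t * g) := by
        gcongr
        exact Finset.pow_card_le_prod T _ z fun t ht => (hT t ht).2.2
    _ ≤ g ^ K * ∏ i ∈ Finset.range K, (b + i * g) := Nat.le_of_dvd hpos h2
    _ ≤ g ^ K * ∏ i ∈ Finset.range K, Y := by
        gcongr with i hi; exact hY i (Finset.mem_range.1 hi)
    _ = (g * Y) ^ K := by rw [Finset.prod_const, Finset.card_range, mul_pow]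

/-- Upper bound for the number of primes in a short progression. -/
lemma card_primes_progression_le {g L B z : ℕ} (T : Finset ℕ) (hg : 1 ≤ g)
    (hT : ∀ t ∈ T, t.Prime ∧ z ≤ t ∧ t ≤ B)
    (hd : ∀ s ∈ T, ∀ t ∈ T, s ≤ t → g ∣ t - s ∧ t - s ≤ L) (hL : L ≤ B) (hK : L / g + 1 < z) :
    T.card * Real.log z ≤ (L / g + 1 : ℕ) * (1 + Real.log (2 * g * B / (L / g + 1 : ℕ))) := by
  set K := L / g + 1 with hKdef
  rcases T.eq_empty_or_nonempty with rfl | hne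
  · rcases Nat.eq_zero_or_pos B with rfl | hB
    · simp
    · simp
      refine mul_nonneg (by positivity) (add_nonneg zero_le_one (Real.log_nonneg ?_))
      rw [le_div_iff₀ (by positivity)]
      have h1 : K ≤ B + 1 := by
        have := Nat.div_le_self L g
        omega
      have h2 : K ≤ 2 * g * B := by nlinarith
      rw [one_mul]
      exact_mod_cast h2
  set b := T.min' hne with hb
  have hbT : b ∈ T := T.min'_mem hne
  have hb1 : 1 ≤ b := (hT b hbT).1.one_lt.le
  have hmin : ∀ t ∈ T, b ≤ t := fun t ht => T.min'_le t ht
  have hB : 1 ≤ B := hb1.trans (hT b hbT).2.2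
  have heq : ∀ t ∈ T, b + (t - b) / g * g = t := fun t ht => by
    have := hmin t ht
    rw [Nat.div_mul_cancel (hd b hbT t ht this).1]
    omega
  have hinj : Set.InjOn (fun t => (t - b) / g) (T : Set ℕ) := by
    intro s hs t ht h
    rw [← heq s hs, ← heq t ht]
    simp only at h
    rw [h]
  have h1 := factorial_mul_pow_le (K := K) (b := b) (g := g) (z := z) (Y := 2 * B) hb1 hg hK
    (fun i hi => by
      have h1 : i * g ≤ L / g * g := Nat.mul_le_mul_right _ (by omega)
      have h2 := Nat.div_mul_le_self L g
      have h3 := (hT b hbT).2.2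
      omega) (T.image fun t => (t - b) / g) (by
      intro t ht
      obtain ⟨s, hs, rfl⟩ := Finset.mem_image.1 ht
      rw [heq s hs]
      refine ⟨?_, (hT s hs).1, (hT s hs).2.1⟩
      have := Nat.div_le_div_right (c := g) (hd b hbT s hs (hmin s hs)).2
      omega)
  rw [Finset.card_image_of_injOn hinj] at h1
  have hK0 : (0 : ℝ) < K := by exact_mod_cast Nat.succ_pos _
  have hz0 : (0 : ℝ) < z := by exact_mod_cast (Nat.zero_le _).trans_lt hK
  have h2 := Real.pow_div_factorial_le_exp (K : ℝ) K.cast_nonneg K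
  have hf0 : (0 : ℝ) < K.factorial := by exact_mod_cast K.factorial_pos
  rw [div_le_iff₀ hf0] at h2
  have h3 : (K : ℝ) ^ K * z ^ T.card ≤ Real.exp K * (2 * g * B) ^ K := by
    calc (K : ℝ) ^ K * z ^ T.card ≤ Real.exp K * K.factorial * z ^ T.card := by gcongr
      _ = Real.exp K * ((K.factorial * z ^ T.card : ℕ) : ℝ) := by push_cast; ring
      _ ≤ Real.exp K * (((g * (2 * B)) ^ K : ℕ) : ℝ) := by
        gcongr
      _ = _ := by push_cast; ring
  have hgB : (0 : ℝ) < 2 * g * B := by positivity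
  have h4 := Real.log_le_log (by positivity) h3
  rw [Real.log_mul (by positivity) (by positivity), Real.log_mul (by positivity) (by positivity),
    Real.log_pow, Real.log_pow, Real.log_pow, Real.log_exp] at h4
  rw [Real.log_div hgB.ne' hK0.ne']
  linarith

/-- A quadruple of naturals, viewed as integers. -/
def quadCast (p : Fin 4 → ℕ) : Fin 4 → ℤ := fun i => (p i : ℤ)

/-- Quadruples of primes in `[z, B]` that are not all equal. -/
def primeQuads (z B : ℕ) : Finset (Fin 4 → ℕ) :=
  (Fintype.piFinset fun _ => (Finset.Icc z B).filter Nat.Prime).filter fun p => ∃ i j, p i ≠ p j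

lemma mem_primeQuads {z B : ℕ} {p : Fin 4 → ℕ} : p ∈ primeQuads z B ↔
    (∀ i, z ≤ p i ∧ p i ≤ B ∧ (p i).Prime) ∧ ∃ i j, p i ≠ p j := by
  simp [primeQuads, Fintype.mem_piFinset, and_assoc]

/-- Pairs of prime quadruples whose minors have gcd `g` and maximum in `[2 ^ j, 2 ^ (j + 1))`. -/
def minorCell (z B g j : ℕ) : Finset ((Fin 4 → ℕ) × (Fin 4 → ℕ)) :=
  (primeQuads z B ×ˢ primeQuads z B).filter fun x =>
    minorMax (quadCast x.1) (quadCast x.2) ≠ 0 ∧ minorGcd (quadCast x.1) (quadCast x.2) = g ∧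
      Nat.log 2 (minorMax (quadCast x.1) (quadCast x.2)) = j

lemma mem_minorCell {z B g j : ℕ} {p q : Fin 4 → ℕ} (h : (p, q) ∈ minorCell z B g j) :
    p ∈ primeQuads z B ∧ q ∈ primeQuads z B ∧ p ≠ q ∧
    (∀ s t, (g : ℤ) ∣ (p s : ℤ) * q t - p t * q s) ∧
    (∀ s t, |(p s : ℤ) * q t - p t * q s| < 2 ^ (j + 1)) ∧ 1 ≤ g ∧ g < 2 ^ (j + 1) ∧
    2 ^ j ≤ B ^ 2 := by
  simp only [minorCell, Finset.mem_filter, Finset.mem_product] at h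
  obtain ⟨⟨hp, hq⟩, h0, hG, hj⟩ := h
  have hlt : minorMax (quadCast p) (quadCast q) < 2 ^ (j + 1) := by
    rw [← hj]; exact Nat.lt_pow_succ_log_self (by norm_num) _
  refine ⟨hp, hq, ?_, fun s t => ?_, fun s t => ?_, ?_, ?_, ?_⟩
  · rintro rfl
    apply h0
    obtain ⟨s, t, hst⟩ := exists_natAbs_minor_eq (quadCast p) (quadCast p)
    rw [← hst]
    simp only [minor, Int.natAbs_eq_zero]
    ring
  · rw [← hG]; exact minorGcd_dvd (quadCast p) (quadCast q) s t
  · have := natAbs_minor_le (quadCast p) (quadCast q) s t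
    have h2 := this.trans_lt hlt
    have h3 : |minor (quadCast p) (quadCast q) s t| < 2 ^ (j + 1) := by
      rw [Int.abs_eq_natAbs]
      exact_mod_cast h2
    exact h3
  · rw [← hG]; exact minorGcd_pos h0
  · rw [← hG]; exact (minorGcd_le_minorMax h0).trans_lt hlt
  · have h1 : 2 ^ j ≤ minorMax (quadCast p) (quadCast q) := by
      rw [← hj]; exact Nat.pow_log_le_self 2 h0
    refine h1.trans ?_
    obtain ⟨s, t, hst⟩ := exists_natAbs_minor_eq (quadCast p) (quadCast q)
    rw [← hst]
    have hp' := fun i => ((mem_primeQuads.1 hp).1 i).2.1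
    have hq' := fun i => ((mem_primeQuads.1 hq).1 i).2.1
    zify
    simp only [minor, quadCast]
    have e1 : (p s : ℤ) * q t ≤ B ^ 2 := by
      rw [sq]; have := hp' s; have := hq' t; gcongr
    have e2 : (p t : ℤ) * q s ≤ B ^ 2 := by
      rw [sq]; have := hp' t; have := hq' s; gcongr
    have e3 : (0 : ℤ) ≤ (p s : ℤ) * q t := by positivity
    have e4 : (0 : ℤ) ≤ (p t : ℤ) * q s := by positivity
    rw [abs_le]; constructor <;> linarith

/-- Bound for a cell not using primality beyond coprimality. -/
lemma card_minorCell_le_unsieved {z B g j : ℕ} (hz : 1 ≤ z) :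
    (minorCell z B g j).card ≤
      4 * ((B + 1) ^ 2 * ((2 * (2 ^ (j + 1) / g) + 1) * (B / z + 1)) ^ 3) := by
  classical
  set D := 2 ^ (j + 1) with hD
  have hsub : minorCell z B g j ⊆ Finset.univ.biUnion fun i : Fin 4 =>
      (minorCell z B g j).filter fun x => x.1 i ≠ x.2 i := by
    rintro ⟨p, q⟩ h
    obtain ⟨i, hi⟩ := Function.ne_iff.1 (mem_minorCell h).2.2.1
    simp only [Finset.mem_biUnion, Finset.mem_univ, true_and, Finset.mem_filter]
    exact ⟨i, h, hi⟩
  refine (Finset.card_le_card hsub).trans (Finset.card_biUnion_le.trans ?_)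
  have : ∀ i ∈ (Finset.univ : Finset (Fin 4)),
      ((minorCell z B g j).filter fun x => x.1 i ≠ x.2 i).card ≤
      (B + 1) ^ 2 * ((2 * (D / g) + 1) * (B / z + 1)) ^ 3 := by
    intro i _
    have hc : ((minorCell z B g j).filter fun x => x.1 i ≠ x.2 i).card ≤
        (Fintype.piFinset fun s : Fin 4 => if s = i then
          Finset.Icc (0 : ℤ) B ×ˢ Finset.range (B + 1) else
          Finset.Icc (-((D / g : ℕ) : ℤ)) ((D / g : ℕ) : ℤ) ×ˢ Finset.range (B / z + 1)).card := by
      refine Finset.card_le_card_of_injOn (fun x s => if s = i then ((x.2 i : ℤ), x.1 i) else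
        (((x.1 i : ℤ) * x.2 s - x.1 s * x.2 i) / g, x.1 s / x.1 i)) ?_ ?_
      · rintro ⟨p, q⟩ h
        obtain ⟨h, hne⟩ := Finset.mem_filter.1 h
        obtain ⟨hp, hq, -, h1, h2, h3, -⟩ := mem_minorCell h
        have hp' := (mem_primeQuads.1 hp).1
        have hq' := (mem_primeQuads.1 hq).1
        rw [Finset.mem_coe, Fintype.mem_piFinset]
        intro s
        by_cases hs : s = i
        · simp only [hs, if_true, Finset.mem_product, Finset.mem_Icc, Finset.mem_range]
          have := (hp' i).2.1
          have := (hq' i).2.1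
          omega
        · simp only [hs, if_false, Finset.mem_product, Finset.mem_Icc, Finset.mem_range]
          have hg0 : (0 : ℤ) < g := by exact_mod_cast h3
          constructor
          · obtain ⟨y, hy⟩ := h1 i s
            rw [hy, Int.mul_ediv_cancel_left _ hg0.ne', ← abs_le, Int.abs_eq_natAbs]
            norm_cast
            rw [Nat.le_div_iff_mul_le h3]
            have h4 := h2 i s
            rw [hy, abs_mul, Nat.abs_cast, Int.abs_eq_natAbs] at h4
            rw [mul_comm]
            exact_mod_cast h4.le
          · rw [Nat.lt_succ_iff]
            exact Nat.div_le_div (hp' s).2.1 (hp' i).1 (by omega)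
      · rintro ⟨p, q⟩ h ⟨p', q'⟩ h' heq
        obtain ⟨h, hne⟩ := Finset.mem_filter.1 h
        obtain ⟨h', hne'⟩ := Finset.mem_filter.1 h'
        obtain ⟨hp, hq, -, h1, h2, h3, -⟩ := mem_minorCell h
        obtain ⟨hp', hq', -, h1', h2', -⟩ := mem_minorCell h'
        have hi := congrFun heq i
        simp only [if_true, Prod.mk.injEq, Nat.cast_inj] at hi
        obtain ⟨hi2, hi1⟩ := hi
        have hg0 : (g : ℤ) ≠ 0 := by exact_mod_cast (by omega : g ≠ 0)
        have hpp := ((mem_primeQuads.1 hp).1 i).2.2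
        have hqp := ((mem_primeQuads.1 hq).1 i).2.2
        have hco : IsCoprime (p i : ℤ) (q i : ℤ) :=
          Nat.isCoprime_iff_coprime.2 ((Nat.coprime_primes hpp hqp).2 hne)
        have hp0 : (0 : ℤ) < p i := by exact_mod_cast hpp.pos
        have key : ∀ s, p s = p' s ∧ q s = q' s := by
          intro s
          by_cases hs : s = i
          · rw [hs]; exact ⟨hi1, hi2⟩
          · have h5 := congrFun heq s
            simp only [hs, if_false, Prod.mk.injEq] at h5
            obtain ⟨h6, h7⟩ := h5
            rw [← hi1, ← hi2] at h6
            rw [← hi1] at h7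
            obtain ⟨y, hy⟩ := h1 i s
            obtain ⟨y', hy'⟩ := h1' i s
            rw [← hi1, ← hi2] at hy'
            rw [hy, hy', Int.mul_ediv_cancel_left _ hg0, Int.mul_ediv_cancel_left _ hg0] at h6
            rw [h6, ← hy'] at hy
            have h8 : (p i : ℤ) ∣ (p s : ℤ) - p' s :=
              hco.dvd_of_dvd_mul_left ⟨(q s : ℤ) - q' s, by linear_combination -hy⟩
            have h9 : (p s : ℤ) = p' s := by
              rw [← sub_eq_zero]
              apply Int.eq_zero_of_abs_lt_dvd h8
              have hA := Nat.mod_add_div (p s) (p i)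
              have hB := Nat.mod_add_div (p' s) (p i)
              rw [← h7] at hB
              have := Nat.mod_lt (p s) hpp.pos
              have := Nat.mod_lt (p' s) hpp.pos
              rw [abs_lt]
              constructor <;> omega
            refine ⟨by exact_mod_cast h9, ?_⟩
            rw [h9] at hy
            have : (p i : ℤ) * ((q s : ℤ) - q' s) = 0 := by linarith
            rw [mul_eq_zero, or_iff_right hp0.ne', sub_eq_zero] at this
            exact_mod_cast this
        rw [Prod.mk.injEq]
        exact ⟨funext fun s => (key s).1, funext fun s => (key s).2⟩
    refine hc.trans_eq ?_
    rw [Fintype.card_piFinset]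
    have : ∀ s : Fin 4, (if s = i then
          Finset.Icc (0 : ℤ) B ×ˢ Finset.range (B + 1) else
          Finset.Icc (-((D / g : ℕ) : ℤ)) ((D / g : ℕ) : ℤ) ×ˢ Finset.range (B / z + 1)).card =
        if s = i then (B + 1) * (B + 1) else (2 * (D / g) + 1) * (B / z + 1) := by
      intro s
      split_ifs
      · simp [Finset.card_product]
      · rw [Finset.card_product, Finset.card_range, Int.card_Icc]
        congr 1
        omega
    rw [Finset.prod_congr rfl fun s _ => this s]
    fin_cases i <;> simp [Fin.prod_univ_four] <;> ring
  refine (Finset.sum_le_sum this).trans_eq ?_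
  simp

lemma card_primeQuads_le (z B : ℕ) :
    (primeQuads z B).card ≤ ((Finset.Icc z B).filter Nat.Prime).card ^ 4 := by
  refine (Finset.card_filter_le _ _).trans_eq ?_
  rw [Fintype.card_piFinset]
  simp

/-- Bound for a cell in terms of the number of primes in short progressions. -/
lemma card_minorCell_le_sieved {z B g j t : ℕ} (hgz : g < z)
    (ht : ∀ T : Finset ℕ, (∀ s ∈ T, s.Prime ∧ z ≤ s ∧ s ≤ B) →
      (∀ s ∈ T, ∀ u ∈ T, s ≤ u → g ∣ u - s ∧ u - s ≤ min (2 ^ (j + 2) / z) B) → T.card ≤ t) :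
    (minorCell z B g j).card ≤ ((Finset.Icc z B).filter Nat.Prime).card ^ 5 * t ^ 3 := by
  classical
  set P := (Finset.Icc z B).filter Nat.Prime with hP
  have h1 : (minorCell z B g j).card ≤
      t ^ 3 * ((minorCell z B g j).image fun x => (x.1, x.2 0)).card := by
    refine Finset.card_le_mul_card_image _ _ ?_
    rintro ⟨p, q₀⟩ -
    obtain ⟨F, hF⟩ : ∃ F, F = (minorCell z B g j).filter fun x => (x.1, x.2 0) = (p, q₀) :=
      ⟨_, rfl⟩
    obtain ⟨T, hT⟩ : ∃ T : Fin 4 → Finset ℕ, T = fun s => F.image fun x => x.2 s := ⟨_, rfl⟩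
    rw [← hF]
    have hFs : ∀ x ∈ F, (p, x.2) ∈ minorCell z B g j ∧ x.1 = p ∧ x.2 0 = q₀ := by
      rintro ⟨p', q⟩ hx
      obtain ⟨hx, he⟩ := Finset.mem_filter.1 (hF ▸ hx)
      rw [Prod.mk.injEq] at he
      have he1 : p' = p := he.1
      rw [he1] at hx
      exact ⟨hx, he⟩
    have hTs : ∀ s, ∀ u ∈ T s, ∃ q, (p, q) ∈ minorCell z B g j ∧ q 0 = q₀ ∧ q s = u := by
      intro s u hu
      rw [hT] at hu
      obtain ⟨x, hx, hxu⟩ := Finset.mem_image.1 hu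
      exact ⟨x.2, (hFs x hx).1, (hFs x hx).2.2, hxu⟩
    have hTc : ∀ s, (T s).card ≤ t := by
      intro s
      apply ht
      · intro u hu
        obtain ⟨q, hx, -, hqu⟩ := hTs s u hu
        have := (mem_primeQuads.1 (mem_minorCell hx).2.1).1 s
        rw [hqu] at this
        exact ⟨this.2.2, this.1, this.2.1⟩
      · intro u hu v hv huv
        obtain ⟨q, hx, he, hqu⟩ := hTs s u hu
        obtain ⟨q', hx', he', hqv⟩ := hTs s v hv
        rw [← hqu, ← hqv] at huv ⊢
        obtain ⟨hp, hq, -, h1, h2, h3, -⟩ := mem_minorCell hx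
        obtain ⟨-, hq', -, h1', h2', -⟩ := mem_minorCell hx'
        have hps := (mem_primeQuads.1 hp).1 0
        have hqs := (mem_primeQuads.1 hq).1 s
        have hqs' := (mem_primeQuads.1 hq').1 s
        have a1 := h1 0 s
        have a2 := h1' 0 s
        have b1 := abs_lt.1 (h2 0 s)
        have b2 := abs_lt.1 (h2' 0 s)
        rw [he] at a1 b1
        rw [he'] at a2 b2
        have heq : (p 0 : ℤ) * (q' s - q s : ℕ) =
          ((p 0 : ℤ) * q' s - p s * q₀) - ((p 0 : ℤ) * q s - p s * q₀) := by
          rw [Nat.cast_sub huv]; ring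
        constructor
        · have hd : (g : ℤ) ∣ (p 0 : ℤ) * (q' s - q s : ℕ) := heq ▸ dvd_sub a2 a1
          have hd' : g ∣ p 0 * (q' s - q s) := by exact_mod_cast hd
          refine Nat.Coprime.dvd_of_dvd_mul_left ?_ hd'
          rw [Nat.coprime_comm, hps.2.2.coprime_iff_not_dvd]
          intro hdv
          have := Nat.le_of_dvd h3 hdv
          omega
        · rw [le_min_iff]
          constructor
          · rw [Nat.le_div_iff_mul_le (by omega)]
            have h5 : (p 0 : ℤ) * (q' s - q s : ℕ) ≤ 2 ^ (j + 2) := by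
              rw [heq, pow_succ]; linarith
            have h6 : p 0 * (q' s - q s) ≤ 2 ^ (j + 2) := by exact_mod_cast h5
            calc (q' s - q s) * z ≤ (q' s - q s) * p 0 := by gcongr; exact hps.1
              _ ≤ _ := by rw [mul_comm]; exact h6
          · have := hqs'.2.1
            omega
    have hcard : F.card ≤ (T 1 ×ˢ T 2 ×ˢ T 3).card := by
      refine Finset.card_le_card_of_injOn (fun x => (x.2 1, x.2 2, x.2 3)) ?_ ?_
      · intro x hx
        simp only [Finset.mem_coe, Finset.mem_product, hT]
        exact ⟨Finset.mem_image_of_mem _ hx, Finset.mem_image_of_mem _ hx,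
          Finset.mem_image_of_mem _ hx⟩
      · intro x hx y hy h
        obtain ⟨-, e1, e2⟩ := hFs x hx
        obtain ⟨-, e3, e4⟩ := hFs y hy
        simp only [Prod.mk.injEq] at h
        refine Prod.ext (e1.trans e3.symm) (funext fun s => ?_)
        fin_cases s
        · exact e2.trans e4.symm
        · exact h.1
        · exact h.2.1
        · exact h.2.2
    refine hcard.trans ?_
    rw [Finset.card_product, Finset.card_product]
    calc (T 1).card * ((T 2).card * (T 3).card) ≤ t * (t * t) := by
          gcongr <;> apply hTc
      _ = t ^ 3 := by ring
  have h2 : ((minorCell z B g j).image fun x => (x.1, x.2 0)).card ≤ P.card ^ 4 * P.card := by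
    refine (Finset.card_le_card (t := primeQuads z B ×ˢ P) ?_).trans ?_
    · intro y hy
      obtain ⟨⟨p, q⟩, hx, rfl⟩ := Finset.mem_image.1 hy
      obtain ⟨hp, hq, -⟩ := mem_minorCell hx
      have := (mem_primeQuads.1 hq).1 0
      simp only [Finset.mem_product, hP, Finset.mem_filter, Finset.mem_Icc]
      exact ⟨hp, ⟨this.1, this.2.1⟩, this.2.2⟩
    · rw [Finset.card_product]
      gcongr
      exact card_primeQuads_le z B
  calc _ ≤ _ := h1
    _ ≤ t ^ 3 * (P.card ^ 4 * P.card) := by gcongr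
    _ = _ := by ring

/-- Chebyshev's upper bound. -/
lemma exists_card_primes_le : ∃ C : ℝ, 0 < C ∧ ∀ᶠ B : ℕ in atTop, ∀ z : ℕ,
    (((Finset.Icc z B).filter Nat.Prime).card : ℝ) ≤ C * B / Real.log B := by
  refine ⟨Real.log 4 + 1, by positivity, ?_⟩
  filter_upwards [tendsto_natCast_atTop_atTop.eventually
    (Chebyshev.eventually_primeCounting_le one_pos)] with B hB z
  refine le_trans ?_ hB
  rw [Nat.floor_natCast, Nat.primeCounting, Nat.primeCounting', Nat.count_eq_card_filter_range]
  norm_cast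
  refine Finset.card_le_card fun p hp => ?_
  simp only [Finset.mem_filter, Finset.mem_Icc, Finset.mem_range] at hp ⊢
  exact ⟨by omega, hp.2⟩

lemma one_add_log_le {u : ℝ} (hu : 1 ≤ u) :
    ∃ w : ℝ, 0 ≤ w ∧ w ^ 12 = u ∧ 1 + Real.log u ≤ 13 * w := by
  refine ⟨u ^ (1 / 12 : ℝ), by positivity, ?_, ?_⟩
  · rw [← Real.rpow_natCast, ← Real.rpow_mul (by linarith)]
    norm_num
  · have h1 := Real.log_le_rpow_div (show 0 ≤ u by linarith) (show (0 : ℝ) < 1 / 12 by norm_num)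
    have h2 : (1 : ℝ) ≤ u ^ (1 / 12 : ℝ) := Real.one_le_rpow hu (by norm_num)
    linarith

lemma eventually_log_pow_le (c : ℝ) (hc : 0 < c) (k : ℕ) :
    ∀ᶠ B : ℕ in atTop, Real.log B ^ k ≤ c * B := by
  have h := (Real.isLittleO_pow_log_id_atTop (n := k)).bound hc
  filter_upwards [tendsto_natCast_atTop_atTop.eventually h, eventually_ge_atTop 1] with B hB h1
  have h0 : 0 ≤ Real.log B := Real.log_natCast_nonneg B
  simpa [abs_of_nonneg h0] using hB

lemma card_minorCell_le_of_small {κ : ℝ} (hκ : 0 < κ) (hκ1 : κ ≤ 1) {B z g j : ℕ} (hB : 1 ≤ B)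
    (hz : κ * B ≤ z) (hg : 1 ≤ g) (hgD : g < 2 ^ (j + 1)) {l : ℝ}
    (hU : 2 ^ j * l ^ 8 ≤ B ^ 2 * √g) :
    (minorCell z B g j).card * l ^ 8 * (g ^ 2 * √g) ≤ 16 * (12 / κ) ^ 3 * B ^ 4 * 4 ^ j := by
  have hB' : (1 : ℝ) ≤ B := by exact_mod_cast hB
  have hg' : (1 : ℝ) ≤ g := by exact_mod_cast hg
  have hz0 : (0 : ℝ) < z := lt_of_lt_of_le (by positivity) hz
  have hz1 : 1 ≤ z := by exact_mod_cast hz0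
  have hsq : √(g : ℝ) * √g = g := Real.mul_self_sqrt (by positivity)
  have h1 : ((minorCell z B g j).card : ℝ) ≤
      4 * ((B + 1) ^ 2 *
        ((2 * ((2 ^ (j + 1) / g : ℕ) : ℝ) + 1) * (((B / z : ℕ) : ℝ) + 1)) ^ 3) := by
    have := card_minorCell_le_unsieved (z := z) (B := B) (g := g) (j := j) hz1
    calc ((minorCell z B g j).card : ℝ) ≤ ((4 * ((B + 1) ^ 2 *
          ((2 * (2 ^ (j + 1) / g) + 1) * (B / z + 1)) ^ 3) : ℕ) : ℝ) := by exact_mod_cast this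
      _ = _ := by push_cast; ring
  have h2 : ((2 ^ (j + 1) / g : ℕ) : ℝ) ≤ 2 * 2 ^ j / g := by
    refine Nat.cast_div_le.trans_eq ?_
    push_cast; ring
  have h2' : (1 : ℝ) ≤ 2 * 2 ^ j / g := by
    rw [le_div_iff₀ (by positivity), one_mul]
    have : (g : ℝ) < 2 ^ (j + 1) := by exact_mod_cast hgD
    rw [pow_succ] at this; linarith
  have h3 : ((B / z : ℕ) : ℝ) ≤ 1 / κ := by
    refine Nat.cast_div_le.trans ?_
    rw [div_le_div_iff₀ hz0 hκ]; linarith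
  have h3' : 1 ≤ 1 / κ := by rw [le_div_iff₀ hκ]; linarith
  have h4 : ((minorCell z B g j).card : ℝ) ≤ 16 * B ^ 2 * (12 / κ * (2 ^ j / g)) ^ 3 := by
    refine h1.trans ?_
    calc 4 * (((B : ℝ) + 1) ^ 2 *
          ((2 * ((2 ^ (j + 1) / g : ℕ) : ℝ) + 1) * (((B / z : ℕ) : ℝ) + 1)) ^ 3)
        ≤ 4 * (((B : ℝ) + B) ^ 2 * ((3 * (2 * 2 ^ j / g)) * (2 * (1 / κ))) ^ 3) := by
          gcongr <;> linarith
      _ = _ := by ring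
  calc (minorCell z B g j).card * l ^ 8 * (g ^ 2 * √g)
      ≤ 16 * B ^ 2 * (12 / κ * (2 ^ j / g)) ^ 3 * l ^ 8 * (g ^ 2 * √g) := by gcongr
    _ = 16 * (12 / κ) ^ 3 * B ^ 2 * (2 ^ j) ^ 2 * (2 ^ j * l ^ 8) * √g / g := by
      field_simp
    _ ≤ 16 * (12 / κ) ^ 3 * B ^ 2 * (2 ^ j) ^ 2 * (B ^ 2 * √g) * √g / g := by gcongr
    _ = 16 * (12 / κ) ^ 3 * B ^ 4 * (2 ^ j) ^ 2 * (√g * √g) / g := by ring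
    _ = 16 * (12 / κ) ^ 3 * B ^ 4 * 4 ^ j := by
      rw [hsq, ← pow_mul, mul_comm j 2, pow_mul]
      norm_num
      field_simp

lemma card_minorCell_le_of_large {κ C₀ : ℝ} (hκ : 0 < κ) (hκ1 : κ ≤ 1) (hC₀ : 0 < C₀)
    {B z g j : ℕ} (hB : 1 ≤ B)
    (hz : κ * B ≤ z) (hg : 1 ≤ g) (hgz : g < z) (hjB : 2 ^ j ≤ B ^ 2)
    {l : ℝ} (hl : 0 < l) (hlz : l ≤ 2 * Real.log z)
    (hπ : (((Finset.Icc z B).filter Nat.Prime).card : ℝ) ≤ C₀ * B / l)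
    (hE : (B : ℝ) * g ≤ 2 ^ j) :
    (minorCell z B g j).card * l ^ 8 * (g ^ 2 * √g) ≤
      C₀ ^ 5 * (2 + C₀ / κ) ^ 3 * 13 ^ 3 * (25 / κ ^ 2) * (250 / κ ^ 3) * B ^ 4 * 4 ^ j := by
  have hB' : (1 : ℝ) ≤ B := by exact_mod_cast hB
  have hg' : (1 : ℝ) ≤ g := by exact_mod_cast hg
  have hz0 : (0 : ℝ) < z := lt_of_lt_of_le (by positivity) hz
  have hz1 : 1 ≤ z := by exact_mod_cast hz0
  have hsq : √(g : ℝ) * √g = g := Real.mul_self_sqrt (by positivity)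
  set L := min (2 ^ (j + 2) / z) B with hL
  set K := L / g + 1 with hK
  have hK0 : (0 : ℝ) < K := by exact_mod_cast Nat.succ_pos _
  have hKB : (K : ℝ) ≤ 2 * g * B := by
    have h1 : K ≤ B + 1 := by
      have h2 := Nat.div_le_self L g
      have h3 : L ≤ B := min_le_right _ _
      omega
    have h2 : K ≤ 2 * g * B := by nlinarith
    exact_mod_cast h2
  have hu1 : 1 ≤ 2 * (g : ℝ) * B / K := by rwa [le_div_iff₀ hK0, one_mul]
  obtain ⟨w, hw0, hw, hwlog⟩ := one_add_log_le hu1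
  have hlog0 := Real.log_nonneg hu1
  set τ : ℝ := (2 + C₀ / κ) * (K * (13 * w)) / l with hτ
  have hτ0 : 0 ≤ τ := by positivity
  have h1 := card_minorCell_le_sieved (z := z) (B := B) (g := g) (j := j) (t := ⌊τ⌋₊) hgz (by
    intro T hT hT'
    rw [Nat.le_floor_iff hτ0, hτ, le_div_iff₀ hl]
    have hlow : (K : ℝ) * 1 ≤ K * (13 * w) := by gcongr; linarith
    rcases lt_or_ge K z with hKz | hKz
    · have := card_primes_progression_le T hg hT hT' (min_le_right _ _) hKz
      rw [← hL, ← hK] at this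
      have hc : (0 : ℝ) ≤ T.card := Nat.cast_nonneg _
      calc (T.card : ℝ) * l ≤ T.card * (2 * Real.log z) := by gcongr
        _ = 2 * (T.card * Real.log z) := by ring
        _ ≤ 2 * (K * (1 + Real.log (2 * g * B / K))) := by gcongr
        _ ≤ 2 * (K * (13 * w)) := by gcongr
        _ ≤ (2 + C₀ / κ) * (K * (13 * w)) := by
          gcongr
          have : 0 < C₀ / κ := by positivity
          linarith
    · have hc : (T.card : ℝ) ≤ C₀ * B / l := by
        refine le_trans ?_ hπ
        norm_cast
        refine Finset.card_le_card fun p hp => ?_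
        have := hT p hp
        simp only [Finset.mem_filter, Finset.mem_Icc]
        tauto
      rw [le_div_iff₀ hl] at hc
      have hKz' : (z : ℝ) ≤ K := by exact_mod_cast hKz
      calc (T.card : ℝ) * l ≤ C₀ * B := hc
        _ = C₀ / κ * (κ * B) := by field_simp
        _ ≤ C₀ / κ * (K * (13 * w)) := mul_le_mul_of_nonneg_left (by linarith) (by positivity)
        _ ≤ (2 + C₀ / κ) * (K * (13 * w)) := by gcongr; linarith)
  have h2 : ((minorCell z B g j).card : ℝ) ≤ (C₀ * B / l) ^ 5 * τ ^ 3 := by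
    calc ((minorCell z B g j).card : ℝ) ≤
        (((Finset.Icc z B).filter Nat.Prime).card : ℝ) ^ 5 * (⌊τ⌋₊ : ℝ) ^ 3 := by exact_mod_cast h1
      _ ≤ _ := by
        gcongr
        exact Nat.floor_le hτ0
  set E : ℝ := 2 ^ j / (B * g) with hEdef
  have hE1 : 1 ≤ E := by rwa [hEdef, le_div_iff₀ (by positivity), one_mul]
  have hKE : (K : ℝ) ≤ 5 / κ * E := by
    have e1 : ((L / g : ℕ) : ℝ) ≤ 4 / κ * E := by
      calc ((L / g : ℕ) : ℝ) ≤ L / g := Nat.cast_div_le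
        _ ≤ ((2 ^ (j + 2) / z : ℕ) : ℝ) / g := by
          gcongr; exact min_le_left _ _
        _ ≤ (2 ^ (j + 2) / z) / g := by
          gcongr
          refine Nat.cast_div_le.trans_eq ?_
          push_cast; ring
        _ ≤ (2 ^ (j + 2) / (κ * B)) / g := by gcongr
        _ = 4 / κ * E := by rw [hEdef]; field_simp; ring
    have e2 : 1 ≤ 1 / κ * E := by
      have : 1 ≤ 1 / κ := by rw [le_div_iff₀ hκ]; linarith
      nlinarith
    rw [hK]; push_cast
    calc ((L / g : ℕ) : ℝ) + 1 ≤ 4 / κ * E + 1 / κ * E := by linarith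
      _ = _ := by ring
  have hv : √(g : ℝ) * (K * w ^ 3) / B ≤ 250 / κ ^ 3 := by
    have h250 : 1 ≤ 250 / κ ^ 3 := by
      rw [le_div_iff₀ (by positivity)]
      have : κ ^ 3 ≤ 1 := pow_le_one₀ hκ.le hκ1
      linarith
    have hjB' : (2 : ℝ) ^ j ≤ B ^ 2 := by exact_mod_cast hjB
    have h4 : (√(g : ℝ) * (K * w ^ 3) / B) ^ 4 ≤ (250 / κ ^ 3) ^ 4 := by
      calc (√(g : ℝ) * (K * w ^ 3) / B) ^ 4 = (√(g : ℝ) * √g) ^ 2 * K ^ 4 * w ^ 12 / B ^ 4 := by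
            ring
        _ = (g : ℝ) ^ 2 * K ^ 4 * (2 * g * B / K) / B ^ 4 := by rw [hsq, hw]
        _ = 2 * g ^ 3 * B * (K : ℝ) ^ 3 / B ^ 4 := by field_simp
        _ ≤ 2 * g ^ 3 * B * (5 / κ * E) ^ 3 / B ^ 4 := by gcongr
        _ = 250 / κ ^ 3 * ((2 ^ j) ^ 3 / (B ^ 2) ^ 3) := by rw [hEdef]; field_simp; ring
        _ ≤ 250 / κ ^ 3 * 1 := by
          gcongr
          rw [div_le_one (by positivity)]
          gcongr
        _ ≤ (250 / κ ^ 3) ^ 4 := by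
          rw [mul_one]; exact le_self_pow₀ h250 (by norm_num)
    exact le_of_pow_le_pow_left₀ (by norm_num) (by positivity) h4
  calc (minorCell z B g j).card * l ^ 8 * (g ^ 2 * √g)
      ≤ ((C₀ * B / l) ^ 5 * τ ^ 3) * l ^ 8 * (g ^ 2 * √g) := by gcongr
    _ = C₀ ^ 5 * (2 + C₀ / κ) ^ 3 * 13 ^ 3 * B ^ 6 * (K : ℝ) ^ 2 * g ^ 2
        * (√(g : ℝ) * (K * w ^ 3) / B) := by
      rw [hτ]; field_simp
    _ ≤ C₀ ^ 5 * (2 + C₀ / κ) ^ 3 * 13 ^ 3 * B ^ 6 * (5 / κ * E) ^ 2 * g ^ 2 * (250 / κ ^ 3) := by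
      gcongr
    _ = C₀ ^ 5 * (2 + C₀ / κ) ^ 3 * 13 ^ 3 * (25 / κ ^ 2) * (250 / κ ^ 3) * B ^ 4 *
          (2 ^ j) ^ 2 := by
      rw [hEdef]; field_simp; norm_num
    _ = _ := by rw [← pow_mul, mul_comm j 2, pow_mul]; norm_num

/-- Bound for the number of pairs of prime quadruples with given gcd and size of minors. -/
lemma exists_card_minorCell_le {κ : ℝ} (hκ : 0 < κ) (hκ1 : κ ≤ 1) : ∃ C : ℝ, 0 < C ∧
    ∀ᶠ B : ℕ in atTop, ∀ z : ℕ, κ * B ≤ z → ∀ g j : ℕ,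
      (minorCell z B g j).card * Real.log B ^ 8 * (g ^ 2 * √g) ≤ C * B ^ 4 * 4 ^ j := by
  obtain ⟨C₀, hC₀, hπ⟩ := exists_card_primes_le
  refine ⟨16 * (12 / κ) ^ 3 +
    C₀ ^ 5 * (2 + C₀ / κ) ^ 3 * 13 ^ 3 * (25 / κ ^ 2) * (250 / κ ^ 3), by positivity, ?_⟩
  have hlogκ : ∀ᶠ B : ℕ in atTop, 1 ≤ κ ^ 2 * (B : ℝ) :=
    (tendsto_natCast_atTop_atTop.const_mul_atTop (by positivity)).eventually_ge_atTop 1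
  filter_upwards [hπ, eventually_log_pow_le (κ / 2) (by positivity) 16, eventually_ge_atTop 3,
    hlogκ] with B hπ hlog hB3 hlogκ z hz g j
  have hB0 : (0 : ℝ) < B := by exact_mod_cast (by omega : 0 < B)
  rcases (minorCell z B g j).eq_empty_or_nonempty with he | ⟨⟨p, q⟩, hx⟩
  · rw [he]; simp; positivity
  obtain ⟨-, -, -, -, -, hg, hgD, hjB⟩ := mem_minorCell hx
  have hl : 0 < Real.log B := Real.log_pos (by exact_mod_cast (by omega : 1 < B))
  rw [add_mul, add_mul]
  rcases le_or_gt (2 ^ j * Real.log B ^ 8) (B ^ 2 * √g) with hU | hS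
  · refine (card_minorCell_le_of_small hκ hκ1 (by omega) hz hg hgD hU).trans ?_
    have : 0 ≤ C₀ ^ 5 * (2 + C₀ / κ) ^ 3 * 13 ^ 3 * (25 / κ ^ 2) * (250 / κ ^ 3) *
        (B : ℝ) ^ 4 * 4 ^ j := by positivity
    linarith
  · have hg' : (1 : ℝ) ≤ g := by exact_mod_cast hg
    have hs0 : 0 < √(g : ℝ) := Real.sqrt_pos.2 (by linarith)
    have hsq : √(g : ℝ) * √g = g := Real.mul_self_sqrt (by positivity)
    have hjB' : (2 : ℝ) ^ j ≤ B ^ 2 := by exact_mod_cast hjB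
    have hs : √(g : ℝ) ≤ Real.log B ^ 8 := by
      have : (B : ℝ) ^ 2 * √g ≤ B ^ 2 * Real.log B ^ 8 := hS.le.trans (by gcongr)
      exact le_of_mul_le_mul_left this (by positivity)
    have hg16 : (g : ℝ) ≤ Real.log B ^ 16 := by
      calc (g : ℝ) = √g * √g := hsq.symm
        _ ≤ Real.log B ^ 8 * Real.log B ^ 8 := by gcongr
        _ = _ := by ring
    have hgz : g < z := by
      have : (g : ℝ) < z := by
        have : 0 < κ * B := by positivity
        linarith
      exact_mod_cast this
    have hlz : Real.log B ≤ 2 * Real.log z := by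
      have hz0 : (0 : ℝ) < z := lt_of_lt_of_le (by positivity) hz
      have : (B : ℝ) ≤ z ^ 2 := by
        calc (B : ℝ) ≤ (κ * B) ^ 2 := by nlinarith
          _ ≤ z ^ 2 := by gcongr
      have h2 := Real.log_le_log hB0 this
      rw [Real.log_pow] at h2
      exact_mod_cast h2
    have hE : (B : ℝ) * g ≤ 2 ^ j := by
      have h1 : √(g : ℝ) * Real.log B ^ 8 ≤ B := by
        calc √(g : ℝ) * Real.log B ^ 8 ≤ Real.log B ^ 8 * Real.log B ^ 8 := by gcongr
          _ = Real.log B ^ 16 := by ring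
          _ ≤ κ / 2 * B := hlog
          _ ≤ 1 * B := by gcongr; linarith
          _ = B := one_mul _
      have h2 : (B : ℝ) * g * Real.log B ^ 8 ≤ 2 ^ j * Real.log B ^ 8 := by
        calc (B : ℝ) * g * Real.log B ^ 8 = B * √g * (√g * Real.log B ^ 8) := by
              linear_combination (-(B : ℝ) * Real.log B ^ 8) * hsq
          _ ≤ B * √g * B := by gcongr
          _ = B ^ 2 * √g := by ring
          _ ≤ _ := hS.le
      exact le_of_mul_le_mul_right h2 (by positivity)
    refine (card_minorCell_le_of_large hκ hκ1 hC₀ (by omega) hz hg hgz hjB hl hlz (hπ z)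
      hE).trans ?_
    have : 0 ≤ 16 * (12 / κ) ^ 3 * (B : ℝ) ^ 4 * 4 ^ j := by positivity
    linarith

/-- The tail `∑_{g > N} g^{-3/2}`. -/
noncomputable def threeHalvesTail (N : ℕ) : ℝ :=
  ∑' k : ℕ, 1 / (((k + (N + 1) : ℕ) : ℝ) * √((k + (N + 1) : ℕ) : ℝ))

lemma summable_three_halves : Summable fun g : ℕ => 1 / ((g : ℝ) * √(g : ℝ)) := by
  have h := (Real.summable_one_div_nat_rpow (p := 3 / 2)).2 (by norm_num)
  refine h.congr fun g => ?_
  rcases Nat.eq_zero_or_pos g with rfl | hg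
  · norm_num
  · rw [show (3 / 2 : ℝ) = 1 + 1 / 2 by norm_num, Real.rpow_add (by exact_mod_cast hg),
      Real.rpow_one, Real.sqrt_eq_rpow]

lemma tendsto_threeHalvesTail : Tendsto threeHalvesTail atTop (𝓝 0) := by
  have h := tendsto_sum_nat_add fun g : ℕ => 1 / ((g : ℝ) * √(g : ℝ))
  exact (tendsto_add_atTop_iff_nat (f := fun i => ∑' k : ℕ,
    1 / (((k + i : ℕ) : ℝ) * √((k + i : ℕ) : ℝ))) 1).2 h

lemma sum_le_threeHalvesTail (N K : ℕ) :
    ∑ g ∈ Finset.Ico (N + 1) K, 1 / ((g : ℝ) * √(g : ℝ)) ≤ threeHalvesTail N := by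
  rw [Finset.sum_Ico_eq_sum_range]
  have hs : Summable fun k : ℕ => 1 / (((k + (N + 1) : ℕ) : ℝ) * √((k + (N + 1) : ℕ) : ℝ)) :=
    (summable_nat_add_iff (N + 1)).2 summable_three_halves
  refine le_trans (le_of_eq ?_) (hs.sum_le_tsum (Finset.range (K - (N + 1)))
    fun i _ => by positivity)
  refine Finset.sum_congr rfl fun i _ => ?_
  rw [add_comm i]

lemma sum_two_pow_log_le {m : ℕ} (hm : m ≠ 0) :
    ∑ j ∈ Finset.range (Nat.log 2 m + 1), (2 : ℝ) ^ j ≤ 2 * m := by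
  have h1 : ∑ j ∈ Finset.range (Nat.log 2 m + 1), (2 : ℝ) ^ j = 2 ^ (Nat.log 2 m + 1) - 1 := by
    rw [geom_sum_eq (by norm_num)]; norm_num
  have h2 : (2 : ℝ) ^ Nat.log 2 m ≤ m := by exact_mod_cast Nat.pow_log_le_self 2 hm
  rw [h1, pow_succ]; linarith

lemma exists_sum_gcd_div_max_le {κ : ℝ} (hκ : 0 < κ) (hκ1 : κ ≤ 1) :
    ∃ C : ℝ, 0 < C ∧ ∀ᶠ B : ℕ in atTop, ∀ z : ℕ, κ * B ≤ z → ∀ (N : ℕ) (Y : ℝ), 0 ≤ Y → ∀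
      (S : Finset ((Fin 4 → ℕ) × (Fin 4 → ℕ))),
      (∀ x ∈ S, x.1 ∈ primeQuads z B ∧ x.2 ∈ primeQuads z B ∧
        minorMax (quadCast x.1) (quadCast x.2) ≠ 0 ∧
        (minorMax (quadCast x.1) (quadCast x.2) : ℝ) ≤ Y ∧
        N < minorGcd (quadCast x.1) (quadCast x.2)) →
      (∑ x ∈ S, (minorGcd (quadCast x.1) (quadCast x.2) : ℝ) /
        minorMax (quadCast x.1) (quadCast x.2)) * Real.log B ^ 8 ≤
        C * B ^ 4 * Y * threeHalvesTail N := by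
  obtain ⟨C, hC, hcell⟩ := exists_card_minorCell_le hκ hκ1
  refine ⟨2 * C, by positivity, ?_⟩
  filter_upwards [hcell] with B hB z hz N Y hY0 S hS
  rcases S.eq_empty_or_nonempty with rfl | ⟨x₀, hx₀⟩
  · have h0 : 0 ≤ threeHalvesTail N := tsum_nonneg fun k => by positivity
    simp only [Finset.sum_empty, zero_mul]
    positivity
  set m := ⌊Y⌋₊ with hm
  have hm0 : m ≠ 0 := by
    have h1 := (hS x₀ hx₀).2.2.1
    have h2 := Nat.le_floor (hS x₀ hx₀).2.2.2.1
    omega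
  let G : (Fin 4 → ℕ) × (Fin 4 → ℕ) → ℕ := fun x => minorGcd (quadCast x.1) (quadCast x.2)
  let M : (Fin 4 → ℕ) × (Fin 4 → ℕ) → ℕ := fun x => minorMax (quadCast x.1) (quadCast x.2)
  let f : (Fin 4 → ℕ) × (Fin 4 → ℕ) → ℕ × ℕ := fun x => (G x, Nat.log 2 (M x))
  have hmap : ∀ x ∈ S, f x ∈ Finset.Ico (N + 1) (m + 1) ×ˢ Finset.range (Nat.log 2 m + 1) := by
    intro x hx
    obtain ⟨-, -, h3, h4, h5⟩ := hS x hx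
    have h6 := minorGcd_le_minorMax h3
    have h7 : minorMax (quadCast x.1) (quadCast x.2) ≤ m := Nat.le_floor h4
    have h8 := Nat.log_mono_right (b := 2) h7
    simp only [f, G, M, Finset.mem_product, Finset.mem_Ico, Finset.mem_range]
    omega
  rw [← Finset.sum_fiberwise_of_maps_to hmap, Finset.sum_mul]
  calc _ ≤ ∑ c ∈ Finset.Ico (N + 1) (m + 1) ×ˢ Finset.range (Nat.log 2 m + 1),
        C * B ^ 4 * (1 / ((c.1 : ℝ) * √(c.1 : ℝ)) * 2 ^ c.2) := by
        refine Finset.sum_le_sum fun c hc => ?_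
        obtain ⟨g, j⟩ := c
        simp only [Finset.mem_product, Finset.mem_Ico, Finset.mem_range] at hc
        have hg : (0 : ℝ) < g := by exact_mod_cast (show 0 < g by omega)
        have hbound : ∀ x ∈ S.filter (fun x => f x = (g, j)),
            (minorGcd (quadCast x.1) (quadCast x.2) : ℝ) /
              minorMax (quadCast x.1) (quadCast x.2) ≤ g / 2 ^ j := by
          intro x hx
          obtain ⟨hxS, hx⟩ := Finset.mem_filter.1 hx
          have h3 := (hS x hxS).2.2.1
          simp only [f, G, M, Prod.mk.injEq] at hx
          rw [hx.1, ← hx.2]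
          gcongr
          exact_mod_cast Nat.pow_log_le_self 2 h3
        have hsub : S.filter (fun x => f x = (g, j)) ⊆ minorCell z B g j := by
          intro x hx
          obtain ⟨hxS, hx⟩ := Finset.mem_filter.1 hx
          obtain ⟨h1, h2, h3, -, -⟩ := hS x hxS
          simp only [f, G, M, Prod.mk.injEq] at hx
          exact Finset.mem_filter.2 ⟨Finset.mem_product.2 ⟨h1, h2⟩, h3, hx.1, hx.2⟩
        have h1 := Finset.sum_le_card_nsmul _ _ _ hbound
        rw [nsmul_eq_mul] at h1
        have h2 : ((S.filter (fun x => f x = (g, j))).card : ℝ) ≤ (minorCell z B g j).card := by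
          exact_mod_cast Finset.card_le_card hsub
        have h3 := hB z hz g j
        have hl := Real.log_natCast_nonneg B
        have h4 : (4 : ℝ) ^ j = 2 ^ j * 2 ^ j := by rw [← mul_pow]; norm_num
        have hs : 0 < √(g : ℝ) := Real.sqrt_pos.2 hg
        calc _ ≤ (minorCell z B g j).card * (g / 2 ^ j : ℝ) * Real.log B ^ 8 := by
              gcongr
              exact h1.trans (by gcongr)
          _ = (minorCell z B g j).card * Real.log B ^ 8 * (g ^ 2 * √g) / (2 ^ j * (g * √g)) := by
              field_simp
          _ ≤ C * B ^ 4 * 4 ^ j / (2 ^ j * (g * √g)) := by gcongr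
          _ = C * B ^ 4 * (1 / ((g : ℝ) * √(g : ℝ)) * 2 ^ j) := by
              rw [h4]; field_simp
    _ = C * B ^ 4 * ((∑ g ∈ Finset.Ico (N + 1) (m + 1), 1 / ((g : ℝ) * √(g : ℝ))) *
          ∑ j ∈ Finset.range (Nat.log 2 m + 1), (2 : ℝ) ^ j) := by
        rw [← Finset.mul_sum, Finset.sum_product, Finset.sum_mul_sum]
    _ ≤ C * B ^ 4 * (threeHalvesTail N * (2 * Y)) := by
        have := sum_two_pow_log_le hm0
        have h2 : (m : ℝ) ≤ Y := Nat.floor_le hY0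
        have h0 : 0 ≤ threeHalvesTail N := tsum_nonneg fun k => by positivity
        gcongr
        · exact sum_le_threeHalvesTail N (m + 1)
        · linarith
    _ = _ := by ring

/-- The integer quadruples with all coordinates at most `R` in absolute value. -/
noncomputable def box (R : ℕ) : Finset (Fin 4 → ℤ) :=
  Fintype.piFinset fun _ => Finset.Icc (-(R : ℤ)) R

lemma mem_box {R : ℕ} {a : Fin 4 → ℤ} : a ∈ box R ↔ ∀ i, |a i| ≤ R := by
  simp [box, Fintype.mem_piFinset, abs_le]

/-- A Lipschitz weight, at least `1` on `|a| ≤ n` and supported on `|a| ≤ 2n`. -/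
noncomputable def weight (n : ℕ) (a : Fin 4 → ℤ) : ℝ := max 0 (2 - ‖a‖ / n)

lemma weight_nonneg (n : ℕ) (a : Fin 4 → ℤ) : 0 ≤ weight n a := le_max_left _ _

lemma weight_le (n : ℕ) (a : Fin 4 → ℤ) : weight n a ≤ 2 := by
  refine max_le (by norm_num) ?_
  have : 0 ≤ ‖a‖ / n := by positivity
  linarith

lemma norm_le_of_abs_le {R : ℝ} (hR : 0 ≤ R) {a : Fin 4 → ℤ} (h : ∀ i, (|a i| : ℤ) ≤ R) :
    ‖a‖ ≤ R := by
  refine (pi_norm_le_iff_of_nonneg hR).2 fun i => ?_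
  rw [Int.norm_eq_abs]; exact_mod_cast h i

lemma one_le_weight {n : ℕ} (hn : 0 < n) {a : Fin 4 → ℤ} (h : ∀ i, |a i| ≤ n) :
    1 ≤ weight n a := by
  refine le_max_of_le_right ?_
  have h1 : ‖a‖ ≤ n := norm_le_of_abs_le (by positivity) fun i => by exact_mod_cast h i
  have h2 : ‖a‖ / n ≤ 1 := (div_le_one (by exact_mod_cast hn)).2 h1
  linarith

lemma abs_le_of_weight_ne_zero {n : ℕ} (hn : 0 < n) {a : Fin 4 → ℤ} (h : weight n a ≠ 0) (i) :
    |a i| ≤ ((2 * n : ℕ) : ℤ) := by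
  have h1 : 0 < 2 - ‖a‖ / n := by
    by_contra hc
    exact h (max_eq_left (not_lt.1 hc))
  have h2 : ‖a‖ < 2 * n := by
    rwa [sub_pos, div_lt_iff₀ (by exact_mod_cast hn)] at h1
  have h3 := (norm_le_pi_norm a i).trans h2.le
  rw [Int.norm_eq_abs] at h3
  exact_mod_cast h3

lemma abs_weight_sub_le (n : ℕ) (a b : Fin 4 → ℤ) :
    |weight n a - weight n b| ≤ ‖a - b‖ / n := by
  refine (abs_max_sub_max_le_max 0 _ 0 _).trans ?_
  rw [sub_self, abs_zero, max_eq_right (abs_nonneg _)]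
  rw [show 2 - ‖a‖ / (n : ℝ) - (2 - ‖b‖ / n) = -((‖a‖ - ‖b‖) / n) by ring, abs_neg, abs_div,
    abs_of_nonneg (Nat.cast_nonneg (α := ℝ) n)]
  gcongr
  exact abs_norm_sub_norm_le a b

lemma sum_box_add {f : (Fin 4 → ℤ) → ℝ} {R R' : ℕ} (t : Fin 4 → ℤ)
    (hf : ∀ a, f a ≠ 0 → ∀ i, |a i| ≤ R) (ht : ∀ i, |t i| + R ≤ R') :
    ∑ a ∈ box R', f (a + t) = ∑ a ∈ box R', f a := by
  refine Finset.sum_bij_ne_zero (fun a _ _ => a + t) ?_ ?_ ?_ ?_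
  · intro a _ h
    refine mem_box.2 fun i => (hf _ h i).trans ?_
    have := ht i
    have := abs_nonneg (t i)
    linarith
  · intro a _ _ b _ _ h
    exact add_right_cancel h
  · intro b _ h
    refine ⟨b - t, mem_box.2 fun i => ?_, by simpa using h, by simp⟩
    have h1 := hf b h i
    have h2 := ht i
    have h3 := abs_sub (b i) (t i)
    simp only [Pi.sub_apply]
    linarith
  · intro a _ _; rfl

/-- Indicator of the hyperplane orthogonal to `p`. -/
noncomputable def ind (p a : Fin 4 → ℤ) : ℝ := if ∑ i, p i * a i = 0 then 1 else 0

lemma ind_nonneg (p a) : 0 ≤ ind p a := by unfold ind; split_ifs <;> norm_num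

/-- Weighted correlation of the increments of two hyperplane indicators. -/
noncomputable def pairCorr (n : ℕ) (p q k : Fin 4 → ℤ) : ℝ :=
  ∑ a ∈ box (3 * n), weight n a * ((ind p a - ind p (a + k)) * (ind q a - ind q (a + k)))

lemma sum_ind_mul_ind_le {p q : Fin 4 → ℤ} {R : ℕ} (hM : minorMax p q ≠ 0)
    (hMR : minorMax p q ≤ R) (s t : Fin 4 → ℤ) :
    ∑ a ∈ box R, ind p (a + s) * ind q (a + t) ≤ 72 * R ^ 2 * (minorGcd p q / minorMax p q) := by
  set S := (box R).filter fun a => ∑ i, p i * a i = -∑ i, p i * s i ∧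
    ∑ i, q i * a i = -∑ i, q i * t i with hS
  have h1 := card_coset_le _ _ hM hMR S (fun a ha => by
    rw [hS, Finset.mem_filter, mem_box] at ha
    exact ⟨ha.2.1, ha.2.2, ha.1⟩)
  have h2 : ∑ a ∈ box R, ind p (a + s) * ind q (a + t) = S.card := by
    rw [Finset.card_filter, Nat.cast_sum]
    refine Finset.sum_congr rfl fun a _ => ?_
    simp only [ind, Pi.add_apply, mul_add, Finset.sum_add_distrib, add_eq_zero_iff_eq_neg]
    split_ifs <;> simp_all
  have h3 : (0 : ℝ) < minorMax p q := by exact_mod_cast Nat.pos_of_ne_zero hM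
  rw [h2, ← mul_div_assoc, le_div_iff₀ h3]
  rw [mul_comm]
  exact_mod_cast h1

lemma abs_pairCorr_le {p q : Fin 4 → ℤ} {n : ℕ} (hM : minorMax p q ≠ 0)
    (hMn : minorMax p q ≤ n) (k : Fin 4 → ℤ) :
    |pairCorr n p q k| ≤ 5184 * n ^ 2 * (minorGcd p q / minorMax p q) := by
  have hb : ∀ s t : Fin 4 → ℤ, ∑ a ∈ box (3 * n), ind p (a + s) * ind q (a + t) ≤
      648 * n ^ 2 * (minorGcd p q / minorMax p q) := fun s t => by
    refine (sum_ind_mul_ind_le hM (by omega) s t).trans_eq ?_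
    push_cast; ring
  have h0 := hb 0 0
  have h1 := hb 0 k
  have h2 := hb k 0
  have h3 := hb k k
  simp only [add_zero] at h0 h1 h2
  refine (Finset.abs_sum_le_sum_abs _ _).trans ?_
  calc _ ≤ ∑ a ∈ box (3 * n), 2 * (ind p a * ind q a + ind p a * ind q (a + k) +
        ind p (a + k) * ind q a + ind p (a + k) * ind q (a + k)) := by
        refine Finset.sum_le_sum fun a _ => ?_
        rw [abs_mul, abs_of_nonneg (weight_nonneg _ _)]
        have e1 := ind_nonneg p a
        have e2 := ind_nonneg q a
        have e3 := ind_nonneg p (a + k)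
        have e4 := ind_nonneg q (a + k)
        refine mul_le_mul (weight_le n a) ?_ (abs_nonneg _) (by norm_num)
        rw [abs_mul]
        calc _ ≤ (ind p a + ind p (a + k)) * (ind q a + ind q (a + k)) := by
              gcongr <;> rw [abs_le] <;> constructor <;> linarith
          _ = _ := by ring
    _ ≤ _ := by
        rw [← Finset.mul_sum, Finset.sum_add_distrib, Finset.sum_add_distrib,
          Finset.sum_add_distrib]
        linarith

lemma abs_pairCorr_le_of_shift {p q k t t' : Fin 4 → ℤ} {n : ℕ} (hn : 0 < n)
    (hM : minorMax p q ≠ 0) (hMn : minorMax p q ≤ n)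
    (htp : ∑ i, p i * t i = 0) (htq : ∑ i, q i * t i = -∑ i, q i * k i)
    (htp' : ∑ i, p i * t' i = -∑ i, p i * k i) (htq' : ∑ i, q i * t' i = 0)
    {T : ℝ} (hT : T ≤ n) (hk : ∀ i, (|k i| : ℤ) ≤ T) (ht : ∀ i, (|t i| : ℤ) ≤ T)
    (ht' : ∀ i, (|t' i| : ℤ) ≤ T) :
    |pairCorr n p q k| ≤ 1944 * n * T * (minorGcd p q / minorMax p q) := by
  have hT0 : 0 ≤ T := le_trans (by positivity) (hk 0)
  have hkn : ∀ i, |(-k) i| + ((2 * n : ℕ) : ℤ) ≤ ((3 * n : ℕ) : ℤ) := fun i => by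
    have : ((|k i| : ℤ) : ℝ) ≤ n := (hk i).trans hT
    have : |k i| ≤ n := by exact_mod_cast this
    rw [Pi.neg_apply, abs_neg]; push_cast; linarith
  have htn : ∀ i, |t i| + ((2 * n : ℕ) : ℤ) ≤ ((3 * n : ℕ) : ℤ) := fun i => by
    have : ((|t i| : ℤ) : ℝ) ≤ n := (ht i).trans hT
    have : |t i| ≤ n := by exact_mod_cast this
    push_cast; linarith
  have htn' : ∀ i, |t' i| + ((2 * n : ℕ) : ℤ) ≤ ((3 * n : ℕ) : ℤ) := fun i => by
    have : ((|t' i| : ℤ) : ℝ) ≤ n := (ht' i).trans hT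
    have : |t' i| ≤ n := by exact_mod_cast this
    push_cast; linarith
  have hsupp : ∀ g : (Fin 4 → ℤ) → ℝ, ∀ a, weight n a * g a ≠ 0 → ∀ i, |a i| ≤ ((2 * n : ℕ) : ℤ) :=
    fun g a h => abs_le_of_weight_ne_zero hn (left_ne_zero_of_mul h)
  have e1 := sum_box_add t (hsupp fun a => ind p a * ind q (a + k)) htn
  have e2 := sum_box_add t' (hsupp fun a => ind p (a + k) * ind q a) htn'
  have e3 := sum_box_add (-k) (hsupp fun a => ind p (a + k) * ind q (a + k)) hkn
  have hp0 : ∀ a s : Fin 4 → ℤ, ∑ i, p i * s i = 0 → ind p (a + s) = ind p a := fun a s h => by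
    simp only [ind, Pi.add_apply, mul_add, Finset.sum_add_distrib, h, add_zero]
  have hq0 : ∀ a s : Fin 4 → ℤ, ∑ i, q i * s i = 0 → ind q (a + s) = ind q a := fun a s h => by
    simp only [ind, Pi.add_apply, mul_add, Finset.sum_add_distrib, h, add_zero]
  have i1 : ∀ a, ind p (a + t) * ind q (a + t + k) = ind p a * ind q a := fun a => by
    rw [hp0 a t htp, add_assoc, hq0 a (t + k)]
    simp only [Pi.add_apply, mul_add, Finset.sum_add_distrib, htq]; ring
  have i2 : ∀ a, ind p (a + t' + k) * ind q (a + t') = ind p a * ind q a := fun a => by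
    rw [hq0 a t' htq', add_assoc, hp0 a (t' + k)]
    simp only [Pi.add_apply, mul_add, Finset.sum_add_distrib, htp']; ring
  simp only [i1, i2, neg_add_cancel_right] at e1 e2 e3
  have hE : pairCorr n p q k = ∑ a ∈ box (3 * n),
      ((weight n a - weight n (a + t)) + (weight n (a + -k) - weight n (a + t'))) *
        (ind p a * ind q a) := by
    calc _ = ∑ a ∈ box (3 * n), weight n a * (ind p a * ind q a) -
          ∑ a ∈ box (3 * n), weight n a * (ind p a * ind q (a + k)) -
          ∑ a ∈ box (3 * n), weight n a * (ind p (a + k) * ind q a) +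
          ∑ a ∈ box (3 * n), weight n a * (ind p (a + k) * ind q (a + k)) := by
          rw [← Finset.sum_sub_distrib, ← Finset.sum_sub_distrib, ← Finset.sum_add_distrib]
          exact Finset.sum_congr rfl fun a _ => by ring
      _ = _ := by
          rw [← e1, ← e2, ← e3, ← Finset.sum_sub_distrib, ← Finset.sum_sub_distrib,
            ← Finset.sum_add_distrib]
          exact Finset.sum_congr rfl fun a _ => by ring
  have hn' : (0 : ℝ) < n := by exact_mod_cast hn
  have hw : ∀ a, |(weight n a - weight n (a + t)) + (weight n (a + -k) - weight n (a + t'))| ≤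
      3 * T / n := fun a => by
    have h1 := abs_weight_sub_le n a (a + t)
    have h2 := abs_weight_sub_le n (a + -k) (a + t')
    have h3 : ‖a - (a + t)‖ ≤ T := by
      rw [show a - (a + t) = -t by abel, norm_neg]; exact norm_le_of_abs_le hT0 ht
    have h4 : ‖(a + -k) - (a + t')‖ ≤ T + T := by
      rw [show (a + -k) - (a + t') = -(k + t') by abel, norm_neg]
      exact (norm_add_le _ _).trans
        (add_le_add (norm_le_of_abs_le hT0 hk) (norm_le_of_abs_le hT0 ht'))
    calc _ ≤ _ := abs_add_le _ _
      _ ≤ T / n + (T + T) / n := by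
          refine add_le_add (h1.trans ?_) (h2.trans ?_) <;> gcongr
      _ = _ := by ring
  have hb := sum_ind_mul_ind_le hM (show minorMax p q ≤ 3 * n by omega) 0 0
  simp only [add_zero] at hb
  rw [hE]
  refine (Finset.abs_sum_le_sum_abs _ _).trans ?_
  calc _ ≤ ∑ a ∈ box (3 * n), 3 * T / n * (ind p a * ind q a) := by
        refine Finset.sum_le_sum fun a _ => ?_
        have := mul_nonneg (ind_nonneg p a) (ind_nonneg q a)
        rw [abs_mul, abs_of_nonneg this]
        gcongr
        exact hw a
    _ ≤ 3 * T / n * (72 * (3 * n : ℕ) ^ 2 * (minorGcd p q / minorMax p q)) := by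
        rw [← Finset.mul_sum]
        gcongr
    _ = _ := by
        push_cast; field_simp; ring

lemma minorMax_ne_zero_of_ne {z B : ℕ} {p q : Fin 4 → ℕ} (hp : p ∈ primeQuads z B)
    (hq : q ∈ primeQuads z B) (hne : p ≠ q) : minorMax (quadCast p) (quadCast q) ≠ 0 := by
  intro h0
  have hm : ∀ i j, p i * q j = p j * q i := fun i j => by
    have h1 := natAbs_minor_le (quadCast p) (quadCast q) i j
    rw [h0, Nat.le_zero, Int.natAbs_eq_zero] at h1
    simp only [minor, quadCast] at h1
    zify; linarith
  obtain ⟨hp1, i, j, hij⟩ := mem_primeQuads.1 hp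
  obtain ⟨hq1, -⟩ := mem_primeQuads.1 hq
  have hdvd : p i ∣ p j * q i := by rw [← hm i j]; exact dvd_mul_right _ _
  have heq : p i = q i := by
    rcases (hp1 i).2.2.dvd_mul.1 hdvd with h | h
    · exact absurd ((Nat.prime_dvd_prime_iff_eq (hp1 i).2.2 (hp1 j).2.2).1 h) hij
    · exact (Nat.prime_dvd_prime_iff_eq (hp1 i).2.2 (hq1 i).2.2).1 h
  apply hne
  funext s
  have h2 := hm i s
  rw [heq, mul_comm] at h2
  exact (Nat.eq_of_mul_eq_mul_right (hq1 i).2.2.pos h2).symm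

lemma minorMax_le_sq {z B : ℕ} {p q : Fin 4 → ℕ} (hp : p ∈ primeQuads z B)
    (hq : q ∈ primeQuads z B) : minorMax (quadCast p) (quadCast q) ≤ B ^ 2 := by
  obtain ⟨s, t, hst⟩ := exists_natAbs_minor_eq (quadCast p) (quadCast q)
  rw [← hst]
  have hp' := fun i => ((mem_primeQuads.1 hp).1 i).2.1
  have hq' := fun i => ((mem_primeQuads.1 hq).1 i).2.1
  zify
  simp only [minor, quadCast]
  have e1 : (p s : ℤ) * q t ≤ B ^ 2 := by
    rw [sq]; have := hp' s; have := hq' t; gcongr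
  have e2 : (p t : ℤ) * q s ≤ B ^ 2 := by
    rw [sq]; have := hp' t; have := hq' s; gcongr
  have e3 : (0 : ℤ) ≤ (p s : ℤ) * q t := by positivity
  have e4 : (0 : ℤ) ≤ (p t : ℤ) * q s := by positivity
  rw [abs_le]; constructor <;> linarith

lemma abs_dot_le {p k : Fin 4 → ℤ} {B K : ℕ} (hp : ∀ i, |p i| ≤ B) (hk : ∀ i, |k i| ≤ K) :
    |∑ i, p i * k i| ≤ ((4 * K * B : ℕ) : ℤ) := by
  refine (Finset.abs_sum_le_sum_abs _ _).trans ?_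
  calc ∑ i, |p i * k i| ≤ ∑ _i : Fin 4, (B : ℤ) * K := by
        refine Finset.sum_le_sum fun i _ => ?_
        rw [abs_mul]
        exact mul_le_mul (hp i) (hk i) (abs_nonneg _) (by positivity)
    _ = _ := by simp; ring

lemma abs_pairCorr_le_of_good {z B n W : ℕ} (hn : 0 < n) {p q : Fin 4 → ℕ}
    (hp : p ∈ primeQuads z B) (hq : q ∈ primeQuads z B) (hne : p ≠ q)
    (hG : minorGcd (quadCast p) (quadCast q) ∣ W) {θ : ℝ} (hθ : 0 < θ) (hθ1 : θ ≤ 1)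
    (hM : θ * B ^ 2 ≤ minorMax (quadCast p) (quadCast q))
    (hB : (B : ℝ) ^ 2 ≤ θ ^ 2 / 10 * n) {k : Fin 4 → ℤ} (hkW : ∀ i, (W : ℤ) ∣ k i)
    (hk : ∀ i, ((|k i| : ℤ) : ℝ) ≤ θ ^ 2 / 10 * n) :
    |pairCorr n (quadCast p) (quadCast q) k| ≤ 1944 * n ^ 2 * θ *
      (minorGcd (quadCast p) (quadCast q) / minorMax (quadCast p) (quadCast q)) := by
  have hM0 := minorMax_ne_zero_of_ne hp hq hne
  have hMB := minorMax_le_sq hp hq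
  set M := minorMax (quadCast p) (quadCast q) with hMdef
  have hn' : (0 : ℝ) < n := by exact_mod_cast hn
  have hθ2 : θ ^ 2 ≤ θ := by nlinarith
  have hMB' : (M : ℝ) ≤ B ^ 2 := by exact_mod_cast hMB
  have hMn : M ≤ n := by
    have : (M : ℝ) ≤ n := by nlinarith
    exact_mod_cast this
  set K := ⌊θ ^ 2 / 10 * n⌋₊ with hK
  have hkK : ∀ i, |k i| ≤ (K : ℤ) := fun i => by
    have h1 : (((k i).natAbs : ℕ) : ℝ) ≤ θ ^ 2 / 10 * n := by
      rw [Nat.cast_natAbs]; exact hk i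
    rw [Int.abs_eq_natAbs]
    exact_mod_cast Nat.le_floor h1
  have hKle : (K : ℝ) ≤ θ ^ 2 / 10 * n := Nat.floor_le (by positivity)
  have hpB : ∀ i, |quadCast p i| ≤ (B : ℤ) := fun i => by
    rw [quadCast, Nat.abs_cast]; exact_mod_cast ((mem_primeQuads.1 hp).1 i).2.1
  have hqB : ∀ i, |quadCast q i| ≤ (B : ℤ) := fun i => by
    rw [quadCast, Nat.abs_cast]; exact_mod_cast ((mem_primeQuads.1 hq).1 i).2.1
  have hGW : (minorGcd (quadCast p) (quadCast q) : ℤ) ∣ W := by exact_mod_cast hG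
  have hdiv : ∀ r : Fin 4 → ℤ, (minorGcd (quadCast p) (quadCast q) : ℤ) ∣ -∑ i, r i * k i :=
    fun r => (dvd_neg).2 (Finset.dvd_sum fun i _ => (hGW.trans (hkW i)).mul_left _)
  have hconv : ∀ t : Fin 4 → ℤ,
      (∀ i, |t i| * (M : ℤ) ≤ 2 * ((4 * K * B : ℕ) : ℤ) * B + 2 * (M : ℤ) ^ 2) →
      ∀ i, ((|t i| : ℤ) : ℝ) ≤ θ * n := fun t ht i => by
    have hM' : (0 : ℝ) < M := by exact_mod_cast Nat.pos_of_ne_zero hM0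
    have h1 : ((|t i| : ℤ) : ℝ) * M ≤ 8 * K * B ^ 2 + 2 * (M : ℝ) ^ 2 := by
      have h2 : ((|t i| * (M : ℤ) : ℤ) : ℝ) ≤
          ((2 * ((4 * K * B : ℕ) : ℤ) * B + 2 * (M : ℤ) ^ 2 : ℤ) : ℝ) := by exact_mod_cast ht i
      push_cast at h2 ⊢
      linarith
    have h3 : 8 * K * (B : ℝ) ^ 2 ≤ 8 / 10 * (θ * n) * M := by
      calc 8 * K * (B : ℝ) ^ 2 ≤ 8 * (θ ^ 2 / 10 * n) * B ^ 2 := by gcongr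
        _ = 8 / 10 * (θ * n) * (θ * B ^ 2) := by ring
        _ ≤ _ := by gcongr
    have h4 : 2 * (M : ℝ) ^ 2 ≤ 2 / 10 * (θ * n) * M := by
      have : (M : ℝ) ≤ θ * n / 10 := by
        refine hMB'.trans (hB.trans ?_)
        nlinarith
      nlinarith
    exact le_of_mul_le_mul_right (by linarith) hM'
  have h0 : |(0 : ℤ)| ≤ ((4 * K * B : ℕ) : ℤ) := by rw [abs_zero]; positivity
  obtain ⟨t, ht1, ht2, ht3⟩ := exists_short_preimage hM0 hpB hqB (dvd_zero _) (hdiv (quadCast q)) h0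
    (by rw [abs_neg]; exact abs_dot_le hqB hkK)
  obtain ⟨t', ht1', ht2', ht3'⟩ := exists_short_preimage hM0 hpB hqB (hdiv (quadCast p))
    (dvd_zero _) (by rw [abs_neg]; exact abs_dot_le hpB hkK) h0
  refine (abs_pairCorr_le_of_shift hn hM0 hMn ht1 ht2 ht1' ht2' (T := θ * n) (by nlinarith)
    (fun i => (hk i).trans ?_) (hconv t ht3) (hconv t' ht3')).trans_eq (by ring)
  nlinarith

lemma abs_pairCorr_self_le {z B n : ℕ} (hz : 0 < z) (hB : B ≤ n) {p : Fin 4 → ℕ}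
    (hp : p ∈ primeQuads z B) (k : Fin 4 → ℤ) :
    |pairCorr n (quadCast p) (quadCast p) k| ≤ 3888 * n ^ 3 / z := by
  obtain ⟨hp1, i, j, hij⟩ := mem_primeQuads.1 hp
  have hco : IsCoprime (quadCast p i) (quadCast p j) :=
    Nat.isCoprime_iff_coprime.2 ((Nat.coprime_primes (hp1 i).2.2 (hp1 j).2.2).2 hij)
  have hz' : (0 : ℝ) < z := by exact_mod_cast hz
  have hb : ∀ s : Fin 4 → ℤ, ∑ a ∈ box (3 * n), ind (quadCast p) (a + s) ≤ 972 * n ^ 3 / z := by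
    intro s
    set S := (box (3 * n)).filter fun a => ∑ i, quadCast p i * a i = -∑ i, quadCast p i * s i
      with hS
    have hpj := hp1 j
    have h1 := card_hyperplane_le (fun h => hij (by rw [h])) hco (R := 3 * n)
      (by simpa [quadCast] using (hp1 i).2.2.ne_zero) (j := j) (b := p j) rfl hpj.2.2.pos
      (by omega) _ S (fun a ha => by
        rw [hS, Finset.mem_filter, mem_box] at ha
        exact ⟨ha.2, ha.1⟩)
    have h2 : ∑ a ∈ box (3 * n), ind (quadCast p) (a + s) = S.card := by
      rw [Finset.card_filter, Nat.cast_sum]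
      refine Finset.sum_congr rfl fun a _ => ?_
      simp only [ind, Pi.add_apply, mul_add, Finset.sum_add_distrib, add_eq_zero_iff_eq_neg]
      split_ifs <;> simp_all
    rw [h2, le_div_iff₀ hz']
    calc (S.card : ℝ) * z ≤ S.card * p j := by
          have : z ≤ p j := hpj.1
          gcongr
      _ = ((p j * S.card : ℕ) : ℝ) := by push_cast; ring
      _ ≤ ((36 * (3 * n) ^ 3 : ℕ) : ℝ) := by exact_mod_cast h1
      _ = _ := by push_cast; ring
  have h0 := hb 0
  have h1 := hb k
  simp only [add_zero] at h0
  refine (Finset.abs_sum_le_sum_abs _ _).trans ?_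
  calc _ ≤ ∑ a ∈ box (3 * n), 2 * (ind (quadCast p) a + ind (quadCast p) (a + k)) := by
        refine Finset.sum_le_sum fun a _ => ?_
        rw [abs_mul, abs_of_nonneg (weight_nonneg _ _)]
        refine mul_le_mul (weight_le n a) ?_ (abs_nonneg _) (by norm_num)
        unfold ind
        split_ifs <;> norm_num
    _ ≤ _ := by
        rw [← Finset.mul_sum, Finset.sum_add_distrib]
        have : (3888 : ℝ) * n ^ 3 / z = 2 * (972 * n ^ 3 / z + 972 * n ^ 3 / z) := by ring
        rw [this]; gcongr

/-- Number of quadruples in `P` orthogonal to `a`. -/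
noncomputable def countSol (P : Finset (Fin 4 → ℕ)) (a : Fin 4 → ℤ) : ℝ :=
  ∑ p ∈ P, ind (quadCast p) a

lemma sum_weight_mul_sub_sq (n : ℕ) (P : Finset (Fin 4 → ℕ)) (k : Fin 4 → ℤ) :
    ∑ a ∈ box (3 * n), weight n a * (countSol P a - countSol P (a + k)) ^ 2 =
      ∑ x ∈ P ×ˢ P, pairCorr n (quadCast x.1) (quadCast x.2) k := by
  simp only [pairCorr]
  rw [Finset.sum_comm]
  refine Finset.sum_congr rfl fun a _ => ?_
  rw [← Finset.mul_sum, countSol, countSol, ← Finset.sum_sub_distrib, sq, Finset.sum_mul_sum,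
    Finset.sum_product]

lemma exists_variance_le {κ : ℝ} (hκ : 0 < κ) (hκ1 : κ ≤ 1) : ∃ C : ℝ, 0 < C ∧
    ∀ ε : ℝ, 0 < ε → ∃ W : ℕ, 0 < W ∧ ∃ δ : ℝ, 0 < δ ∧ δ ≤ 1 ∧ ∀ᶠ B : ℕ in atTop,
      ∀ z n : ℕ, κ * B ≤ z → (B : ℝ) ^ 2 ≤ δ * n → ∀ k : Fin 4 → ℤ, (∀ i, (W : ℤ) ∣ k i) →
      (∀ i, ((|k i| : ℤ) : ℝ) ≤ δ * n) →
      ∑ a ∈ box (3 * n), weight n a *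
        (countSol (primeQuads z B) a - countSol (primeQuads z B) (a + k)) ^ 2 ≤
      ε * n ^ 2 * B ^ 6 / Real.log B ^ 8 + C * n ^ 3 * B ^ 3 / Real.log B ^ 4 := by
  obtain ⟨C₁, hC₁, h₁⟩ := exists_sum_gcd_div_max_le hκ hκ1
  obtain ⟨C₂, hC₂, h₂⟩ := exists_card_primes_le
  refine ⟨3888 * C₂ ^ 4 / κ, by positivity, fun ε hε => ?_⟩
  have hτ0 : 0 ≤ threeHalvesTail 0 := tsum_nonneg fun k => by positivity
  obtain ⟨N, hN⟩ := (tendsto_threeHalvesTail.eventually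
    (gt_mem_nhds (show 0 < ε / (2 * 5184 * C₁) by positivity))).exists
  obtain ⟨θ, hθ, hθ1, hθε⟩ : ∃ θ : ℝ, 0 < θ ∧ θ ≤ 1 ∧
      7128 * θ * C₁ * threeHalvesTail 0 ≤ ε / 2 := by
    refine ⟨min 1 (ε / (2 * (7128 * C₁ * threeHalvesTail 0 + 1))), by positivity,
      min_le_left _ _, ?_⟩
    calc _ = min 1 (ε / (2 * (7128 * C₁ * threeHalvesTail 0 + 1))) *
          (7128 * C₁ * threeHalvesTail 0) := by ring
      _ ≤ (ε / (2 * (7128 * C₁ * threeHalvesTail 0 + 1))) *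
          (7128 * C₁ * threeHalvesTail 0 + 1) := by
        gcongr
        · exact min_le_right _ _
        · linarith
      _ = ε / 2 := by field_simp
  refine ⟨N.factorial, N.factorial_pos, θ ^ 2 / 10, by positivity, by nlinarith, ?_⟩
  filter_upwards [h₁, h₂, eventually_ge_atTop 3] with B hB₁ hB₂ hB3 z n hz hBn k hkW hk
  have hB0 : (0 : ℝ) < B := by positivity
  have hz0 : (0 : ℝ) < z := lt_of_lt_of_le (by positivity) hz
  have hl : 0 < Real.log B := Real.log_pos (by exact_mod_cast (show 1 < B by omega))
  have hBn' : B ^ 2 ≤ n := by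
    have : (B : ℝ) ^ 2 ≤ n := hBn.trans
      (mul_le_of_le_one_left (Nat.cast_nonneg n) (by nlinarith))
    exact_mod_cast this
  have hBn1 : B ≤ n := le_trans (Nat.le_self_pow (by norm_num) B) hBn'
  have hn : 0 < n := by omega
  set P := primeQuads z B with hP
  set G : (Fin 4 → ℕ) × (Fin 4 → ℕ) → ℕ := fun x => minorGcd (quadCast x.1) (quadCast x.2) with hG
  set M : (Fin 4 → ℕ) × (Fin 4 → ℕ) → ℕ := fun x => minorMax (quadCast x.1) (quadCast x.2) with hM
  have hdiag : ∑ x ∈ P ×ˢ P, (if x.1 = x.2 then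
      |pairCorr n (quadCast x.1) (quadCast x.2) k| else 0) ≤
      3888 * C₂ ^ 4 / κ * n ^ 3 * B ^ 3 / Real.log B ^ 4 := by
    rw [Finset.sum_product]
    have e1 : ∀ p ∈ P, ∑ q ∈ P, (if p = q then
        |pairCorr n (quadCast p) (quadCast q) k| else 0) ≤ 3888 * n ^ 3 / (κ * B) := fun p hp => by
      rw [Finset.sum_ite_eq, if_pos hp]
      refine (abs_pairCorr_self_le (by exact_mod_cast hz0) hBn1 hp k).trans ?_
      gcongr
    refine (Finset.sum_le_sum e1).trans ?_
    rw [Finset.sum_const, nsmul_eq_mul]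
    have e2 : (P.card : ℝ) ≤ (C₂ * B / Real.log B) ^ 4 := by
      calc (P.card : ℝ) ≤ ((((Finset.Icc z B).filter Nat.Prime).card ^ 4 : ℕ) : ℝ) := by
            exact_mod_cast card_primeQuads_le z B
        _ ≤ _ := by push_cast; gcongr; exact hB₂ z
    calc _ ≤ (C₂ * B / Real.log B) ^ 4 * (3888 * n ^ 3 / (κ * B)) := by gcongr
      _ = _ := by field_simp
  have hsum : ∀ (N : ℕ) (Y : ℝ) (S : Finset _), 0 ≤ Y → S ⊆ P ×ˢ P → (∀ x ∈ S, x.1 ≠ x.2) →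
      (∀ x ∈ S, (M x : ℝ) ≤ Y ∧ N < G x) →
      ∑ x ∈ S, (G x : ℝ) / M x ≤ C₁ * B ^ 4 * Y * threeHalvesTail N / Real.log B ^ 8 := by
    intro N Y S hY hS hne hS'
    rw [le_div_iff₀ (by positivity)]
    refine hB₁ z hz N Y hY S fun x hx => ?_
    obtain ⟨h1, h2⟩ := Finset.mem_product.1 (hS hx)
    exact ⟨h1, h2, minorMax_ne_zero_of_ne h1 h2 (hne x hx), (hS' x hx).1, (hS' x hx).2⟩
  set D := (P ×ˢ P).filter fun x => x.1 ≠ x.2 with hD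
  have hDs : D ⊆ P ×ˢ P := Finset.filter_subset _ _
  have hDne : ∀ x ∈ D, x.1 ≠ x.2 := fun x hx => (Finset.mem_filter.1 hx).2
  have hDM : ∀ x ∈ D, (M x : ℝ) ≤ (B : ℝ) ^ 2 := fun x hx => by
    obtain ⟨h1, h2⟩ := Finset.mem_product.1 (hDs hx)
    exact_mod_cast minorMax_le_sq h1 h2
  have hDG : ∀ x ∈ D, 0 < G x := fun x hx => by
    obtain ⟨h1, h2⟩ := Finset.mem_product.1 (hDs hx)
    exact minorGcd_pos (minorMax_ne_zero_of_ne h1 h2 (hDne x hx))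
  have s1 := hsum 0 (B ^ 2) D (by positivity) hDs hDne fun x hx => ⟨hDM x hx, hDG x hx⟩
  have s2 := hsum N (B ^ 2) (D.filter fun x => N < G x) (by positivity)
    ((Finset.filter_subset _ _).trans hDs) (fun x hx => hDne x (Finset.mem_filter.1 hx).1)
    fun x hx => ⟨hDM x (Finset.mem_filter.1 hx).1, (Finset.mem_filter.1 hx).2⟩
  have s3 := hsum 0 (θ * B ^ 2) (D.filter fun x => (M x : ℝ) ≤ θ * B ^ 2) (by positivity)
    ((Finset.filter_subset _ _).trans hDs) (fun x hx => hDne x (Finset.mem_filter.1 hx).1)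
    fun x hx => ⟨(Finset.mem_filter.1 hx).2, hDG x (Finset.mem_filter.1 hx).1⟩
  have hoff : ∀ x ∈ D, |pairCorr n (quadCast x.1) (quadCast x.2) k| ≤
      1944 * n ^ 2 * θ * ((G x : ℝ) / M x) +
      5184 * n ^ 2 * (if N < G x then (G x : ℝ) / M x else 0) +
      5184 * n ^ 2 * (if (M x : ℝ) ≤ θ * B ^ 2 then (G x : ℝ) / M x else 0) := by
    intro x hx
    obtain ⟨h1, h2⟩ := Finset.mem_product.1 (hDs hx)
    have hM0 := minorMax_ne_zero_of_ne h1 h2 (hDne x hx)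
    have htriv := abs_pairCorr_le hM0 ((minorMax_le_sq h1 h2).trans hBn') k
    have p1 : 0 ≤ 1944 * n ^ 2 * θ * ((G x : ℝ) / M x) := by positivity
    have p2 : 0 ≤ 5184 * (n : ℝ) ^ 2 * (if N < G x then (G x : ℝ) / M x else 0) := by
      split_ifs <;> positivity
    have p3 : 0 ≤ 5184 * (n : ℝ) ^ 2 * (if (M x : ℝ) ≤ θ * B ^ 2 then (G x : ℝ) / M x else 0) := by
      split_ifs <;> positivity
    by_cases c1 : N < G x
    · rw [if_pos c1]
      linarith
    by_cases c2 : (M x : ℝ) ≤ θ * B ^ 2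
    · rw [if_pos c2]
      linarith
    · have := abs_pairCorr_le_of_good hn h1 h2 (hDne x hx)
        (Nat.dvd_factorial (hDG x hx) (not_lt.1 c1)) hθ hθ1 (not_le.1 c2).le hBn hkW hk
      linarith
  rw [sum_weight_mul_sub_sq]
  calc ∑ x ∈ P ×ˢ P, pairCorr n (quadCast x.1) (quadCast x.2) k
      ≤ ∑ x ∈ P ×ˢ P, ((if x.1 = x.2 then |pairCorr n (quadCast x.1) (quadCast x.2) k| else 0) +
        (if x.1 ≠ x.2 then |pairCorr n (quadCast x.1) (quadCast x.2) k| else 0)) := by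
        refine Finset.sum_le_sum fun x _ => (le_abs_self _).trans ?_
        by_cases h : x.1 = x.2 <;> simp [h]
    _ = _ + ∑ x ∈ D, |pairCorr n (quadCast x.1) (quadCast x.2) k| := by
        rw [Finset.sum_add_distrib, hD, Finset.sum_filter]
    _ ≤ 3888 * C₂ ^ 4 / κ * n ^ 3 * B ^ 3 / Real.log B ^ 4 +
        (1944 * n ^ 2 * θ * (C₁ * B ^ 4 * B ^ 2 * threeHalvesTail 0 / Real.log B ^ 8) +
        5184 * n ^ 2 * (C₁ * B ^ 4 * B ^ 2 * threeHalvesTail N / Real.log B ^ 8) +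
        5184 * n ^ 2 * (C₁ * B ^ 4 * (θ * B ^ 2) * threeHalvesTail 0 / Real.log B ^ 8)) := by
        refine add_le_add hdiag ((Finset.sum_le_sum hoff).trans ?_)
        rw [Finset.sum_add_distrib, Finset.sum_add_distrib, ← Finset.mul_sum, ← Finset.mul_sum,
          ← Finset.mul_sum, ← Finset.sum_filter, ← Finset.sum_filter]
        gcongr
    _ = (7128 * θ * C₁ * threeHalvesTail 0 + 5184 * C₁ * threeHalvesTail N) *
          (n ^ 2 * B ^ 6 / Real.log B ^ 8) +
          3888 * C₂ ^ 4 / κ * n ^ 3 * B ^ 3 / Real.log B ^ 4 := by ring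
    _ ≤ ε * (n ^ 2 * B ^ 6 / Real.log B ^ 8) +
          3888 * C₂ ^ 4 / κ * n ^ 3 * B ^ 3 / Real.log B ^ 4 := by
        gcongr
        have : 5184 * C₁ * threeHalvesTail N ≤ 5184 * C₁ * (ε / (2 * 5184 * C₁)) := by gcongr
        have e : 5184 * C₁ * (ε / (2 * 5184 * C₁)) = ε / 2 := by field_simp
        linarith
    _ = _ := by ring

/-- Solutions of `∑ aᵢ bᵢ = 0` in units of a ring. -/
def unitSols {R : Type*} [CommRing R] (a : Fin 4 → R) : Set (Fin 4 → Rˣ) :=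
  {b | ∑ i, a i * (b i : R) = 0}

lemma card_unitSols_ge {R : Type*} [CommRing R] [Finite R] {a : Fin 4 → R} {i j k l : Fin 4}
    (hsum : ∀ f : Fin 4 → R, ∑ s, f s = f i + f j + f k + f l) (hij : i ≠ j) (hik : i ≠ k)
    (hil : i ≠ l) (hjk : j ≠ k) (hjl : j ≠ l) (hkl : k ≠ l) (hi : IsUnit (a i)) {N : ℕ}
    (hN : ∀ v w : Rˣ, N ≤ Nat.card {u : Rˣ // IsUnit (a j * u + a k * v + a l * w)}) :
    Nat.card Rˣ ^ 2 * N ≤ Nat.card (unitSols a) := by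
  have := Fintype.ofFinite Rˣ
  obtain ⟨α, hα⟩ := hi
  calc Nat.card Rˣ ^ 2 * N = ∑ _x : Rˣ × Rˣ, N := by
        simp [Nat.card_eq_fintype_card, sq]
    _ ≤ ∑ x : Rˣ × Rˣ, Nat.card {u : Rˣ // IsUnit (a j * u + a k * x.1 + a l * x.2)} :=
        Finset.sum_le_sum fun x _ => hN x.1 x.2
    _ = Nat.card (Σ x : Rˣ × Rˣ, {u : Rˣ // IsUnit (a j * u + a k * x.1 + a l * x.2)}) :=
        Nat.card_sigma.symm
    _ ≤ Nat.card (unitSols a) := by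
        refine Nat.card_le_card_of_injective (fun y => ⟨fun s =>
          if s = i then -(α⁻¹ * y.2.2.unit) else if s = j then y.2.1 else
            if s = k then y.1.1 else y.1.2, ?_⟩) ?_
        · simp only [unitSols, Set.mem_ofPred_eq]
          rw [hsum]
          simp only [if_true, if_neg hij.symm, if_neg hik.symm, if_neg hil.symm, if_neg hjk.symm,
            if_neg hjl.symm, if_neg hkl.symm, ← hα]
          simp
          ring
        · rintro ⟨⟨v, w⟩, u, hu⟩ ⟨⟨v', w'⟩, u', hu'⟩ h
          have h' := Subtype.ext_iff.1 h
          have hj := congrFun h' j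
          have hk := congrFun h' k
          have hl := congrFun h' l
          simp only [if_neg hij.symm, if_neg hik.symm, if_neg hil.symm, if_neg hjk.symm,
            if_neg hjl.symm, if_neg hkl.symm, if_true] at hj hk hl
          subst hj hk hl
          rfl

lemma card_isUnit_add_ge {R : Type*} [CommRing R] [Finite R] {a : R} (ha : IsUnit a) (c d : R) :
    2 * Nat.card Rˣ - Nat.card R ≤ Nat.card {u : Rˣ // IsUnit (a * u + c + d)} := by
  classical
  have := Fintype.ofFinite R
  have h1 : Nat.card {u : Rˣ // IsUnit (a * u + c + d)} +
      Nat.card {u : Rˣ // ¬ IsUnit (a * u + c + d)} = Nat.card Rˣ := by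
    rw [← Nat.card_sum]
    exact Nat.card_congr (Equiv.sumCompl _)
  have h2 : Nat.card {x : R // IsUnit x} + Nat.card {x : R // ¬ IsUnit x} = Nat.card R := by
    rw [← Nat.card_sum]
    exact Nat.card_congr (Equiv.sumCompl _)
  have h3 : Nat.card Rˣ ≤ Nat.card {x : R // IsUnit x} :=
    Nat.card_le_card_of_injective (fun u => ⟨u, u.isUnit⟩) fun u v h =>
      Units.ext (Subtype.ext_iff.1 h)
  have h4 : Nat.card {u : Rˣ // ¬ IsUnit (a * u + c + d)} ≤ Nat.card {x : R // ¬ IsUnit x} := by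
    refine Nat.card_le_card_of_injective (fun u => ⟨a * u.1 + c + d, u.2⟩) fun u v h => ?_
    have h' := Subtype.ext_iff.1 h
    simp only [add_left_inj] at h'
    exact Subtype.ext (Units.ext (ha.mul_left_cancel h'))
  omega

lemma card_unitSols_mul (a : Fin 4 → ℤ) {m n : ℕ} [NeZero (m * n)] (h : m.Coprime n) :
    Nat.card (unitSols fun i => (a i : ZMod m)) * Nat.card (unitSols fun i => (a i : ZMod n)) ≤
      Nat.card (unitSols fun i => (a i : ZMod (m * n))) := by
  let e := ZMod.chineseRemainder h
  let f : (ZMod m)ˣ × (ZMod n)ˣ → (ZMod (m * n))ˣ := fun x =>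
    Units.map (e.symm : ZMod m × ZMod n →* ZMod (m * n)) (MulEquiv.prodUnits.symm x)
  have hf : ∀ x, e (f x : ZMod (m * n)) = (↑x.1, ↑x.2) := fun x => by
    simp [f, e]
    rfl
  rw [← Nat.card_prod]
  refine Nat.card_le_card_of_injective (fun x => ⟨fun i => f (x.1.1 i, x.2.1 i), ?_⟩) ?_
  · obtain ⟨⟨b, hb⟩, ⟨c, hc⟩⟩ := x
    simp only [unitSols, Set.mem_ofPred_eq] at hb hc ⊢
    apply e.injective
    rw [map_sum, map_zero]
    simp only [map_mul, hf, map_intCast]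
    ext
    · simpa [Prod.fst_sum] using hb
    · simpa [Prod.snd_sum] using hc
  · rintro ⟨⟨b, hb⟩, ⟨c, hc⟩⟩ ⟨⟨b', hb'⟩, ⟨c', hc'⟩⟩ hx
    have h1 : ∀ i, f (b i, c i) = f (b' i, c' i) := fun i => congrFun (Subtype.ext_iff.1 hx) i
    have h2 : ∀ i, (b i : ZMod m) = b' i ∧ (c i : ZMod n) = c' i := fun i => by
      have := congrArg (fun u : (ZMod (m * n))ˣ => e u) (h1 i)
      simpa only [hf, Prod.mk.injEq] using this
    have e1 : b = b' := funext fun i => Units.ext (h2 i).1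
    have e2 : c = c' := funext fun i => Units.ext (h2 i).2
    subst e1 e2
    rfl

lemma isUnit_intCast_prime_pow_iff {p k : ℕ} (hp : p.Prime) (hk : k ≠ 0) {x : ℤ} :
    IsUnit (x : ZMod (p ^ k)) ↔ (x : ZMod p) ≠ 0 := by
  rw [ZMod.coe_int_isUnit_iff_isCoprime, Nat.cast_pow,
    IsCoprime.pow_left_iff (Nat.pos_of_ne_zero hk),
    Ne, ZMod.intCast_zmod_eq_zero_iff_dvd, (Nat.prime_iff_prime_int.1 hp).coprime_iff_not_dvd]

lemma sum_eq_of_complement {R : Type*} [AddCommMonoid R] {i j k l : Fin 4}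
    (h : ∀ s, s = i ∨ s = j ∨ s = k ∨ s = l) (hij : i ≠ j) (hik : i ≠ k) (hil : i ≠ l)
    (hjk : j ≠ k) (hjl : j ≠ l) (hkl : k ≠ l) (f : Fin 4 → R) :
    ∑ s, f s = f i + f j + f k + f l := by
  have : (Finset.univ : Finset (Fin 4)) = {i, j, k, l} := by
    ext s; simpa using h s
  rw [this, Finset.sum_insert (by simp [hij, hik, hil]), Finset.sum_insert (by simp [hjk, hjl]),
    Finset.sum_pair hkl, add_assoc, add_assoc]

lemma exists_two_ne_zero {a : Fin 4 → ℤ} (ha : IsLocSolv a) {p : ℕ} (hp : p.Prime) :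
    ∃ i j, i ≠ j ∧ (a i : ZMod p) ≠ 0 ∧ (a j : ZMod p) ≠ 0 := by
  have := Fact.mk hp
  obtain ⟨⟨-, hgcd⟩, -, hloc⟩ := ha
  obtain ⟨i, hi⟩ : ∃ i, (a i : ZMod p) ≠ 0 := by
    by_contra! hc
    have h1 : (p : ℤ) ∣ Finset.univ.gcd a :=
      Finset.dvd_gcd fun i _ => (ZMod.intCast_zmod_eq_zero_iff_dvd _ _).1 (hc i)
    rw [hgcd] at h1
    exact hp.one_lt.ne' (by exact_mod_cast Int.eq_one_of_dvd_one (by positivity) h1)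
  by_contra! hc
  obtain ⟨x, hx⟩ := hloc p hp
  rw [Finset.sum_eq_single i (fun j _ hj => by
    by_cases h : (a j : ZMod p) = 0
    · rw [h, zero_mul]
    · exact absurd (hc i j hj.symm hi) h) (by simp)] at hx
  exact (mul_ne_zero hi (x i).ne_zero) hx

lemma card_unitSols_prime_pow {a : Fin 4 → ℤ} (ha : IsLocSolv a) {p k : ℕ} (hp : p.Prime)
    (hk : k ≠ 0) : (p ^ k).totient ^ 2 * (2 * (p ^ k).totient - p ^ k) ≤
      Nat.card (unitSols fun i => (a i : ZMod (p ^ k))) := by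
  have : NeZero (p ^ k) := ⟨(pow_pos hp.pos k).ne'⟩
  obtain ⟨i, j, hij, hi, hj⟩ := exists_two_ne_zero ha hp
  obtain ⟨r, l, hc, -, hir, hil, hjr, hjl, hrl⟩ := exists_complement i j hij
  have hcard : Nat.card (ZMod (p ^ k))ˣ = (p ^ k).totient := by
    rw [Nat.card_eq_fintype_card, ZMod.card_units_eq_totient]
  rw [← hcard]
  refine card_unitSols_ge (sum_eq_of_complement hc hij hir hil hjr hjl hrl) hij hir hil hjr hjl hrl
    ((isUnit_intCast_prime_pow_iff hp hk).2 hi) fun v w => ?_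
  have := card_isUnit_add_ge ((isUnit_intCast_prime_pow_iff hp hk).2 hj)
    ((a r : ZMod (p ^ k)) * v) ((a l : ZMod (p ^ k)) * w)
  rwa [Nat.card_zmod] at this

lemma card_unitSols_two_pow {a : Fin 4 → ℤ} (ha : IsLocSolv a) {k : ℕ} (hk : k ≠ 0) :
    (2 ^ k).totient ^ 3 ≤ Nat.card (unitSols fun i => (a i : ZMod (2 ^ k))) := by
  have : NeZero (2 ^ k) := ⟨(pow_pos two_pos k).ne'⟩
  obtain ⟨i, j, hij, hi, hj⟩ := exists_two_ne_zero ha Nat.prime_two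
  obtain ⟨r, l, hc, -, hir, hil, hjr, hjl, hrl⟩ := exists_complement i j hij
  have hcard : Nat.card (ZMod (2 ^ k))ˣ = (2 ^ k).totient := by
    rw [Nat.card_eq_fintype_card, ZMod.card_units_eq_totient]
  rw [← hcard, pow_succ]
  refine card_unitSols_ge (sum_eq_of_complement hc hij hir hil hjr hjl hrl) hij hir hil hjr hjl hrl
    ((isUnit_intCast_prime_pow_iff Nat.prime_two hk).2 hi) fun v w => ?_
  let φ := ZMod.castHom (dvd_pow_self 2 hk) (ZMod 2)
  have h1 : ∀ u : (ZMod 2)ˣ, (u : ZMod 2) = 1 := by decide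
  have hunit : ∀ x : ZMod (2 ^ k), φ x ≠ 0 → IsUnit x := fun x hx => by
    have h2 : ((x.val : ℤ) : ZMod (2 ^ k)) = x := by simp
    rw [← h2, isUnit_intCast_prime_pow_iff Nat.prime_two hk]
    rw [← h2, map_intCast] at hx
    exact hx
  have hφ : ∀ u : (ZMod (2 ^ k))ˣ, φ u = 1 := fun u => by
    simpa using h1 (Units.map (φ : ZMod (2 ^ k) →* ZMod 2) u)
  refine Nat.card_le_card_of_injective (fun u => ⟨u, hunit _ ?_⟩) fun u u' h =>
    Subtype.ext_iff.1 h
  rw [map_add, map_add, map_mul, map_mul, map_mul, hφ, hφ, hφ, map_intCast, map_intCast,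
    map_intCast, mul_one, mul_one, mul_one]
  obtain ⟨x, hx⟩ := ha.2.2 2 Nat.prime_two
  rw [sum_eq_of_complement hc hij hir hil hjr hjl hrl] at hx
  simp only [h1, mul_one] at hx
  intro h0
  apply hi
  linear_combination hx - h0

/-- Lower bound for the local density at `p`. -/
noncomputable def localFactor (p : ℕ) : ℝ := if p ≤ 2 then 1 else 1 - 1 / ((p : ℝ) - 1) ^ 2

lemma localFactor_mem (p : ℕ) : 0 ≤ localFactor p ∧ localFactor p ≤ 1 := by
  unfold localFactor
  split_ifs with h
  · norm_num
  · have h1 : (3 : ℝ) ≤ p := by exact_mod_cast (show 3 ≤ p by omega)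
    have h2 : 1 / ((p : ℝ) - 1) ^ 2 ≤ 1 := by
      rw [div_le_one (by nlinarith)]; nlinarith
    have h3 : 0 ≤ 1 / ((p : ℝ) - 1) ^ 2 := by positivity
    constructor <;> linarith

lemma half_le_prod_range_localFactor (N : ℕ) :
    1 / 2 ≤ ∏ p ∈ Finset.range N, localFactor p := by
  have h : ∀ M : ℕ, ∏ p ∈ Finset.range (M + 3), localFactor p = (M + 2) / (2 * (M + 1)) := by
    intro M
    induction M with
    | zero => simp [Finset.prod_range_succ, localFactor]
    | succ M ih =>
      rw [show M + 1 + 3 = (M + 3) + 1 by ring, Finset.prod_range_succ, ih, localFactor,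
        if_neg (by omega)]
      push_cast
      rw [show (M : ℝ) + 3 - 1 = M + 2 by ring]
      field_simp
      ring
  by_cases hN : N ≤ 2
  · interval_cases N <;> simp [Finset.prod_range_succ, localFactor] <;> norm_num
  · obtain ⟨M, rfl⟩ := Nat.exists_eq_add_of_le (show 3 ≤ N by omega)
    rw [add_comm, h, div_le_div_iff₀ (by norm_num) (by positivity)]
    linarith

lemma half_le_prod_localFactor (S : Finset ℕ) : 1 / 2 ≤ ∏ p ∈ S, localFactor p := by
  refine (half_le_prod_range_localFactor (S.sup id + 1)).trans ?_
  have hsub : S ⊆ Finset.range (S.sup id + 1) := fun p hp =>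
    Finset.mem_range.2 (Nat.lt_succ_of_le (Finset.le_sup (f := id) hp))
  rw [← Finset.prod_sdiff hsub]
  refine mul_le_of_le_one_left (Finset.prod_nonneg fun p _ => (localFactor_mem p).1) ?_
  exact Finset.prod_le_one (fun p _ => (localFactor_mem p).1) fun p _ => (localFactor_mem p).2

lemma prod_localFactor_mul_le {a : Fin 4 → ℤ} (ha : IsLocSolv a) (W : ℕ) (hW : W ≠ 0) :
    (∏ p ∈ W.primeFactors, localFactor p) * (W.totient : ℝ) ^ 4 ≤
      W * Nat.card (unitSols fun i => (a i : ZMod W)) := by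
  induction W using Nat.recOnPosPrimePosCoprime with
  | zero => exact absurd rfl hW
  | one =>
    have : Nonempty (unitSols fun i => (a i : ZMod 1)) := ⟨1, Subsingleton.elim _ _⟩
    have : 0 < Nat.card (unitSols fun i => (a i : ZMod 1)) := Nat.card_pos
    simp only [Nat.primeFactors_one, Finset.prod_empty, Nat.totient_one, Nat.cast_one, one_pow,
      one_mul]
    exact_mod_cast this
  | prime_pow p k hp hk =>
    have hk0 : k ≠ 0 := hk.ne'
    rw [Nat.primeFactors_prime_pow hk0 hp, Finset.prod_singleton]
    have htot : ((p ^ k).totient : ℝ) = p ^ (k - 1) * (p - 1) := by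
      rw [Nat.totient_prime_pow hp hk, Nat.cast_mul, Nat.cast_sub hp.one_le]
      push_cast; ring
    have hpk : (p : ℝ) ^ k = p ^ (k - 1) * p := by
      rw [← pow_succ, Nat.sub_add_cancel hk]
    have hp0 : (0 : ℝ) < p := by exact_mod_cast hp.pos
    set u : ℝ := p ^ (k - 1) with hu
    have hu0 : 0 < u := by positivity
    by_cases h2 : p ≤ 2
    · obtain rfl : p = 2 := le_antisymm h2 hp.two_le
      have h := card_unitSols_two_pow ha hk0
      have h' : ((2 ^ k).totient : ℝ) ^ 3 ≤ Nat.card (unitSols fun i => (a i : ZMod (2 ^ k))) := by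
        exact_mod_cast h
      rw [localFactor, if_pos h2, one_mul]
      calc ((2 ^ k).totient : ℝ) ^ 4 = (2 ^ k).totient * (2 ^ k).totient ^ 3 := by ring
        _ ≤ ((2 ^ k : ℕ) : ℝ) * Nat.card (unitSols fun i => (a i : ZMod (2 ^ k))) := by
            gcongr
            exact Nat.totient_le _
    · have h := card_unitSols_prime_pow ha hp hk0
      have h3 : (3 : ℝ) ≤ p := by exact_mod_cast (show 3 ≤ p by omega)
      have h' : ((p ^ k).totient : ℝ) ^ 2 * (2 * (p ^ k).totient - p ^ k) ≤
          Nat.card (unitSols fun i => (a i : ZMod (p ^ k))) := by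
        refine le_trans ?_ (Nat.cast_le.2 h)
        rw [Nat.cast_mul, Nat.cast_pow]
        gcongr
        have h4 : 2 * (p ^ k).totient ≤ 2 * (p ^ k).totient - p ^ k + p ^ k := le_tsub_add
        rw [sub_le_iff_le_add]
        exact_mod_cast h4
      rw [localFactor, if_neg h2]
      have e : (1 - 1 / ((p : ℝ) - 1) ^ 2) * ((p ^ k).totient : ℝ) ^ 4 =
          (p ^ k : ℕ) * (((p ^ k).totient : ℝ) ^ 2 * (2 * (p ^ k).totient - p ^ k)) := by
        have : (p : ℝ) - 1 ≠ 0 := by linarith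
        rw [htot, Nat.cast_pow, hpk]
        field_simp
        ring
      rw [e]
      gcongr
  | coprime m n hm hn hmn ihm ihn =>
    have : NeZero (m * n) := ⟨hW⟩
    have h := card_unitSols_mul a hmn
    have h' : (Nat.card (unitSols fun i => (a i : ZMod m)) : ℝ) *
        Nat.card (unitSols fun i => (a i : ZMod n)) ≤
        Nat.card (unitSols fun i => (a i : ZMod (m * n))) := by exact_mod_cast h
    have h1 := ihm (by omega)
    have h2 := ihn (by omega)
    have hpos : ∀ S : Finset ℕ, 0 ≤ ∏ p ∈ S, localFactor p := fun S =>
      Finset.prod_nonneg fun p _ => (localFactor_mem p).1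
    rw [hmn.primeFactors_mul, Finset.prod_union hmn.disjoint_primeFactors, Nat.totient_mul hmn]
    push_cast
    calc _ = ((∏ p ∈ m.primeFactors, localFactor p) * (m.totient : ℝ) ^ 4) *
          ((∏ p ∈ n.primeFactors, localFactor p) * (n.totient : ℝ) ^ 4) := by ring
      _ ≤ (m * Nat.card (unitSols fun i => (a i : ZMod m))) *
          (n * Nat.card (unitSols fun i => (a i : ZMod n))) := by
          have := hpos m.primeFactors
          have := hpos n.primeFactors
          gcongr
      _ = m * n * (Nat.card (unitSols fun i => (a i : ZMod m)) *
          Nat.card (unitSols fun i => (a i : ZMod n))) := by ring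
      _ ≤ _ := by gcongr

lemma totient_pow_le_card_unitSols {a : Fin 4 → ℤ} (ha : IsLocSolv a) {W : ℕ} (hW : W ≠ 0) :
    (W.totient : ℝ) ^ 4 ≤ 2 * W * Nat.card (unitSols fun i => (a i : ZMod W)) := by
  have h1 := prod_localFactor_mul_le ha W hW
  have h2 := half_le_prod_localFactor W.primeFactors
  have h3 : 0 ≤ (W.totient : ℝ) ^ 4 := by positivity
  nlinarith

lemma card_hyperplane_ge {κ : ℝ} (hκ : 0 < κ) (hκ1 : κ ≤ 1) {z B H : ℕ} (hz : κ * B ≤ z)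
    (hB : 1 ≤ B) (hH : 4 * (B : ℝ) ≤ κ * H) {p : Fin 4 → ℕ} (hp : p ∈ primeQuads z B) {m : ℤ}
    (hm : ((|m| : ℤ) : ℝ) ≤ κ * H * B / 8) :
    κ ^ 3 / 1024 * H ^ 3 / B ≤
      ((box H).filter fun h => ∑ i, quadCast p i * h i = m).card := by
  obtain ⟨hp1, i, j, hij'⟩ := mem_primeQuads.1 hp
  have hij : i ≠ j := fun h => hij' (by rw [h])
  obtain ⟨k, l, hc, hsum, hik, hil, hjk, hjl, hkl⟩ := exists_complement i j hij
  obtain ⟨u, v, huv⟩ : IsCoprime (p i : ℤ) (p j : ℤ) :=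
    Nat.isCoprime_iff_coprime.2 ((Nat.coprime_primes (hp1 i).2.2 (hp1 j).2.2).2 hij')
  have hB0 : (0 : ℝ) < B := by exact_mod_cast hB
  have hzp : ∀ s, (z : ℝ) ≤ p s := fun s => by exact_mod_cast (hp1 s).1
  have hpj0 : (0 : ℤ) < p j := by exact_mod_cast (hp1 j).2.2.pos
  set J := ⌊κ * H / 16⌋₊ with hJ
  set T := ⌊κ * H / (2 * B)⌋₊ with hT
  have hJle : (J : ℝ) ≤ κ * H / 16 := Nat.floor_le (by positivity)
  have hTle : (T : ℝ) ≤ κ * H / (2 * B) := Nat.floor_le (by positivity)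
  have hTB : (T : ℝ) * B ≤ κ * H / 2 := by
    calc (T : ℝ) * B ≤ κ * H / (2 * B) * B := by gcongr
      _ = _ := by field_simp
  let r : ℤ × ℤ × ℕ → ℤ := fun x => m - x.1 * p k - x.2.1 * p l
  let X : ℤ × ℤ × ℕ → ℤ := fun x => (r x * u) % p j + p j * x.2.2
  let F : ℤ × ℤ × ℕ → Fin 4 → ℤ := fun x s =>
    if s = i then X x else if s = j then (r x - X x * p i) / p j else if s = k then x.1 else x.2.1
  have Fi : ∀ x, F x i = X x := fun x => by simp [F]
  have Fj : ∀ x, F x j = (r x - X x * p i) / p j := fun x => by simp [F, hij.symm]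
  have Fk : ∀ x, F x k = x.1 := fun x => by simp [F, hik.symm, hjk.symm]
  have Fl : ∀ x, F x l = x.2.1 := fun x => by simp [F, hil.symm, hjl.symm, hkl.symm]
  have hdvd : ∀ x, (p j : ℤ) ∣ r x - X x * p i := fun x => by
    have h1 : (p j : ℤ) ∣ r x * u - (r x * u) % p j := Int.dvd_self_sub_emod
    have h2 : r x - X x * p i = (r x * u - (r x * u) % p j) * p i +
        p j * (r x * v - x.2.2 * p i) := by
      simp only [X]; linear_combination (-(r x)) * huv
    rw [h2]
    exact dvd_add (h1.mul_right _) (dvd_mul_right _ _)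
  have hcard : (Finset.Icc (-(J : ℤ)) J ×ˢ Finset.Icc (-(J : ℤ)) J ×ˢ Finset.range T).card ≤
      ((box H).filter fun h => ∑ i, quadCast p i * h i = m).card := by
    refine Finset.card_le_card_of_injOn F ?_ ?_
    · intro x hx
      simp only [Finset.coe_product, Set.mem_prod, Finset.mem_coe, Finset.mem_Icc,
        Finset.mem_range] at hx
      obtain ⟨⟨a1, a2⟩, ⟨b1, b2⟩, ht⟩ := hx
      have ha : |x.1| ≤ J := abs_le.2 ⟨a1, a2⟩
      have hb : |x.2.1| ≤ J := abs_le.2 ⟨b1, b2⟩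
      have ha' : |(x.1 : ℝ)| ≤ κ * H / 16 := by
        refine le_trans ?_ hJle
        exact_mod_cast ha
      have hb' : |(x.2.1 : ℝ)| ≤ κ * H / 16 := by
        refine le_trans ?_ hJle
        exact_mod_cast hb
      have hX0 : 0 ≤ X x := add_nonneg (Int.emod_nonneg _ hpj0.ne') (by positivity)
      have hX1 : X x ≤ p j * T := by
        have h1 := Int.emod_lt_of_pos (r x * u) hpj0
        have h2 : ((x.2.2 : ℤ) + 1) ≤ T := by exact_mod_cast ht
        have h3 : (p j : ℤ) * (x.2.2 + 1) ≤ p j * T := by gcongr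
        simp only [X]; linarith
      have hX1' : ((X x : ℤ) : ℝ) ≤ κ * H / 2 := by
        calc ((X x : ℤ) : ℝ) ≤ ((p j * T : ℤ) : ℝ) := by exact_mod_cast hX1
          _ = T * p j := by push_cast; ring
          _ ≤ T * B := by gcongr; exact (hp1 j).2.1
          _ ≤ _ := hTB
      have hr : |((r x : ℤ) : ℝ)| ≤ κ * H * B / 4 := by
        have e1 : |(x.1 : ℝ) * p k| ≤ κ * H / 16 * B := by
          rw [abs_mul, Nat.abs_cast]; gcongr; exact (hp1 k).2.1
        have e2 : |(x.2.1 : ℝ) * p l| ≤ κ * H / 16 * B := by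
          rw [abs_mul, Nat.abs_cast]; gcongr; exact (hp1 l).2.1
        have e3 : |(m : ℝ)| ≤ κ * H * B / 8 := by exact_mod_cast hm
        rw [abs_le] at e1 e2 e3 ⊢
        simp only [r]; push_cast
        constructor <;> linarith [e1.1, e1.2, e2.1, e2.2, e3.1, e3.2]
      have hHle : κ * H ≤ H := mul_le_of_le_one_left (by positivity) hκ1
      rw [Finset.mem_coe, Finset.mem_filter, mem_box]
      refine ⟨fun s => ?_, ?_⟩
      · rcases hc s with rfl | rfl | rfl | rfl
        · rw [Fi, abs_of_nonneg hX0]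
          have : ((X x : ℤ) : ℝ) ≤ (H : ℤ) := by
            push_cast
            have : (0 : ℝ) ≤ H := by positivity
            linarith
          exact_mod_cast this
        · rw [Fj]
          obtain ⟨y, hy⟩ := hdvd x
          rw [hy, Int.mul_ediv_cancel_left _ hpj0.ne']
          have h1 : |(y : ℝ)| * p s ≤ H * p s := by
            have hy' : ((r x : ℤ) : ℝ) - (X x : ℤ) * p i = p s * y := by exact_mod_cast hy
            have h2 : |(y : ℝ)| * p s = |((r x : ℤ) : ℝ) - (X x : ℤ) * p i| := by
              rw [hy', abs_mul, Nat.abs_cast, mul_comm]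
            have h3 : |((X x : ℤ) : ℝ) * p i| ≤ κ * H / 2 * B := by
              rw [abs_mul, Nat.abs_cast, abs_of_nonneg (by exact_mod_cast hX0)]
              gcongr
              exact (hp1 i).2.1
            rw [h2]
            refine (abs_sub _ _).trans ?_
            calc _ ≤ κ * H * B / 4 + κ * H / 2 * B := add_le_add hr h3
              _ ≤ H * (κ * B) := by
                have : 0 ≤ κ * H * B := by positivity
                nlinarith
              _ ≤ H * p s := by gcongr; exact hz.trans (hzp s)
          have h4 := le_of_mul_le_mul_right h1 (by exact_mod_cast hpj0)
          exact_mod_cast h4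
        · rw [Fk]
          have : |(x.1 : ℝ)| ≤ H := by
            have : (0 : ℝ) ≤ H := by positivity
            linarith
          exact_mod_cast this
        · rw [Fl]
          have : |(x.2.1 : ℝ)| ≤ H := by
            have : (0 : ℝ) ≤ H := by positivity
            linarith
          exact_mod_cast this
      · rw [hsum, Fi, Fj, Fk, Fl]
        simp only [quadCast]
        rw [Int.mul_ediv_cancel' (hdvd x)]
        simp only [r]; ring
    · intro x _ y _ h
      have h1 : x.1 = y.1 := by rw [← Fk x, h, Fk]
      have h2 : x.2.1 = y.2.1 := by rw [← Fl x, h, Fl]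
      have h3 : X x = X y := by rw [← Fi x, h, Fi]
      have h4 : r x = r y := by simp only [r, h1, h2]
      simp only [X, h4, add_right_inj] at h3
      have h5 := mul_left_cancel₀ hpj0.ne' h3
      exact Prod.ext h1 (Prod.ext h2 (by exact_mod_cast h5))
  have hcard' : ((Finset.Icc (-(J : ℤ)) J ×ˢ Finset.Icc (-(J : ℤ)) J ×ˢ Finset.range T).card : ℝ) =
      (2 * J + 1) * ((2 * J + 1) * T) := by
    have : (J + 1 + J : ℤ).toNat = 2 * J + 1 := by omega
    simp [this]
  have hJge : κ * H / 16 ≤ 2 * J + 1 := by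
    have := Nat.lt_floor_add_one (κ * H / 16)
    have h0 : (0 : ℝ) ≤ J := by positivity
    linarith
  have hTge : κ * H / (4 * B) ≤ T := by
    have h1 := Nat.lt_floor_add_one (κ * H / (2 * B))
    have h2 : 1 ≤ κ * H / (4 * B) := (one_le_div (by positivity)).2 hH
    have h3 : κ * H / (2 * B) = κ * H / (4 * B) + κ * H / (4 * B) := by field_simp; ring
    linarith
  calc κ ^ 3 / 1024 * H ^ 3 / B = κ * H / 16 * (κ * H / 16 * (κ * H / (4 * B))) := by
        field_simp; ring
    _ ≤ (2 * J + 1) * ((2 * J + 1) * T) := by gcongr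
    _ ≤ _ := by rw [← hcard']; exact_mod_cast hcard

/-- The primes `p` in `[y, (1 + δ) y]` with `p ≡ b (mod W)`. -/
noncomputable def primesIn (W : ℕ) (b : ZMod W) (δ y : ℝ) : Finset ℕ :=
  (Finset.range (⌊(1 + δ) * y⌋₊ + 1)).filter fun p : ℕ => p.Prime ∧ y ≤ p ∧ (p : ZMod W) = b

lemma mem_primesIn {W : ℕ} {b : ZMod W} {δ y : ℝ} (hδ : 0 ≤ δ) (hy : 0 ≤ y) {p : ℕ} :
    p ∈ primesIn W b δ y ↔ p.Prime ∧ y ≤ p ∧ (p : ℝ) ≤ (1 + δ) * y ∧ (p : ZMod W) = b := by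
  rw [primesIn, Finset.mem_filter, Finset.mem_range, Nat.lt_succ_iff,
    Nat.le_floor_iff (by positivity)]
  tauto

lemma exists_card_primesIn_ge : ∃ c : ℝ, 0 < c ∧ ∀ (W : ℕ), W ≠ 0 → ∀ δ : ℝ, 0 < δ → δ ≤ 1 →
    ∀ θ : ℝ, 0 < θ → ∀ᶠ B : ℕ in atTop, ∀ (b : (ZMod W)ˣ) (y : ℝ), θ * B ≤ y → y ≤ B →
      c * δ * θ * B / (W.totient * Real.log B) ≤ (primesIn W b δ y).card := by
  obtain ⟨c, hc, h⟩ := exists_primes_progression_ge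
  refine ⟨c, hc, fun W hW δ hδ hδ1 θ hθ => ?_⟩
  have : NeZero W := ⟨hW⟩
  have h1 : ∀ᶠ x : ℝ in atTop, ∀ b : (ZMod W)ˣ, c * δ * x / (W.totient * Real.log x) ≤
      (primesIn W b δ x).card := by
    rw [Filter.eventually_all]
    exact fun b => h W b b.isUnit δ hδ hδ1
  obtain ⟨x₀, hx₀⟩ := Filter.eventually_atTop.1 (h1.and (Filter.eventually_gt_atTop 1))
  have h2 : Tendsto (fun B : ℕ => θ * (B : ℝ)) atTop atTop :=
    Tendsto.const_mul_atTop hθ tendsto_natCast_atTop_atTop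
  filter_upwards [h2.eventually_ge_atTop x₀] with B hB b y hy hyB
  obtain ⟨h3, h4⟩ := hx₀ y (hB.trans hy)
  refine le_trans ?_ (h3 b)
  have hW0 : (0 : ℝ) < W.totient := by exact_mod_cast Nat.totient_pos.2 (Nat.pos_of_ne_zero hW)
  have h5 : 0 < Real.log y := Real.log_pos h4
  have h6 : Real.log y ≤ Real.log B := Real.log_le_log (by linarith) hyB
  rw [mul_assoc (c * δ)]
  gcongr

set_option maxHeartbeats 1000000 in
lemma exists_card_admissible_residue_ge : ∃ c : ℝ, 0 < c ∧ ∀ η : ℝ, 0 < η → η ≤ 1 →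
    ∀ W : ℕ, W ≠ 0 → ∀ δ : ℝ, 0 < δ → δ ≤ 1 / 2 → ∀ᶠ B : ℕ in atTop, ∀ (n : ℕ) (a : Fin 4 → ℤ),
      IsLocSolv a → (∀ s, η * n ≤ ((|a s| : ℤ) : ℝ)) → (∀ s, |a s| ≤ n) →
      ∀ b : Fin 4 → (ZMod W)ˣ,
      (c * (η ^ 3 / 32) * B / (W.totient * Real.log B)) ^ 4 * δ ≤
        ((primeQuads ⌈η ^ 3 / 32 * B⌉₊ B).filter fun p =>
          |((∑ s, quadCast p s * a s : ℤ) : ℝ)| ≤ δ * n * B ∧ ∀ s, (p s : ZMod W) = b s).card := by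
  obtain ⟨c, hc, h⟩ := exists_card_primesIn_ge
  refine ⟨c, hc, fun η hη hη1 W hW δ hδ hδ1 => ?_⟩
  set μ := η ^ 3 / 32 with hμ
  have hμ0 : 0 < μ := by positivity
  clear_value μ
  have hη2 : η ^ 2 ≤ η := by nlinarith
  have hη3 : η ^ 3 ≤ η ^ 2 := by nlinarith [sq_nonneg η]
  filter_upwards [h W hW δ hδ (by linarith) μ hμ0, h W hW 1 one_pos le_rfl μ hμ0,
    Filter.eventually_gt_atTop 0] with B hB hB' hB0 n a ha han han' b
  have hB0' : (0 : ℝ) < B := by exact_mod_cast hB0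
  obtain ⟨⟨hne, -⟩, hsign, -⟩ := ha
  push Not at hsign
  obtain ⟨⟨j, hj⟩, ⟨i, hi⟩⟩ := hsign
  replace hj : a j < 0 := lt_of_le_of_ne hj (hne j)
  replace hi : 0 < a i := lt_of_le_of_ne hi (hne i).symm
  have hij : i ≠ j := by rintro rfl; omega
  obtain ⟨k, l, hc', -, hik, hil, hjk, hjl, hkl⟩ := exists_complement i j hij
  have hsum := fun f : Fin 4 → ℤ => sum_eq_of_complement hc' hij hik hil hjk hjl hkl f
  have hn0 : (0 : ℝ) < n := by
    have : (0 : ℤ) < n := (abs_pos.2 (hne i)).trans_le (han' i)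
    exact_mod_cast this
  have hi0 : (0 : ℝ) < a i := by exact_mod_cast hi
  have hi1 : η * n ≤ a i := by simpa [abs_of_pos hi] using han i
  have hi2 : (a i : ℝ) ≤ n := by
    have := (le_abs_self _).trans (han' i)
    exact_mod_cast this
  have hj1 : η * n ≤ -(a j : ℝ) := by simpa [abs_of_neg hj] using han j
  have hj2 : -(a j : ℝ) ≤ n := by
    have := (neg_le_abs _).trans (han' j)
    exact_mod_cast this
  have hj0 : 0 ≤ -(a j : ℝ) := le_trans (by positivity) hj1
  have hle : ∀ s, |(a s : ℝ)| ≤ n := fun s => by exact_mod_cast han' s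
  set Ak := primesIn W (b k) 1 (μ * B) with hAk
  set Al := primesIn W (b l) 1 (μ * B) with hAl
  set Aj := primesIn W (b j) 1 (η / 4 * B) with hAj
  let y : ℕ × ℕ × ℕ → ℝ := fun t => -(a j * t.1 + a k * t.2.1 + a l * t.2.2 : ℝ) / a i
  have hy : ∀ t ∈ Aj ×ˢ Ak ×ˢ Al, η ^ 2 / 8 * B ≤ y t ∧ y t ≤ 5 / 8 * B := by
    intro t ht
    simp only [Finset.mem_product] at ht
    obtain ⟨h1, h2, h3⟩ := ht
    obtain ⟨-, h1a, h1b, -⟩ := (mem_primesIn zero_le_one (by positivity)).1 h1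
    obtain ⟨-, h2a, h2b, -⟩ := (mem_primesIn zero_le_one (by positivity)).1 h2
    obtain ⟨-, h3a, h3b, -⟩ := (mem_primesIn zero_le_one (by positivity)).1 h3
    have e1 : |(a k : ℝ) * t.2.1| ≤ n * ((1 + 1) * (μ * B)) := by
      rw [abs_mul, Nat.abs_cast]; gcongr; exact hle k
    have e2 : |(a l : ℝ) * t.2.2| ≤ n * ((1 + 1) * (μ * B)) := by
      rw [abs_mul, Nat.abs_cast]; gcongr; exact hle l
    have e3 : η * n * (η / 4 * B) ≤ -(a j : ℝ) * t.1 := by gcongr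
    have e4 : -(a j : ℝ) * t.1 ≤ n * ((1 + 1) * (η / 4 * B)) := by gcongr
    rw [abs_le] at e1 e2
    have e5 : n * ((1 + 1) * (μ * B)) ≤ η ^ 2 / 16 * (n * B) := by
      have : 0 ≤ n * (B : ℝ) := by positivity
      simp only [hμ]; nlinarith
    constructor
    · rw [le_div_iff₀ hi0]
      calc η ^ 2 / 8 * B * a i ≤ η ^ 2 / 8 * B * n := by gcongr
        _ ≤ _ := by linarith [e1.1, e1.2, e2.1, e2.2]
    · rw [div_le_iff₀ hi0]
      calc _ ≤ 5 / 8 * B * (η * n) := by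
            have : η ^ 2 / 16 * (n * (B : ℝ)) ≤ η / 16 * (n * B) := by gcongr
            linarith [e1.1, e1.2, e2.1, e2.2]
        _ ≤ _ := by gcongr
  let T := (Aj ×ˢ Ak ×ˢ Al).sigma fun t => primesIn W (b i) δ (y t)
  let F : (Σ _ : ℕ × ℕ × ℕ, ℕ) → Fin 4 → ℕ := fun x s =>
    if s = i then x.2 else if s = j then x.1.1 else if s = k then x.1.2.1 else x.1.2.2
  have Fi : ∀ x, F x i = x.2 := fun x => by simp [F]
  have Fj : ∀ x, F x j = x.1.1 := fun x => by simp [F, hij.symm]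
  have Fk : ∀ x, F x k = x.1.2.1 := fun x => by simp [F, hik.symm, hjk.symm]
  have Fl : ∀ x, F x l = x.1.2.2 := fun x => by simp [F, hil.symm, hjl.symm, hkl.symm]
  have hcard : T.card ≤ ((primeQuads ⌈μ * B⌉₊ B).filter fun p =>
          |((∑ s, quadCast p s * a s : ℤ) : ℝ)| ≤ δ * n * B ∧ ∀ s, (p s : ZMod W) = b s).card := by
    refine Finset.card_le_card_of_injOn F ?_ ?_
    · intro x hx
      obtain ⟨ht, hxi⟩ := Finset.mem_sigma.1 (Finset.mem_coe.1 hx)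
      obtain ⟨y1, y2⟩ := hy _ ht
      have hy0 : 0 ≤ y x.1 := le_trans (by positivity) y1
      simp only [Finset.mem_product] at ht
      obtain ⟨h1, h2, h3⟩ := ht
      obtain ⟨p1, h1a, h1b, r1⟩ := (mem_primesIn zero_le_one (by positivity)).1 h1
      obtain ⟨p2, h2a, h2b, r2⟩ := (mem_primesIn zero_le_one (by positivity)).1 h2
      obtain ⟨p3, h3a, h3b, r3⟩ := (mem_primesIn zero_le_one (by positivity)).1 h3
      obtain ⟨p4, h4a, h4b, r4⟩ := (mem_primesIn hδ.le hy0).1 hxi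
      have m1 : μ * B ≤ η ^ 2 / 32 * B := by simp only [hμ]; gcongr
      have m2 : η ^ 2 / 32 * B ≤ η / 32 * B := by gcongr
      have m3 : η / 32 * B ≤ 1 / 32 * B := by gcongr
      have m4 : (0 : ℝ) < η ^ 2 * B := by positivity
      have m5 : (1 + δ) * y x.1 ≤ B := by nlinarith
      rw [Finset.mem_coe, Finset.mem_filter, mem_primeQuads]
      refine ⟨⟨fun s => ?_, i, k, ?_⟩, ?_, fun s => ?_⟩
      · rw [Nat.ceil_le, ← Nat.cast_le (α := ℝ) (m := F x s)]
        rcases hc' s with rfl | rfl | rfl | rfl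
        · rw [Fi]; exact ⟨by linarith, by linarith, p4⟩
        · rw [Fj]; exact ⟨by linarith, by linarith, p1⟩
        · rw [Fk]; exact ⟨by linarith, by linarith, p2⟩
        · rw [Fl]; exact ⟨by linarith, by linarith, p3⟩
      · rw [Fi, Fk]
        intro h
        have : (x.2 : ℝ) = x.1.2.1 := by exact_mod_cast h
        linarith
      · have e : ((∑ s, quadCast (F x) s * a s : ℤ) : ℝ) = a i * (x.2 - y x.1) := by
          rw [hsum]
          simp only [quadCast, Fi, Fj, Fk, Fl, y]
          push_cast
          field_simp
          ring
        rw [e, abs_mul, abs_of_pos hi0, abs_of_nonneg (by linarith)]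
        calc (a i : ℝ) * (x.2 - y x.1) ≤ n * (δ * B) := by
              have d1 : δ * y x.1 ≤ δ * B := by gcongr; linarith
              have d2 : x.2 - y x.1 ≤ δ * B := by linarith
              have d3 : 0 ≤ x.2 - y x.1 := by linarith
              gcongr
          _ = _ := by ring
      · rcases hc' s with rfl | rfl | rfl | rfl
        · rw [Fi, r4]
        · rw [Fj, r1]
        · rw [Fk, r2]
        · rw [Fl, r3]
    · intro x _ x' _ hxx
      have q1 : x.1.1 = x'.1.1 := by rw [← Fj x, hxx, Fj]
      have q2 : x.1.2.1 = x'.1.2.1 := by rw [← Fk x, hxx, Fk]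
      have q3 : x.1.2.2 = x'.1.2.2 := by rw [← Fl x, hxx, Fl]
      have q4 : x.2 = x'.2 := by rw [← Fi x, hxx, Fi]
      obtain ⟨⟨_, _, _⟩, _⟩ := x
      obtain ⟨⟨_, _, _⟩, _⟩ := x'
      simp only at q1 q2 q3 q4
      subst q1 q2 q3 q4
      rfl
  refine le_trans ?_ (Nat.cast_le.2 hcard)
  set N := c * μ * B / (W.totient * Real.log B) with hN
  have hN0 : 0 ≤ N := by
    have : 0 ≤ Real.log B := Real.log_natCast_nonneg B
    positivity
  have mB : μ * B ≤ η / 4 * B := by gcongr; linarith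
  have mB1 : η / 4 * B ≤ B := by nlinarith
  have k1 : N ≤ Aj.card := by
    have := hB' (b j) (η / 4 * B) mB mB1; rwa [mul_one] at this
  have k2 : N ≤ Ak.card := by
    have := hB' (b k) (μ * B) le_rfl (mB.trans mB1); rwa [mul_one] at this
  have k3 : N ≤ Al.card := by
    have := hB' (b l) (μ * B) le_rfl (mB.trans mB1); rwa [mul_one] at this
  have k4 : ∀ t ∈ Aj ×ˢ Ak ×ˢ Al, N * δ ≤ (primesIn W (b i) δ (y t)).card := by
    intro t ht
    obtain ⟨y1, y2⟩ := hy t ht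
    have m0 : μ ≤ η ^ 2 / 8 := by linarith [sq_nonneg η]
    have m1 : μ * B ≤ η ^ 2 / 8 * B := mul_le_mul_of_nonneg_right m0 hB0'.le
    have := hB (b i) (y t) (m1.trans y1) (by linarith)
    calc N * δ = _ := by rw [hN]; ring
      _ ≤ _ := this
  calc N ^ 4 * δ = (N * (N * N)) * (N * δ) := by ring
    _ ≤ (Aj.card * (Ak.card * Al.card)) * (N * δ) :=
        mul_le_mul_of_nonneg_right (mul_le_mul k1 (mul_le_mul k2 k3 hN0 (Nat.cast_nonneg _))
          (mul_nonneg hN0 hN0) (Nat.cast_nonneg _)) (mul_nonneg hN0 hδ.le)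
    _ = ∑ t ∈ Aj ×ˢ Ak ×ˢ Al, N * δ := by
        rw [Finset.sum_const, Finset.card_product, Finset.card_product, nsmul_eq_mul]
        push_cast; ring
    _ ≤ ∑ t ∈ Aj ×ˢ Ak ×ˢ Al, ((primesIn W (b i) δ (y t)).card : ℝ) := Finset.sum_le_sum k4
    _ = T.card := by rw [Finset.card_sigma]; push_cast; rfl

lemma exists_card_admissible_ge : ∃ c : ℝ, 0 < c ∧ ∀ η : ℝ, 0 < η → η ≤ 1 →
    ∀ W : ℕ, W ≠ 0 → ∀ δ : ℝ, 0 < δ → δ ≤ 1 / 2 → ∀ᶠ B : ℕ in atTop, ∀ (n : ℕ) (a : Fin 4 → ℤ),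
      IsLocSolv a → (∀ s, η * n ≤ ((|a s| : ℤ) : ℝ)) → (∀ s, |a s| ≤ n) →
      c * (η ^ 3 / 32) ^ 4 * δ / W * B ^ 4 / Real.log B ^ 4 ≤
        ((primeQuads ⌈η ^ 3 / 32 * B⌉₊ B).filter fun p =>
          |((∑ s, quadCast p s * a s : ℤ) : ℝ)| ≤ δ * n * B ∧
            (W : ℤ) ∣ ∑ s, quadCast p s * a s).card := by
  obtain ⟨c, hc, h⟩ := exists_card_admissible_residue_ge
  refine ⟨c ^ 4 / 2, by positivity, fun η hη hη1 W hW δ hδ hδ1 => ?_⟩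
  have : NeZero W := ⟨hW⟩
  filter_upwards [h η hη hη1 W hW δ hδ hδ1] with B hB n a ha h1 h2
  classical
  set U : Finset (Fin 4 → (ZMod W)ˣ) :=
    Finset.univ.filter fun b => b ∈ unitSols fun i => (a i : ZMod W) with hU
  have hUcard : Nat.card (unitSols fun i => (a i : ZMod W)) = U.card := by
    rw [Nat.card_eq_fintype_card, ← Set.toFinset_card]
    congr 1
    ext b
    simp [hU]
  have hφ := totient_pow_le_card_unitSols ha hW
  rw [hUcard] at hφ
  set μ := η ^ 3 / 32 with hμ
  clear_value μ
  let S := (primeQuads ⌈μ * B⌉₊ B).filter fun p =>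
          |((∑ s, quadCast p s * a s : ℤ) : ℝ)| ≤ δ * n * B
  have hcard : ∑ b ∈ U, (S.filter fun p => ∀ s, (p s : ZMod W) = b s).card ≤
      ((primeQuads ⌈μ * B⌉₊ B).filter fun p =>
          |((∑ s, quadCast p s * a s : ℤ) : ℝ)| ≤ δ * n * B ∧
            (W : ℤ) ∣ ∑ s, quadCast p s * a s).card := by
    rw [← Finset.card_biUnion]
    · refine Finset.card_le_card fun p hp => ?_
      obtain ⟨b, hb, hp⟩ := Finset.mem_biUnion.1 hp
      obtain ⟨hp1, hp2⟩ := Finset.mem_filter.1 hp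
      obtain ⟨hp3, hp4⟩ := Finset.mem_filter.1 hp1
      refine Finset.mem_filter.2 ⟨hp3, hp4, ?_⟩
      rw [← ZMod.intCast_zmod_eq_zero_iff_dvd _ W]
      have hb' : ∑ i, (a i : ZMod W) * (b i : ZMod W) = 0 := (Finset.mem_filter.1 hb).2
      rw [← hb']
      push_cast [quadCast]
      exact Finset.sum_congr rfl fun s _ => by rw [hp2 s, mul_comm]
    · intro b _ b' _ hbb
      refine Finset.disjoint_left.2 fun p hp hp' => hbb ?_
      funext s
      ext
      rw [← (Finset.mem_filter.1 hp).2 s, ← (Finset.mem_filter.1 hp').2 s]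
  refine le_trans ?_ (Nat.cast_le.2 hcard)
  have hWφ : (0 : ℝ) < W.totient := by exact_mod_cast Nat.totient_pos.2 (Nat.pos_of_ne_zero hW)
  have hW0 : (0 : ℝ) < W := by exact_mod_cast Nat.pos_of_ne_zero hW
  have hlog : 0 ≤ Real.log B := Real.log_natCast_nonneg B
  push_cast
  calc c ^ 4 / 2 * μ ^ 4 * δ / W * B ^ 4 / Real.log B ^ 4
      = (W.totient : ℝ) ^ 4 / (2 * W) * ((c * μ * B / (W.totient * Real.log B)) ^ 4 * δ) := by
        rw [div_pow, mul_pow (W.totient : ℝ)]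
        field_simp
    _ ≤ U.card * ((c * μ * B / (W.totient * Real.log B)) ^ 4 * δ) := by
        gcongr
        rw [div_le_iff₀ (by positivity)]
        linarith
    _ = ∑ b ∈ U, ((c * μ * B / (W.totient * Real.log B)) ^ 4 * δ) := by
        rw [Finset.sum_const, nsmul_eq_mul]
    _ ≤ _ := by
        refine Finset.sum_le_sum fun b _ => ?_
        refine (hB n a ha h1 h2 b).trans ?_
        rw [Finset.filter_filter]

lemma exists_sum_countSol_ge {η : ℝ} (hη : 0 < η) (hη1 : η ≤ 1) : ∃ c : ℝ, 0 < c ∧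
    ∀ W : ℕ, W ≠ 0 → ∀ δ : ℝ, 0 < δ → δ ≤ 1 → ∀ᶠ B : ℕ in atTop, ∀ (n H : ℕ) (a : Fin 4 → ℤ),
      IsLocSolv a → (∀ s, η * n ≤ ((|a s| : ℤ) : ℝ)) → (∀ s, |a s| ≤ n) →
      δ * n ≤ 2 * (W * H) → (W * H : ℝ) ≤ δ * n → 4 * (B : ℝ) ≤ η ^ 3 / 32 * H →
      c * H ^ 4 * B ^ 3 / (n * Real.log B ^ 4) ≤
        ∑ h ∈ box H, countSol (primeQuads ⌈η ^ 3 / 32 * B⌉₊ B) (a + (W : ℤ) • h) := by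
  obtain ⟨c, hc, h⟩ := exists_card_admissible_ge
  set κ := η ^ 3 / 32 with hκ
  have hκ0 : 0 < κ := by positivity
  have hκ1 : κ ≤ 1 := by
    have : η ^ 3 ≤ 1 := pow_le_one₀ hη.le hη1
    linarith
  refine ⟨c * κ ^ 8 / 16384, by positivity, fun W hW δ hδ hδ1 => ?_⟩
  filter_upwards [h η hη hη1 W hW (κ * δ / 16) (by positivity) (by nlinarith),
    Filter.eventually_ge_atTop 1] with B hB hB1 n H a ha h1 h2 hH1 hH2 hH
  rw [← hκ] at hB
  specialize hB n a ha h1 h2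
  have hB0 : (0 : ℝ) < B := by exact_mod_cast hB1
  have hW0 : (0 : ℝ) < W := by exact_mod_cast Nat.pos_of_ne_zero hW
  have hn0 : (0 : ℝ) < n := by
    have : (0 : ℤ) < n := (abs_pos.2 (ha.1.1 0)).trans_le (h2 0)
    exact_mod_cast this
  have hlog : 0 ≤ Real.log B := Real.log_natCast_nonneg B
  set P := primeQuads ⌈κ * B⌉₊ B with hP
  set S := P.filter fun p => |((∑ s, quadCast p s * a s : ℤ) : ℝ)| ≤ κ * δ / 16 * n * B ∧
            (W : ℤ) ∣ ∑ s, quadCast p s * a s with hS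
  have key : ∀ p ∈ S, κ ^ 3 / 1024 * H ^ 3 / B ≤
      ∑ h ∈ box H, ind (quadCast p) (a + (W : ℤ) • h) := by
    intro p hp
    obtain ⟨hp1, hp2, m, hm⟩ := Finset.mem_filter.1 hp
    have hm' : ((|(-m)| : ℤ) : ℝ) ≤ κ * H * B / 8 := by
      rw [hm] at hp2
      push_cast at hp2 ⊢
      rw [abs_mul, Nat.abs_cast] at hp2
      rw [abs_neg]
      refine le_of_mul_le_mul_left (hp2.trans ?_) hW0
      calc κ * δ / 16 * n * B = κ / 16 * B * (δ * n) := by ring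
        _ ≤ κ / 16 * B * (2 * (W * H)) := by gcongr
        _ = _ := by ring
    refine (card_hyperplane_ge hκ0 hκ1 (Nat.le_ceil _) hB1 hH hp1 hm').trans (le_of_eq ?_)
    rw [Finset.card_filter]
    push_cast
    refine Finset.sum_congr rfl fun h _ => ?_
    rw [ind]
    have e : ∑ i, quadCast p i * (a + (W : ℤ) • h) i =
        W * (m + ∑ i, quadCast p i * h i) := by
      rw [mul_add, ← hm, Finset.mul_sum, ← Finset.sum_add_distrib]
      refine Finset.sum_congr rfl fun i _ => ?_
      simp only [Pi.add_apply, Pi.smul_apply, smul_eq_mul]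
      ring
    rw [e]
    have hWz : (W : ℤ) ≠ 0 := by exact_mod_cast hW
    simp only [mul_eq_zero, hWz, false_or]
    refine if_congr ⟨fun h => by omega, fun h => by omega⟩ rfl rfl
  have hWn : (H : ℝ) / n ≤ δ / W := by
    rw [div_le_div_iff₀ hn0 hW0]; linarith
  calc c * κ ^ 8 / 16384 * H ^ 4 * B ^ 3 / (n * Real.log B ^ 4)
      = c * κ ^ 4 * (κ / 16) * (H / n) * B ^ 4 / Real.log B ^ 4 * (κ ^ 3 / 1024 * H ^ 3 / B) := by
        field_simp
        ring
    _ ≤ c * κ ^ 4 * (κ / 16) * (δ / W) * B ^ 4 / Real.log B ^ 4 * (κ ^ 3 / 1024 * H ^ 3 / B) := by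
        gcongr
    _ = c * κ ^ 4 * (κ * δ / 16) / W * B ^ 4 / Real.log B ^ 4 * (κ ^ 3 / 1024 * H ^ 3 / B) := by
        ring
    _ ≤ S.card * (κ ^ 3 / 1024 * H ^ 3 / B) := by gcongr
    _ = ∑ p ∈ S, κ ^ 3 / 1024 * H ^ 3 / B := by rw [Finset.sum_const, nsmul_eq_mul]
    _ ≤ ∑ p ∈ S, ∑ h ∈ box H, ind (quadCast p) (a + (W : ℤ) • h) := Finset.sum_le_sum key
    _ ≤ ∑ p ∈ P, ∑ h ∈ box H, ind (quadCast p) (a + (W : ℤ) • h) :=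
        Finset.sum_le_sum_of_subset_of_nonneg (Finset.filter_subset _ _) fun p _ _ =>
          Finset.sum_nonneg fun h _ => ind_nonneg _ _
    _ = _ := by rw [Finset.sum_comm]; rfl

lemma card_box_le {H : ℕ} (hH : 1 ≤ H) : ((box H).card : ℝ) ≤ 81 * H ^ 4 := by
  have h1 : (box H).card = (2 * H + 1) ^ 4 := by
    have : (H + 1 + H : ℤ).toNat = 2 * H + 1 := by omega
    simp [box, Fintype.card_piFinset, this]
  have h2 : (1 : ℝ) ≤ H := by exact_mod_cast hH
  rw [h1]
  push_cast
  calc (2 * (H : ℝ) + 1) ^ 4 ≤ (3 * H) ^ 4 := by gcongr; linarith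
    _ = _ := by ring

lemma exists_card_countSol_eq_zero_le {η : ℝ} (hη : 0 < η) (hη1 : η ≤ 1) {ε : ℝ} (hε : 0 < ε) :
    ∃ δ : ℝ, 0 < δ ∧ ∃ K : ℝ, 0 < K ∧ ∀ᶠ B : ℕ in atTop, ∀ n : ℕ,
      (B : ℝ) ^ 2 ≤ δ * n → K * (n * Real.log B ^ 4) ≤ B ^ 3 → ∀ S : Finset (Fin 4 → ℤ),
      (∀ a ∈ S, IsLocSolv a ∧ (∀ s, η * n ≤ ((|a s| : ℤ) : ℝ)) ∧ (∀ s, |a s| ≤ n) ∧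
        countSol (primeQuads ⌈η ^ 3 / 32 * B⌉₊ B) a = 0) → (S.card : ℝ) ≤ ε * n ^ 4 := by
  obtain ⟨c, hc, hS⟩ := exists_sum_countSol_ge hη hη1
  set κ := η ^ 3 / 32 with hκ
  have hκ0 : 0 < κ := by positivity
  have hκ1 : κ ≤ 1 := by
    have : η ^ 3 ≤ 1 := pow_le_one₀ hη.le hη1
    linarith
  clear_value κ
  obtain ⟨C, hC, hV⟩ := exists_variance_le hκ0 hκ1
  obtain ⟨W, hW, δ, hδ, hδ1, hV⟩ := hV (ε * (c / 81) ^ 2 / 2) (by positivity)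
  refine ⟨δ, hδ, 2 * C / (ε * (c / 81) ^ 2), by positivity, ?_⟩
  have hW0 : (0 : ℝ) < W := by exact_mod_cast hW
  have hlim : ∀ᶠ B : ℕ in atTop, 8 * W / (κ * δ) + 2 * W / δ + 2 ≤ (B : ℝ) :=
    tendsto_natCast_atTop_atTop.eventually_ge_atTop _
  filter_upwards [hV, hS W hW.ne' δ hδ hδ1, hlim] with B hV hS hB n hn hX T hT
  have hB1 : 8 * W / (κ * δ) ≤ B := by
    have : 0 ≤ 2 * W / δ := by positivity
    linarith
  have hB2 : 2 * W / δ ≤ B := by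
    have : 0 ≤ 8 * W / (κ * δ) := by positivity
    linarith
  have hB3 : (2 : ℝ) ≤ B := by
    have : 0 ≤ 8 * W / (κ * δ) := by positivity
    have : 0 ≤ 2 * W / δ := by positivity
    linarith
  have hB0 : (0 : ℝ) < B := by linarith
  have hlog : 0 < Real.log B := Real.log_pos (by linarith)
  have hnB : (B : ℝ) ^ 2 ≤ n := hn.trans (mul_le_of_le_one_left (Nat.cast_nonneg n) hδ1)
  have hn0 : (0 : ℝ) < n := lt_of_lt_of_le (by positivity) hnB
  set H := ⌊δ * n / W⌋₊ with hH
  have hH1 : (W * H : ℝ) ≤ δ * n := by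
    have : (H : ℝ) ≤ δ * n / W := Nat.floor_le (by positivity)
    rwa [le_div_iff₀ hW0, mul_comm] at this
  have hH2 : δ * n < W * (H + 1) := by
    have : δ * n / W < H + 1 := Nat.lt_floor_add_one _
    rw [div_lt_iff₀ hW0] at this
    linarith
  have hnW : 2 * W ≤ δ * n := by
    rw [div_le_iff₀ hδ] at hB2
    calc 2 * (W : ℝ) ≤ B * δ := hB2
      _ ≤ B ^ 2 * δ := by gcongr; nlinarith
      _ ≤ n * δ := by gcongr
      _ = _ := mul_comm _ _
  have hH3 : 1 ≤ H := by
    have : 0 < H := by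
      rcases Nat.eq_zero_or_pos H with h | h
      · rw [h] at hH2; push_cast at hH2; linarith
      · exact h
    exact this
  have hH4 : δ * n ≤ 2 * (W * H) := by
    have : (1 : ℝ) ≤ H := by exact_mod_cast hH3
    nlinarith
  have hH5 : 4 * (B : ℝ) ≤ κ * H := by
    rw [div_le_iff₀ (by positivity)] at hB1
    have : 8 * W * B ≤ 2 * (W * (κ * H)) := by
      calc 8 * W * B ≤ B * (κ * δ) * B := by gcongr
        _ = κ * δ * B ^ 2 := by ring
        _ ≤ κ * δ * n := by gcongr
        _ = κ * (δ * n) := by ring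
        _ ≤ κ * (2 * (W * H)) := by gcongr
        _ = _ := by ring
    have : W * (4 * (B : ℝ)) ≤ W * (κ * H) := by linarith
    exact le_of_mul_le_mul_left this hW0
  set N := countSol (primeQuads ⌈κ * B⌉₊ B) with hN
  set X := (B : ℝ) ^ 3 / (n * Real.log B ^ 4) with hXdef
  have hX0 : 0 < X := by positivity
  have hXK : 2 * C / (ε * (c / 81) ^ 2) ≤ X := (le_div_iff₀ (by positivity)).2 hX
  set b : ℝ := ((box H).card : ℝ) with hb
  have hb0 : 0 < b := by
    have : (0 : Fin 4 → ℤ) ∈ box H := mem_box.2 fun i => by simp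
    exact Nat.cast_pos.2 (Finset.card_pos.2 ⟨_, this⟩)
  have hlow : ∀ a ∈ T, (c / 81) ^ 2 * b * X ^ 2 ≤
      ∑ h ∈ box H, (N a - N (a + (W : ℤ) • h)) ^ 2 := by
    intro a ha
    obtain ⟨h1, h2, h3, h4⟩ := hT a ha
    have h5 : c / 81 * b * X ≤ ∑ h ∈ box H, N (a + (W : ℤ) • h) := by
      refine le_trans ?_ (hS n H a h1 h2 h3 hH4 hH1 hH5)
      calc c / 81 * b * X ≤ c / 81 * (81 * H ^ 4) * X := by gcongr; exact card_box_le hH3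
        _ = _ := by rw [hXdef]; ring
    have h6 : (c / 81 * b * X) ^ 2 ≤ (∑ h ∈ box H, N (a + (W : ℤ) • h)) ^ 2 :=
      pow_le_pow_left₀ (by positivity) h5 2
    have h7 := sq_sum_le_card_mul_sum_sq (s := box H) (f := fun h => N (a + (W : ℤ) • h))
    have h8 : ∑ h ∈ box H, (N a - N (a + (W : ℤ) • h)) ^ 2 =
        ∑ h ∈ box H, N (a + (W : ℤ) • h) ^ 2 :=
      Finset.sum_congr rfl fun h _ => by rw [h4, zero_sub, neg_sq]
    rw [h8]
    refine le_of_mul_le_mul_left (le_trans (le_of_eq ?_) (h6.trans h7)) hb0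
    ring
  have hnn : 0 < n := by exact_mod_cast hn0
  have hup : ∀ h ∈ box H, ∑ a ∈ T, (N a - N (a + (W : ℤ) • h)) ^ 2 ≤
      (ε * (c / 81) ^ 2 / 2 * X ^ 2 + C * X) * n ^ 4 := by
    intro h hh
    have h1 := hV ⌈κ * B⌉₊ n (Nat.le_ceil _) hn ((W : ℤ) • h)
      (fun i => by simp [Pi.smul_apply]) (fun i => by
        have := mem_box.1 hh i
        have h' : |((W : ℤ) • h) i| ≤ W * H := by
          rw [Pi.smul_apply, smul_eq_mul, abs_mul, Nat.abs_cast]; gcongr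
        refine le_trans ?_ hH1
        exact_mod_cast h')
    refine le_trans ?_ (h1.trans (le_of_eq ?_))
    · have hsub : T ⊆ box (3 * n) := fun a ha => mem_box.2 fun i => by
        have := (hT a ha).2.2.1 i
        push_cast; linarith
      refine le_trans ?_ (Finset.sum_le_sum_of_subset_of_nonneg hsub fun a _ _ =>
        mul_nonneg (weight_nonneg n a) (sq_nonneg _))
      refine Finset.sum_le_sum fun a ha => ?_
      exact le_mul_of_one_le_left (sq_nonneg _) (one_le_weight hnn (hT a ha).2.2.1)
    · rw [hXdef]; field_simp
  have hmain : T.card * ((c / 81) ^ 2 * b * X ^ 2) ≤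
      b * ((ε * (c / 81) ^ 2 / 2 * X ^ 2 + C * X) * n ^ 4) := by
    calc _ = ∑ a ∈ T, (c / 81) ^ 2 * b * X ^ 2 := by rw [Finset.sum_const, nsmul_eq_mul]
      _ ≤ ∑ a ∈ T, ∑ h ∈ box H, (N a - N (a + (W : ℤ) • h)) ^ 2 := Finset.sum_le_sum hlow
      _ = ∑ h ∈ box H, ∑ a ∈ T, (N a - N (a + (W : ℤ) • h)) ^ 2 := Finset.sum_comm
      _ ≤ ∑ h ∈ box H, (ε * (c / 81) ^ 2 / 2 * X ^ 2 + C * X) * n ^ 4 := Finset.sum_le_sum hup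
      _ = _ := by rw [Finset.sum_const, nsmul_eq_mul]
  have hCX : C * X ≤ ε * (c / 81) ^ 2 / 2 * X ^ 2 := by
    rw [div_le_iff₀ (by positivity)] at hXK
    nlinarith
  refine le_of_mul_le_mul_right (?_ : _ * ((c / 81) ^ 2 * b * X ^ 2) ≤ _) (by positivity)
  refine hmain.trans ?_
  calc b * ((ε * (c / 81) ^ 2 / 2 * X ^ 2 + C * X) * n ^ 4)
      ≤ b * ((ε * (c / 81) ^ 2 / 2 * X ^ 2 + ε * (c / 81) ^ 2 / 2 * X ^ 2) * n ^ 4) := by gcongr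
    _ = _ := by ring

lemma eventually_exists_scale {δ K : ℝ} (hδ : 0 < δ) (hK : 0 < K) {P : ℕ → Prop}
    (hP : ∀ᶠ B in atTop, P B) : ∀ᶠ s : ℝ in atTop, 1 ≤ Real.log s ∧ ∃ B : ℕ, P B ∧
      (B : ℝ) ^ 3 ≤ s * Real.log s ^ 4 * Real.log (Real.log s) ∧ (B : ℝ) ^ 2 ≤ δ * s ∧
      K * (s * Real.log B ^ 4) ≤ B ^ 3 := by
  obtain ⟨B₀, hB₀⟩ := Filter.eventually_atTop.1 hP
  have hlog := Real.tendsto_log_atTop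
  have hlog2 := hlog.comp hlog
  have h10 := (Real.isLittleO_pow_log_id_atTop (n := 10)).bound
    (show 0 < min 1 (δ ^ 3) by positivity)
  filter_upwards [Filter.eventually_ge_atTop (((B₀ : ℝ) + 2) ^ 3), hlog.eventually_ge_atTop 1,
    hlog2.eventually_ge_atTop (max 1 (8 * K)), h10, Filter.eventually_ge_atTop 1]
    with s hs h1 h2 h3 hs1
  refine ⟨h1, ?_⟩
  simp only [Function.comp] at h2
  have h4 : 1 ≤ Real.log (Real.log s) := le_trans (le_max_left _ _) h2
  have h5 : 8 * K ≤ Real.log (Real.log s) := le_trans (le_max_right _ _) h2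
  have hs0 : 0 < s := by linarith
  have h6 : Real.log s ^ 10 ≤ min 1 (δ ^ 3) * s := by
    rw [id, Real.norm_of_nonneg (by positivity), Real.norm_of_nonneg hs0.le] at h3
    exact h3
  have h7 : Real.log s ^ 10 ≤ s := h6.trans (mul_le_of_le_one_left hs0.le (min_le_left _ _))
  have h8 : Real.log s ^ 10 ≤ δ ^ 3 * s := h6.trans (by gcongr; exact min_le_right _ _)
  set L := s * Real.log s ^ 4 * Real.log (Real.log s) with hL
  have hL0 : 0 ≤ L := by positivity
  have hLs : s ≤ L := by
    calc s = s * 1 ^ 4 * 1 := by ring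
      _ ≤ L := by rw [hL]; gcongr
  have hLu : L ≤ s * Real.log s ^ 5 := by
    have := Real.log_le_self (show 0 ≤ Real.log s by linarith)
    calc L ≤ s * Real.log s ^ 4 * Real.log s := by rw [hL]; gcongr
      _ = _ := by ring
  set r := L ^ ((3 : ℕ) : ℝ)⁻¹ with hr
  have hr0 : 0 ≤ r := Real.rpow_nonneg hL0 _
  have hr3 : r ^ 3 = L := Real.rpow_inv_natCast_pow hL0 (by norm_num)
  have hrB : (B₀ : ℝ) + 2 ≤ r := by
    rw [← pow_le_pow_iff_left₀ (by positivity) hr0 (n := 3) (by norm_num), hr3]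
    linarith
  set B := ⌊r⌋₊ with hB
  have hBr : (B : ℝ) ≤ r := Nat.floor_le hr0
  have hrB1 : r < B + 1 := Nat.lt_floor_add_one r
  have hBB : B₀ ≤ B := by
    have : (B₀ : ℝ) ≤ B := by linarith
    exact_mod_cast this
  have hB1 : (1 : ℝ) ≤ B := by
    have : (0 : ℝ) ≤ B₀ := Nat.cast_nonneg _
    linarith
  have hB3 : (B : ℝ) ^ 3 ≤ L := by rw [← hr3]; gcongr
  have hL8 : L ≤ 8 * (B : ℝ) ^ 3 := by
    rw [← hr3]
    calc r ^ 3 ≤ (2 * B) ^ 3 := by gcongr; linarith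
      _ = _ := by ring
  refine ⟨B, hB₀ B hBB, hB3, ?_, ?_⟩
  · rw [← pow_le_pow_iff_left₀ (by positivity) (by positivity) (n := 3) (by norm_num)]
    calc ((B : ℝ) ^ 2) ^ 3 = (B ^ 3) ^ 2 := by ring
      _ ≤ (s * Real.log s ^ 5) ^ 2 := by gcongr; exact hB3.trans hLu
      _ = s ^ 2 * Real.log s ^ 10 := by ring
      _ ≤ s ^ 2 * (δ ^ 3 * s) := by gcongr
      _ = _ := by ring
  · have h9 : Real.log B ≤ Real.log s := by
      refine Real.log_le_log (by linarith) ?_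
      rw [← pow_le_pow_iff_left₀ (by positivity) hs0.le (n := 3) (by norm_num)]
      calc (B : ℝ) ^ 3 ≤ s * Real.log s ^ 5 := hB3.trans hLu
        _ ≤ s * Real.log s ^ 10 := by
          gcongr
          norm_num
        _ ≤ s * s := by gcongr
        _ ≤ s * s * s := le_mul_of_one_le_right (by positivity) hs1
        _ = _ := by ring
    have h10 : 0 ≤ Real.log B := Real.log_natCast_nonneg B
    have h11 : 8 * (K * (s * Real.log B ^ 4)) ≤ 8 * (B : ℝ) ^ 3 := by
      calc 8 * (K * (s * Real.log B ^ 4)) = s * Real.log B ^ 4 * (8 * K) := by ring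
        _ ≤ s * Real.log s ^ 4 * Real.log (Real.log s) := by gcongr
        _ ≤ _ := hL8
    linarith

lemma smallSol_of_countSol_ne_zero {a : Fin 4 → ℤ} {z B : ℕ} {s : ℝ} (hs : 1 ≤ Real.log s)
    (hs0 : 0 < s) (hsa : s ≤ snorm a)
    (hB : (B : ℝ) ^ 3 ≤ s * Real.log s ^ 4 * Real.log (Real.log s))
    (h : countSol (primeQuads z B) a ≠ 0) : SmallSol a := by
  obtain ⟨p, hp, hpa⟩ := Finset.exists_ne_zero_of_sum_ne_zero h
  have hdot : ∑ i, quadCast p i * a i = 0 := by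
    by_contra h0
    exact hpa (by rw [ind, if_neg h0])
  have hp1 := (mem_primeQuads.1 hp).1
  have hL : p ∈ Lsol a := by
    refine ⟨fun i => (hp1 i).2.2, ?_⟩
    rw [← hdot]
    exact Finset.sum_congr rfl fun i _ => mul_comm _ _
  have h1 : mfrak a ≤ (B : ℝ≥0∞) := by
    refine (iInf₂_le p hL).trans ?_
    exact_mod_cast Finset.sup_le fun i _ => (hp1 i).2.1
  have hlogs : Real.log s ≤ Real.log (snorm a) := Real.log_le_log hs0 hsa
  have hloglog : Real.log (Real.log s) ≤ Real.log (Real.log (snorm a)) :=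
    Real.log_le_log (by linarith) hlogs
  have h0 : 0 ≤ Real.log (Real.log s) := Real.log_nonneg hs
  calc mfrak a ^ 3 ≤ (B : ℝ≥0∞) ^ 3 := by gcongr
    _ = ENNReal.ofReal ((B : ℝ) ^ 3) := by
        rw [ENNReal.ofReal_pow (Nat.cast_nonneg _), ENNReal.ofReal_natCast]
    _ ≤ _ := by
        refine ENNReal.ofReal_le_ofReal (hB.trans ?_)
        gcongr

lemma card_box_filter_abs_lt_le {η : ℝ} {n : ℕ} (hn : 1 ≤ η * n) (hη1 : η ≤ 1)
    (s : Fin 4) : (((box n).filter fun a => ((|a s| : ℤ) : ℝ) < η * n).card : ℝ) ≤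
      81 * η * n ^ 4 := by
  have hηn : 0 ≤ η * n := by linarith
  have hn1 : (1 : ℝ) ≤ n := hn.trans (mul_le_of_le_one_left (Nat.cast_nonneg _) hη1)
  set m := ⌊η * n⌋₊ with hm
  have hmle : (m : ℝ) ≤ η * n := Nat.floor_le hηn
  let g : Fin 4 → Finset ℤ := fun t =>
    if t = s then Finset.Icc (-(m : ℤ)) m else Finset.Icc (-(n : ℤ)) n
  have hsub : ((box n).filter fun a => ((|a s| : ℤ) : ℝ) < η * n) ⊆ Fintype.piFinset g := by
    intro a ha
    obtain ⟨h1, h2⟩ := Finset.mem_filter.1 ha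
    refine Fintype.mem_piFinset.2 fun t => ?_
    by_cases ht : t = s
    · simp only [g, ht, if_true, Finset.mem_Icc, ← abs_le]
      have : (a s).natAbs ≤ m := by
        rw [hm, Nat.le_floor_iff hηn, Nat.cast_natAbs]
        exact h2.le
      rw [Int.abs_eq_natAbs]
      exact_mod_cast this
    · simp only [g, ht, if_false, Finset.mem_Icc, ← abs_le]
      exact mem_box.1 h1 t
  have hcard : (Fintype.piFinset g).card = (2 * m + 1) * (2 * n + 1) ^ 3 := by
    have e1 : (m + 1 + m : ℤ).toNat = 2 * m + 1 := by omega
    have e2 : (n + 1 + n : ℤ).toNat = 2 * n + 1 := by omega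
    rw [Fintype.card_piFinset, ← Finset.mul_prod_erase _ _ (Finset.mem_univ s)]
    congr 1
    · simp [g, e1]
    · rw [Finset.prod_congr rfl (g := fun _ => 2 * n + 1), Finset.prod_const,
        Finset.card_erase_of_mem (Finset.mem_univ s)]
      · simp
      · intro t ht
        simp [g, Finset.ne_of_mem_erase ht, e2]
  calc _ ≤ (((2 * m + 1) * (2 * n + 1) ^ 3 : ℕ) : ℝ) := by
        rw [← hcard]; exact_mod_cast Finset.card_le_card hsub
    _ = (2 * m + 1) * (2 * (n : ℝ) + 1) ^ 3 := by push_cast; ring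
    _ ≤ (3 * (η * n)) * (3 * n) ^ 3 := by
        gcongr
        · linarith
        · linarith
    _ = _ := by ring

open Classical in
lemma eventually_card_not_smallSol_le {ε : ℝ} (hε : 0 < ε) : ∀ᶠ n : ℕ in atTop,
    (((box n).filter fun a => IsLocSolv a ∧ ¬ SmallSol a).card : ℝ) ≤ ε * n ^ 4 := by
  set η := min 1 (ε / 648) with hη
  have hη0 : 0 < η := by positivity
  have hη1 : η ≤ 1 := min_le_left _ _
  have hηε : η ≤ ε / 648 := min_le_right _ _
  clear_value η
  obtain ⟨δ, hδ, K, hK, hB⟩ := exists_card_countSol_eq_zero_le hη0 hη1 (half_pos hε)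
  have hlim : Tendsto (fun n : ℕ => η * (n : ℝ)) atTop atTop :=
    Tendsto.const_mul_atTop hη0 tendsto_natCast_atTop_atTop
  filter_upwards [hlim.eventually (eventually_exists_scale hδ (show 0 < K / η by positivity) hB),
    hlim.eventually_ge_atTop 1] with n hn hn1
  obtain ⟨hlog, B, hB, hB1, hB2, hB3⟩ := hn
  set T := (box n).filter fun a => IsLocSolv a ∧ (∀ s, η * n ≤ ((|a s| : ℤ) : ℝ)) ∧
    countSol (primeQuads ⌈η ^ 3 / 32 * B⌉₊ B) a = 0 with hT
  have hTcard : (T.card : ℝ) ≤ ε / 2 * n ^ 4 := by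
    refine hB n (hB2.trans ?_) ?_ T ?_
    · gcongr; exact mul_le_of_le_one_left (Nat.cast_nonneg _) hη1
    · refine le_trans (le_of_eq ?_) hB3
      field_simp
    · intro a ha
      obtain ⟨h1, h2, h3, h4⟩ := Finset.mem_filter.1 ha
      exact ⟨h2, h3, mem_box.1 h1, h4⟩
  have hsub : ((box n).filter fun a => IsLocSolv a ∧ ¬ SmallSol a) ⊆
      T ∪ Finset.univ.biUnion fun s => (box n).filter fun a => ((|a s| : ℤ) : ℝ) < η * n := by
    intro a ha
    obtain ⟨h1, h2, h3⟩ := Finset.mem_filter.1 ha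
    rw [Finset.mem_union]
    by_cases h : ∃ s, ((|a s| : ℤ) : ℝ) < η * n
    · obtain ⟨s, hs⟩ := h
      exact Or.inr (Finset.mem_biUnion.2 ⟨s, Finset.mem_univ s, Finset.mem_filter.2 ⟨h1, hs⟩⟩)
    · push Not at h
      refine Or.inl (Finset.mem_filter.2 ⟨h1, h2, h, ?_⟩)
      by_contra h0
      refine h3 (smallSol_of_countSol_ne_zero hlog (by linarith) ((h 0).trans ?_) hB1 h0)
      have : (a 0).natAbs ≤ snorm a :=
          Finset.le_sup (f := fun i => (a i).natAbs) (Finset.mem_univ 0)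
      rw [← Nat.cast_natAbs (α := ℝ)]
      exact_mod_cast this
  calc _ ≤ ((T.card + ∑ s, ((box n).filter fun a => ((|a s| : ℤ) : ℝ) < η * n).card : ℕ) : ℝ) := by
        exact_mod_cast (Finset.card_le_card hsub).trans
          ((Finset.card_union_le _ _).trans (by gcongr; exact Finset.card_biUnion_le))
    _ ≤ ε / 2 * n ^ 4 + ∑ s : Fin 4, 81 * η * n ^ 4 := by
        rw [Nat.cast_add, Nat.cast_sum]
        exact add_le_add hTcard
          (Finset.sum_le_sum fun s _ => card_box_filter_abs_lt_le hn1 hη1 s)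
    _ = ε / 2 * n ^ 4 + 324 * η * n ^ 4 := by simp; ring
    _ ≤ ε / 2 * n ^ 4 + 324 * (ε / 648) * n ^ 4 := by gcongr
    _ = _ := by ring

lemma sum_one_div_cube_le (M : ℕ) : ∑ m ∈ Finset.Icc 5 M, (1 : ℝ) / (m : ℝ) ^ 3 ≤ (1 : ℝ) / 40 := by
  have key : ∀ k : ℕ, ∑ m ∈ Finset.range k, (1 : ℝ) / ((5 + m : ℕ) : ℝ) ^ 3 ≤
      (1 : ℝ) / 40 - 1 / (2 * ((k : ℝ) + 4) * (k + 5)) := by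
    intro k
    induction k with
    | zero => norm_num
    | succ k ih =>
      rw [Finset.sum_range_succ]
      have hk : (0 : ℝ) ≤ k := Nat.cast_nonneg k
      have h1 : 1 / ((5 + k : ℕ) : ℝ) ^ 3 ≤ 1 / (((k : ℝ) + 4) * (k + 5) * (k + 6)) := by
        refine one_div_le_one_div_of_le (by positivity) ?_
        push_cast
        nlinarith
      have h2 : 1 / (((k : ℝ) + 4) * (k + 5) * (k + 6)) =
          1 / (2 * (k + 4) * (k + 5)) - 1 / (2 * ((k + 1 : ℕ) + 4) * ((k + 1 : ℕ) + 5)) := by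
        push_cast
        field_simp
        ring
      linarith
  have h : Finset.Icc 5 M = Finset.Ico 5 (M + 1) := by ext; simp
  rw [h, Finset.sum_Ico_eq_sum_range]
  refine (key _).trans ?_
  have : (0 : ℝ) ≤ 1 / (2 * (((M + 1 - 5 : ℕ) : ℝ) + 4) * (((M + 1 - 5 : ℕ) : ℝ) + 5)) := by
    positivity
  linarith

lemma card_filter_dvd_le {p N : ℕ} (hp : p.Prime) (hp5 : 5 ≤ p) :
    ((Finset.range N).filter fun u => p ∣ 6 * u + 1).card ≤ N / p + 1 := by
  rw [← Finset.card_range (N / p + 1)]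
  refine Finset.card_le_card_of_injOn (fun u => u / p) ?_ ?_
  · intro u hu
    have := Finset.mem_range.1 (Finset.mem_filter.1 hu).1
    simp only [Finset.coe_range, Set.mem_Iio, Nat.lt_succ_iff]
    exact Nat.div_le_div_right this.le
  · intro u hu v hv huv
    have h1 := (Finset.mem_filter.1 hu).2
    have h2 := (Finset.mem_filter.1 hv).2
    have hcop : Nat.Coprime p 6 := by
      rw [Nat.Prime.coprime_iff_not_dvd hp]
      intro h
      have := Nat.le_of_dvd (by norm_num) h
      interval_cases p
      · omega
      · norm_num at hp
    have h3 : u ≡ v [MOD p] := by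
      have : 6 * u + 1 ≡ 6 * v + 1 [MOD p] :=
        ((Nat.modEq_zero_iff_dvd).2 h1).trans ((Nat.modEq_zero_iff_dvd).2 h2).symm
      exact Nat.ModEq.cancel_left_of_coprime hcop (Nat.ModEq.add_right_cancel' 1 this)
    have h4 := Nat.div_add_mod u p
    have h5 := Nat.div_add_mod v p
    simp only at huv
    rw [← h4, ← h5, huv, h3]

/-- Quadruples `t` below `N` such that each prime `p ≥ 5` leaves at least two of the numbers
`6 tᵢ + 1` undivided. -/
noncomputable def spreadQuads (N : ℕ) : Finset (Fin 4 → ℕ) := by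
  classical
  exact (Fintype.piFinset fun _ => Finset.range N).filter fun t =>
    ∀ p : ℕ, p.Prime → 5 ≤ p → ∃ i j, i ≠ j ∧ ¬ p ∣ 6 * t i + 1 ∧ ¬ p ∣ 6 * t j + 1

lemma mem_spreadQuads {N : ℕ} {t : Fin 4 → ℕ} : t ∈ spreadQuads N ↔ (∀ i, t i < N) ∧
    ∀ p : ℕ, p.Prime → 5 ≤ p → ∃ i j, i ≠ j ∧ ¬ p ∣ 6 * t i + 1 ∧ ¬ p ∣ 6 * t j + 1 := by
  simp [spreadQuads, Fintype.mem_piFinset]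

lemma eventually_card_spreadQuads_ge : ∀ᶠ N : ℕ in atTop,
    (N : ℝ) ^ 4 / 2 ≤ (spreadQuads N).card := by
  classical
  filter_upwards [Filter.eventually_ge_atTop 100] with N hN
  have hN0 : (100 : ℝ) ≤ N := by exact_mod_cast hN
  let D : ℕ → Finset ℕ := fun p => (Finset.range N).filter fun u => p ∣ 6 * u + 1
  let E : ℕ → Fin 4 → Finset (Fin 4 → ℕ) := fun p s =>
    Fintype.piFinset fun i => if i = s then Finset.range N else D p
  have hE : ∀ p s, (E p s).card = N * (D p).card ^ 3 := by
    intro p s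
    simp only [E]
    rw [Fintype.card_piFinset, ← Finset.mul_prod_erase _ _ (Finset.mem_univ s)]
    congr 1
    · simp
    · rw [Finset.prod_congr rfl (g := fun _ => (D p).card), Finset.prod_const,
        Finset.card_erase_of_mem (Finset.mem_univ s)]
      · simp
      · intro t ht
        simp [Finset.ne_of_mem_erase ht]
  set Q := (Finset.Icc 5 (6 * N)).filter Nat.Prime with hQ
  have hsub : (Fintype.piFinset fun _ : Fin 4 => Finset.range N) ⊆
      spreadQuads N ∪ Q.biUnion fun p => Finset.univ.biUnion fun s => E p s := by
    intro t ht
    have ht' : ∀ i, t i < N := by simpa [Fintype.mem_piFinset] using ht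
    rw [Finset.mem_union]
    by_cases h : t ∈ spreadQuads N
    · exact Or.inl h
    · right
      rw [mem_spreadQuads] at h
      push Not at h
      obtain ⟨p, hp, hp5, h⟩ := h ht'
      have hs : ∃ s, ∀ i, i ≠ s → p ∣ 6 * t i + 1 := by
        by_cases h0 : ∃ s, ¬ p ∣ 6 * t s + 1
        · obtain ⟨s, hs⟩ := h0
          exact ⟨s, fun i hi => h s i hi.symm hs⟩
        · push Not at h0
          exact ⟨0, fun i _ => h0 i⟩
      obtain ⟨s, hs⟩ := hs
      have hple : p ≤ 6 * N := by
        obtain ⟨i, hi⟩ := exists_ne s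
        have := Nat.le_of_dvd (by omega) (hs i hi)
        have := ht' i
        omega
      refine Finset.mem_biUnion.2 ⟨p, by simp [hQ, hp, hp5, hple], Finset.mem_biUnion.2
        ⟨s, Finset.mem_univ s, Fintype.mem_piFinset.2 fun i => ?_⟩⟩
      split_ifs with his
      · exact Finset.mem_range.2 (ht' i)
      · exact Finset.mem_filter.2 ⟨Finset.mem_range.2 (ht' i), hs i his⟩
  have hD : ∀ p ∈ Q, ((D p).card : ℝ) ^ 3 ≤ 4 * N ^ 3 * (1 / (p : ℝ) ^ 3) + 4 := by
    intro p hp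
    obtain ⟨hp1, hp2⟩ := Finset.mem_filter.1 hp
    have hp5 := (Finset.mem_Icc.1 hp1).1
    have h1 : ((D p).card : ℝ) ≤ N / p + 1 := by
      calc ((D p).card : ℝ) ≤ ((N / p + 1 : ℕ) : ℝ) := by
            exact_mod_cast card_filter_dvd_le hp2 hp5
        _ ≤ _ := by push_cast; gcongr; exact Nat.cast_div_le
    have h2 : (0 : ℝ) ≤ N / p := by positivity
    calc ((D p).card : ℝ) ^ 3 ≤ ((N : ℝ) / p + 1) ^ 3 := by gcongr
      _ ≤ 4 * ((N : ℝ) / p) ^ 3 + 4 := by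
          nlinarith [mul_nonneg (add_nonneg h2 zero_le_one) (sq_nonneg ((N : ℝ) / p - 1))]
      _ = _ := by rw [div_pow]; ring
  have hsum : ∑ p ∈ Q, ((D p).card : ℝ) ^ 3 ≤ N ^ 3 / 10 + 24 * N := by
    calc ∑ p ∈ Q, ((D p).card : ℝ) ^ 3 ≤ ∑ p ∈ Q, (4 * N ^ 3 * (1 / (p : ℝ) ^ 3) + 4) :=
          Finset.sum_le_sum hD
      _ ≤ ∑ p ∈ Finset.Icc 5 (6 * N), (4 * N ^ 3 * (1 / (p : ℝ) ^ 3) + 4) :=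
          Finset.sum_le_sum_of_subset_of_nonneg (Finset.filter_subset _ _) fun p _ _ => by
            positivity
      _ = 4 * N ^ 3 * ∑ p ∈ Finset.Icc 5 (6 * N), 1 / (p : ℝ) ^ 3 + (6 * N + 1 - 5 : ℕ) * 4 := by
          rw [Finset.sum_add_distrib, ← Finset.mul_sum, Finset.sum_const, Nat.card_Icc,
            nsmul_eq_mul]
      _ ≤ 4 * N ^ 3 * (1 / 40) + (6 * N : ℕ) * 4 := by
          gcongr
          · exact sum_one_div_cube_le _
          · omega
      _ = _ := by push_cast; ring
  have hcard : (N : ℝ) ^ 4 ≤ (spreadQuads N).card + ∑ p ∈ Q, ∑ s : Fin 4, ((E p s).card : ℝ) := by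
    have h1 := Finset.card_le_card hsub
    rw [Fintype.card_piFinset] at h1
    simp only [Finset.card_range, Finset.prod_const, Finset.card_univ, Fintype.card_fin] at h1
    have h2 : N ^ 4 ≤ (spreadQuads N).card + ∑ p ∈ Q, ∑ s : Fin 4, (E p s).card := by
      refine h1.trans ((Finset.card_union_le _ _).trans ?_)
      gcongr
      exact Finset.card_biUnion_le.trans (Finset.sum_le_sum fun p _ => Finset.card_biUnion_le)
    exact_mod_cast h2
  have hE' : ∑ p ∈ Q, ∑ s : Fin 4, ((E p s).card : ℝ) = 4 * N * ∑ p ∈ Q, ((D p).card : ℝ) ^ 3 := by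
    rw [Finset.mul_sum]
    refine Finset.sum_congr rfl fun p _ => ?_
    simp only [hE]
    push_cast
    simp
    ring
  rw [hE'] at hcard
  have h3 : 4 * (N : ℝ) * ∑ p ∈ Q, ((D p).card : ℝ) ^ 3 ≤ 4 * N * (N ^ 3 / 10 + 24 * N) := by gcongr
  have h4 : (96 : ℝ) * N ^ 2 ≤ N ^ 4 / 10 := by
    have : (100 : ℝ) ^ 2 * N ^ 2 ≤ N ^ 2 * N ^ 2 := by gcongr
    nlinarith [sq_nonneg (N : ℝ)]
  nlinarith

lemma exists_unit_solution {p : ℕ} (hp : p.Prime) (hp3 : 3 ≤ p) {a : Fin 4 → ZMod p} {i j : Fin 4}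
    (hij : i ≠ j) (hi : a i ≠ 0) (hj : a j ≠ 0) :
    ∃ x : Fin 4 → (ZMod p)ˣ, ∑ s, a s * (x s : ZMod p) = 0 := by
  have : Fact p.Prime := ⟨hp⟩
  obtain ⟨k, l, hc, -, hik, hil, hjk, hjl, hkl⟩ := exists_complement i j hij
  have hsum := fun f : Fin 4 → ZMod p => sum_eq_of_complement hc hij hik hil hjk hjl hkl f
  set m := -(a k + a l) with hm
  obtain ⟨u, hu⟩ : ∃ u : ZMod p, u ∉ ({0, m} : Finset (ZMod p)) := by
    refine Finset.exists_mem_notMem_of_card_lt_card (s := {0, m}) (t := Finset.univ) ?_ |>.imp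
      fun u h => h.2
    rw [Finset.card_univ, ZMod.card]
    exact lt_of_le_of_lt Finset.card_le_two hp3
  simp only [Finset.mem_insert, Finset.mem_singleton, not_or] at hu
  have hv : m - u ≠ 0 := sub_ne_zero.2 (Ne.symm hu.2)
  refine ⟨fun s => if s = i then Units.mk0 (u / a i) (div_ne_zero hu.1 hi) else
    if s = j then Units.mk0 ((m - u) / a j) (div_ne_zero hv hj) else 1, ?_⟩
  rw [hsum]
  simp only [hij.symm, hik.symm, hil.symm, hjk.symm, hjl.symm, if_true, if_false, Units.val_mk0,
    Units.val_one, mul_one]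
  rw [mul_div_cancel₀ _ hi, mul_div_cancel₀ _ hj, hm]
  ring

/-- The quadruple `(6t₀+1, 6t₁+1, 6t₂+1, -(6t₃+1))`. -/
def signedQuad (t : Fin 4 → ℕ) : Fin 4 → ℤ := fun i => (if i = 3 then -1 else 1) * (6 * t i + 1)

lemma natAbs_signedQuad (t : Fin 4 → ℕ) (i : Fin 4) : (signedQuad t i).natAbs = 6 * t i + 1 := by
  unfold signedQuad; split_ifs <;> omega

lemma isLocSolv_signedQuad {N : ℕ} {t : Fin 4 → ℕ} (ht : t ∈ spreadQuads N) :
    IsLocSolv (signedQuad t) := by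
  have hdvd : ∀ (p : ℕ) i, (p : ℤ) ∣ signedQuad t i ↔ p ∣ 6 * t i + 1 := fun p i => by
    rw [Int.natCast_dvd, natAbs_signedQuad]
  have htwo : ∀ p : ℕ, p.Prime → 3 ≤ p → ∃ i j, i ≠ j ∧ ¬ (p : ℤ) ∣ signedQuad t i ∧
      ¬ (p : ℤ) ∣ signedQuad t j := by
    intro p hp hp3
    simp only [hdvd]
    rcases Nat.lt_or_ge p 5 with h | h
    · interval_cases p
      · exact ⟨0, 1, by decide, by omega, by omega⟩
      · norm_num at hp
    · exact (mem_spreadQuads.1 ht).2 p hp h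
  refine ⟨⟨fun i => ?_, ?_⟩, ?_, fun p hp => ?_⟩
  · rw [← Int.natAbs_ne_zero, natAbs_signedQuad]; omega
  · by_contra hg
    have h1 : (Finset.univ.gcd (signedQuad t)).natAbs ≠ 1 := by
      intro h
      rw [← Finset.normalize_gcd, ← Int.abs_eq_normalize, Int.abs_eq_natAbs, h] at hg
      exact hg rfl
    obtain ⟨p, hp, hpd⟩ := Nat.exists_prime_and_dvd h1
    have h2 : ∀ i, (p : ℤ) ∣ signedQuad t i := fun i =>
      (Int.natCast_dvd.2 hpd).trans (Finset.gcd_dvd (Finset.mem_univ i))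
    rcases Nat.lt_or_ge p 3 with h | h
    · have : p = 2 := le_antisymm (by omega) hp.two_le
      subst this
      have := (hdvd 2 0).1 (h2 0)
      omega
    · obtain ⟨i, -, -, hi, -⟩ := htwo p hp h
      exact hi (h2 i)
  · rintro (h | h)
    · have := h 3
      simp only [signedQuad, if_true] at this
      omega
    · have := h 0
      simp only [signedQuad, show (0 : Fin 4) ≠ 3 by decide, if_false] at this
      omega
  · rcases Nat.lt_or_ge p 3 with h | h
    · have : p = 2 := le_antisymm (by omega) hp.two_le
      subst this
      have h1 : ∀ i, (signedQuad t i : ZMod 2) = 1 := by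
        intro i
        rw [show (1 : ZMod 2) = ((1 : ℤ) : ZMod 2) by norm_num, ZMod.intCast_eq_intCast_iff]
        simp only [Int.ModEq, signedQuad]
        split_ifs <;> omega
      refine ⟨1, ?_⟩
      simp only [h1]
      simp
      decide
    · obtain ⟨i, j, hij, hi, hj⟩ := htwo p hp h
      exact exists_unit_solution (a := fun s => (signedQuad t s : ZMod p)) hp h hij
        (by rwa [Ne, ZMod.intCast_zmod_eq_zero_iff_dvd _ p])
        (by rwa [Ne, ZMod.intCast_zmod_eq_zero_iff_dvd _ p])

lemma mem_box_of_znorm_le {A : ℝ} {a : Fin 4 → ℤ} (h : znorm a ≤ A) : a ∈ box ⌊A⌋₊ := by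
  refine mem_box.2 fun i => ?_
  have h1 : (((a i).natAbs : ℕ) : ℝ) ≤ A := by
    rw [Nat.cast_natAbs, Int.cast_abs, ← Real.sqrt_sq_eq_abs]
    refine (Real.sqrt_le_sqrt ?_).trans h
    exact Finset.single_le_sum (f := fun j => ((a j : ℝ)) ^ 2) (fun j _ => sq_nonneg _)
      (Finset.mem_univ i)
  rw [Int.abs_eq_natAbs]
  exact_mod_cast Nat.le_floor h1

lemma finite_llocSet (A : ℝ) : (LlocSet A).Finite :=
  (box ⌊A⌋₊).finite_toSet.subset fun _ ha => mem_box_of_znorm_le ha.2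

lemma znorm_le_of_abs_le {A : ℝ} (hA : 0 ≤ A) {a : Fin 4 → ℤ} (h : ∀ i, |(a i : ℝ)| ≤ A / 2) :
    znorm a ≤ A := by
  rw [znorm, Real.sqrt_le_left hA]
  calc ∑ i, (a i : ℝ) ^ 2 ≤ ∑ _i : Fin 4, (A / 2) ^ 2 :=
        Finset.sum_le_sum fun i _ => sq_le_sq' (abs_le.1 (h i)).1 (abs_le.1 (h i)).2
    _ = A ^ 2 := by simp; ring

lemma card_spreadQuads_le_ncard_llocSet {A : ℝ} (hA : 0 ≤ A) :
    (spreadQuads ⌊A / 12⌋₊).card ≤ (LlocSet A).ncard := by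
  rw [← Set.ncard_coe_finset]
  refine Set.ncard_le_ncard_of_injOn signedQuad (fun t ht => ?_) (fun t _ t' _ h => ?_)
    (finite_llocSet A)
  · rw [Finset.mem_coe] at ht
    refine ⟨isLocSolv_signedQuad ht, znorm_le_of_abs_le hA fun i => ?_⟩
    have h1 : (t i : ℝ) + 1 ≤ A / 12 := by
      have h2 : t i + 1 ≤ ⌊A / 12⌋₊ := (mem_spreadQuads.1 ht).1 i
      have h3 := (Nat.le_floor_iff (by positivity)).1 h2
      exact_mod_cast h3
    have h4 : |(signedQuad t i : ℝ)| = 6 * t i + 1 := by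
      rw [← Int.cast_abs, Int.abs_eq_natAbs, natAbs_signedQuad]
      push_cast; ring
    rw [h4]; linarith
  · funext i
    have h1 := natAbs_signedQuad t i
    rw [h, natAbs_signedQuad] at h1
    omega

lemma eventually_ncard_llocSet_ge : ∀ᶠ A : ℝ in atTop, A ^ 4 / 663552 ≤ (LlocSet A).ncard := by
  have hlim : Tendsto (fun A : ℝ => ⌊A / 12⌋₊) atTop atTop :=
    tendsto_nat_floor_atTop.comp (Filter.tendsto_id.atTop_div_const (by norm_num))
  filter_upwards [hlim.eventually eventually_card_spreadQuads_ge,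
    Filter.eventually_ge_atTop 24] with A h hA
  have h1 := Nat.lt_floor_add_one (A / 12)
  have h2 : A / 24 ≤ (⌊A / 12⌋₊ : ℝ) := by linarith
  calc A ^ 4 / 663552 = (A / 24) ^ 4 / 2 := by ring
    _ ≤ (⌊A / 12⌋₊ : ℝ) ^ 4 / 2 := by gcongr
    _ ≤ _ := h
    _ ≤ _ := by exact_mod_cast card_spreadQuads_le_ncard_llocSet (by linarith)

lemma eventually_ncard_not_smallSol_le {ε : ℝ} (hε : 0 < ε) : ∀ᶠ A : ℝ in atTop,
    ((LlocSet A \ {a | SmallSol a}).ncard : ℝ) ≤ ε * A ^ 4 := by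
  classical
  filter_upwards [tendsto_nat_floor_atTop.eventually (eventually_card_not_smallSol_le hε),
    Filter.eventually_ge_atTop 0] with A h hA
  have h1 : (LlocSet A \ {a | SmallSol a}).ncard ≤
      ((box ⌊A⌋₊).filter fun a => IsLocSolv a ∧ ¬ SmallSol a).card := by
    rw [← Set.ncard_coe_finset]
    refine Set.ncard_le_ncard (fun a ha => ?_) (Finset.finite_toSet _)
    exact Finset.mem_coe.2 (Finset.mem_filter.2 ⟨mem_box_of_znorm_le ha.1.2, ha.1.1, ha.2⟩)
  calc ((LlocSet A \ {a | SmallSol a}).ncard : ℝ) ≤ _ := Nat.cast_le.2 h1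
    _ ≤ ε * (⌊A⌋₊ : ℝ) ^ 4 := h
    _ ≤ ε * A ^ 4 := by gcongr; exact Nat.floor_le hA

end SmallPrimes

/-- Theorem 1.1: `ϱ(A) → 1` as `A → ∞`, where `ϱ(A)` is the proportion of
`a ∈ 𝕃^loc(A)` with `𝔪(a)³ ≤ |a|(log|a|)⁴(log log|a|)`. -/
theorem small_prime_solutions_density :
    Filter.Tendsto
      (fun A : ℝ => (Set.ncard {a | a ∈ LlocSet A ∧ SmallSol a} : ℝ) / (Set.ncard (LlocSet A) : ℝ))
      Filter.atTop (𝓝 1) := by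
  rw [Metric.tendsto_nhds]
  intro ε hε
  filter_upwards [SmallPrimes.eventually_ncard_llocSet_ge,
    SmallPrimes.eventually_ncard_not_smallSol_le (show 0 < ε / 2 / 663552 by positivity),
    Filter.eventually_gt_atTop 0] with A h1 h2 hA
  have h3 := Set.ncard_inter_add_ncard_sdiff_eq_ncard (LlocSet A) {a | SmallSol a}
    (SmallPrimes.finite_llocSet A)
  have h4 : {a | a ∈ LlocSet A ∧ SmallSol a} = LlocSet A ∩ {a | SmallSol a} := rfl
  have h5 : (0 : ℝ) < (LlocSet A).ncard := lt_of_lt_of_le (by positivity) h1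
  have h6 : ((LlocSet A ∩ {a | SmallSol a}).ncard : ℝ) +
      (LlocSet A \ {a | SmallSol a}).ncard = (LlocSet A).ncard := by exact_mod_cast h3
  rw [h4, Real.dist_eq, div_sub_one h5.ne', abs_div, abs_of_pos h5, div_lt_iff₀ h5,
    show ((LlocSet A ∩ {a | SmallSol a}).ncard : ℝ) - (LlocSet A).ncard =
      -(LlocSet A \ {a | SmallSol a}).ncard by linarith, abs_neg, Nat.abs_cast]
  have h7 : ε / 2 / 663552 * A ^ 4 = ε / 2 * (A ^ 4 / 663552) := by ring
  have h8 : ε / 2 * (A ^ 4 / 663552) ≤ ε / 2 * (LlocSet A).ncard := by gcongr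
  have h9 : 0 < ε * (LlocSet A).ncard := by positivity
  linarith
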